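/- Splitting Lemma (local coordinate form). Let (g, L) be a compatible pair on an open set U ⊆ ℝ^n and let p ∈ U. Suppose there are smooth functions λ_1, …, λ_r : U → ℂ with Im λ_i(x) ≠ 0 for all x, and smooth functions λ_{r+1}, …, λ_k : U → ℝ, such that for every x ∈ U the complex eigenvalues of L(x) are exactly λ_1(x), conj λ_1(x), …, λ_r(x), conj λ_r(x), λ_{r+1}(x), …, λ_k(x), these are pairwise distinct, and their algebraic multiplicities m_1, m_1, …, m_r, m_r, m_{r+1}, …, m_k do not depend on x (so 2m_1 + … + 2m_r + m_{r+1} + … + m_k = n). For i ≤ r put χ_i(t,x) := ((t − λ_i(x))(t − conj λ_i(x)))^{m_i}, for i > r put χ_i(t,x) := (t − λ_i(x))^{m_i}, let χ := χ_1⋯χ_k (the characteristic polynomial of L), χ̂ := Σ_{i=1}^k χ/χ_i, and define h(x) := g(x)·(χ̂(L(x)))^{-1}. Then h(x) is symmetric and invertible, and there exist an open set W ⊆ ℝ^n and a smooth diffeomorphism φ from W onto an open subset of U containing p such that, partitioning the coordinates of W into consecutive groups of sizes 2m_1, …, 2m_r, m_{r+1}, …, m_k, the pullbacks ĥ := (Dφ)ᵀ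 (h∘φ) (Dφ) and L̂ := (Dφ)^{-1} (L∘φ) (Dφ) are block diagonal with blocks ĥ_i, L̂_i of sizes matching the groups; the entries of ĥ_i and L̂_i depend only on the coordinates of the i-th group; the complex eigenvalues of L̂_i are λ_i∘φ and conj λ_i∘φ (for i ≤ r), respectively λ_i∘φ (for i > r); and, regarded as smooth matrix-valued maps of the i-th group of coordinates, each L̂_i is compatible with ĥ_i. -/

import Mathlib

open Matrix Polynomial

noncomputable def pd {ι : Type*} [Fintype ι] [DecidableEq ι] (i : ι)
    (f : (ι → ℝ) → ℝ) (x : ι → ℝ) : ℝ :=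
  fderiv ℝ f x (Pi.single i 1)

noncomputable def christoffel {ι : Type*} [Fintype ι] [DecidableEq ι]
    (g : (ι → ℝ) → Matrix ι ι ℝ) (x : ι → ℝ) (l j k : ι) : ℝ :=
  (1/2) * ∑ m, (g x)⁻¹ l m *
    (pd j (fun y => g y m k) x + pd k (fun y => g y m j) x - pd m (fun y => g y j k) x)

def IsCompatiblePair {ι : Type*} [Fintype ι] [DecidableEq ι]
    (U : Set (ι → ℝ)) (g L : (ι → ℝ) → Matrix ι ι ℝ) : Prop :=
  (∀ i j : ι, ContDiffOn ℝ (⊤ : ℕ∞) (fun y => g y i j) U) ∧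
  (∀ i j : ι, ContDiffOn ℝ (⊤ : ℕ∞) (fun y => L y i j) U) ∧
  (∀ x ∈ U, (g x).IsSymm ∧ IsUnit (g x).det ∧ IsUnit (L x).det ∧ (g x * L x).IsSymm) ∧
  (∀ x ∈ U, ∀ i j k : ι,
    pd k (fun y => (g y * L y) i j) x
      - (∑ l, christoffel g x l k i * (g x * L x) l j)
      - (∑ l, christoffel g x l k j * (g x * L x) i l)
    = pd i (fun y => (1/2) * (L y).trace) x * g x j k
      + pd j (fun y => (1/2) * (L y).trace) x * g x i k)

/-- The Jacobian matrix of a map between coordinate spaces. -/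
noncomputable def jacM {ι κ : Type*} [Fintype ι] [DecidableEq ι] [Fintype κ]
    (φ : (ι → ℝ) → (κ → ℝ)) (x : ι → ℝ) : Matrix κ ι ℝ :=
  fun c a => fderiv ℝ (fun y => φ y c) x (Pi.single a 1)

section PartP1
section SplitAlgebra
variable {V : Type*} [NormedAddCommGroup V] [NormedSpace ℝ V]

/-- Trace of a continuous endomorphism. -/
noncomputable def ctr (T : V →L[ℝ] V) : ℝ := LinearMap.trace ℝ V (T : V →ₗ[ℝ] V)

lemma ctr_add (S T : V →L[ℝ] V) : ctr (S + T) = ctr S + ctr T := by simp [ctr]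
lemma ctr_sub (S T : V →L[ℝ] V) : ctr (S - T) = ctr S - ctr T := by simp [ctr]
lemma ctr_neg (T : V →L[ℝ] V) : ctr (-T) = - ctr T := by simp [ctr]
lemma ctr_smul (c : ℝ) (T : V →L[ℝ] V) : ctr (c • T) = c * ctr T := by simp [ctr]
lemma ctr_comm (S T : V →L[ℝ] V) : ctr (S * T) = ctr (T * S) := by
  unfold ctr
  exact LinearMap.trace_mul_comm ℝ (S : V →ₗ[ℝ] V) (T : V →ₗ[ℝ] V)

/-- The vanishing of the Nijenhuis torsion at a point. -/
def Nij (L : V →L[ℝ] V) (DL : V →L[ℝ] V →L[ℝ] V) : Prop :=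
  ∀ X Y, DL (L X) Y - DL (L Y) X - L (DL X Y) + L (DL Y X) = 0

/-- The compatibility defect at a point. -/
noncomputable def Edef (G : V →L[ℝ] V →L[ℝ] ℝ) (DG : V →L[ℝ] V →L[ℝ] V →L[ℝ] ℝ)
    (L : V →L[ℝ] V) (DL : V →L[ℝ] V →L[ℝ] V) (X Y Z : V) : ℝ :=
  G X (DL Z Y) + G Y (DL Z X) - (DG X (L Y) Z - DG (L Y) X Z)
    - (DG Y (L X) Z - DG (L X) Y Z) - ctr (DL X) * G Y Z - ctr (DL Y) * G X Z

variable {G : V →L[ℝ] V →L[ℝ] ℝ} {DG : V →L[ℝ] V →L[ℝ] V →L[ℝ] ℝ}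
    {L : V →L[ℝ] V} {DL : V →L[ℝ] V →L[ℝ] V}

lemma nij_of_edef (hs : ∀ X Y, G X Y = G Y X) (hL : ∀ X Y, G (L X) Y = G X (L Y))
    (hDs : ∀ Z X Y, DG Z X Y = DG Z Y X)
    (hDL : ∀ Z X Y, DG Z (L X) Y + G (DL Z X) Y = DG Z X (L Y) + G X (DL Z Y))
    (hnd : ∀ N, (∀ W, G W N = 0) → N = 0)
    (hE : ∀ X Y Z, Edef G DG L DL X Y Z = 0) : Nij L DL := by
  intro X Y
  apply hnd
  intro W
  simp only [map_add, map_sub]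
  have key : ∀ W Z Y, 2 * G W (DL Z Y) =
      (DG W (L Y) Z - DG (L Y) W Z) + (DG Y (L W) Z - DG (L W) Y Z)
      + ctr (DL W) * G Y Z + ctr (DL Y) * G W Z - (DG Z W (L Y) - DG Z (L W) Y) := by
    intro W Z Y
    have h1 := hE W Y Z
    have h2 := hDL Z W Y
    have h3 := hs Y (DL Z W)
    unfold Edef at h1
    linarith
  have k1 := key W (L X) Y
  have k2 := key W (L Y) X
  have k3 := key (L W) X Y
  have k4 := key (L W) Y X
  have e1 := hL W (DL X Y)
  have e2 := hL W (DL Y X)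
  have s1 : G Y (L X) = G X (L Y) := by rw [← hL, hs]
  have s2 : G (L W) X = G W (L X) := hL W X
  have s3 : G (L W) Y = G W (L Y) := hL W Y
  have s4 := hs X Y
  rw [s1] at k1
  rw [s2] at k3
  rw [s3] at k4
  rw [s4] at k4
  have d1 := hDs W (L Y) (L X)
  have d2 := hDs (L W) X (L Y)
  have d3 := hDs (L W) Y (L X)
  have d4 := hDs (L (L W)) X Y
  have d5 := hDs (L X) (L W) Y
  have d6 := hDs (L Y) (L W) X
  have d7 := hDs X (L W) (L Y)
  have d8 := hDs Y (L W) (L X)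
  have d9 := hDs X (L (L W)) Y
  have d10 := hDs Y (L (L W)) X
  linarith

lemma edef_mul (hs : ∀ X Y, G X Y = G Y X) (hL : ∀ X Y, G (L X) Y = G X (L Y))
    (hN : Nij L DL)
    {G' : V →L[ℝ] V →L[ℝ] ℝ} {DG' : V →L[ℝ] V →L[ℝ] V →L[ℝ] ℝ}
    (hG' : ∀ X Y, G' X Y = G X (L Y))
    (hDG' : ∀ Z X Y, DG' Z X Y = DG Z X (L Y) + G X (DL Z Y))
    (X Y Z : V) : Edef G' DG' L DL X Y Z = Edef G DG L DL X Y (L Z) := by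
  unfold Edef
  simp only [hG', hDG']
  have n1 : G X (DL (L Y) Z) - G X (DL (L Z) Y) - G X (L (DL Y Z)) + G X (L (DL Z Y)) = 0 := by
    have := congrArg (G X) (hN Y Z)
    simpa only [map_add, map_sub, map_zero] using this
  have n2 : G Y (DL (L X) Z) - G Y (DL (L Z) X) - G Y (L (DL X Z)) + G Y (L (DL Z X)) = 0 := by
    have := congrArg (G Y) (hN X Z)
    simpa only [map_add, map_sub, map_zero] using this
  have e1 := hL Y (DL X Z)
  have e2 := hL X (DL Y Z)
  linarith

end SplitAlgebra
end PartP1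

section PartP2
section Covariance
variable {V : Type*} [NormedAddCommGroup V] [NormedSpace ℝ V]
variable {V' : Type*} [NormedAddCommGroup V'] [NormedSpace ℝ V']

lemma ctr_conj (J : V' ≃L[ℝ] V) (T : V →L[ℝ] V) :
    ctr ((J.symm : V →L[ℝ] V').comp (T.comp (J : V' →L[ℝ] V))) = ctr T := by
  unfold ctr
  have := LinearMap.trace_conj' (T : V →ₗ[ℝ] V) (J.symm.toLinearEquiv)
  rw [← this]
  rfl

variable {G : V →L[ℝ] V →L[ℝ] ℝ} {DG : V →L[ℝ] V →L[ℝ] V →L[ℝ] ℝ}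
    {L : V →L[ℝ] V} {DL : V →L[ℝ] V →L[ℝ] V}
    {G' : V' →L[ℝ] V' →L[ℝ] ℝ} {DG' : V' →L[ℝ] V' →L[ℝ] V' →L[ℝ] ℝ}
    {L' : V' →L[ℝ] V'} {DL' : V' →L[ℝ] V' →L[ℝ] V'}

lemma edef_pullback (J : V' ≃L[ℝ] V) (B : V' →L[ℝ] V' →L[ℝ] V) (hB : ∀ X Y, B X Y = B Y X)
    (hs : ∀ X Y, G X Y = G Y X) (hLs : ∀ X Y, G (L X) Y = G X (L Y))
    (hL : ∀ X, J (L' X) = L (J X))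
    (hDL : ∀ Z Y, B Z (L' Y) + J (DL' Z Y) = DL (J Z) (J Y) + L (B Z Y))
    (hG : ∀ X Y, G' X Y = G (J X) (J Y))
    (hDG : ∀ X Y Z, DG' X Y Z = DG (J X) (J Y) (J Z) + G (B X Y) (J Z) + G (J Y) (B X Z))
    (X Y Z : V') : Edef G' DG' L' DL' X Y Z = Edef G DG L DL (J X) (J Y) (J Z) := by
  have htr : ∀ Z, ctr (DL' Z) = ctr (DL (J Z)) := by
    intro Z
    let A : V' →L[ℝ] V' := (J.symm : V →L[ℝ] V').comp (B Z)
    have h1 : DL' Z = (J.symm : V →L[ℝ] V').comp ((DL (J Z)).comp (J : V' →L[ℝ] V))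
        + L' * A - A * L' := by
      ext Y
      have h2 := hDL Z Y
      have h3 : L (B Z Y) = J (L' (J.symm (B Z Y))) := by rw [hL]; simp
      have h4 : J (DL' Z Y) = DL (J Z) (J Y) + J (L' (J.symm (B Z Y))) - B Z (L' Y) := by
        rw [← h3, ← h2]; abel
      have h5 := congrArg J.symm h4
      simpa [A] using h5
    rw [h1, ctr_sub, ctr_add, ctr_conj, ctr_comm L' A]; ring
  have key : ∀ W Z Y, G W (J (DL' Z Y)) = G W (DL (J Z) (J Y)) + G (L W) (B Z Y)
      - G W (B Z (L' Y)) := by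
    intro W Z Y
    have h2 := congrArg (G W) (hDL Z Y)
    simp only [map_add] at h2
    rw [hLs]; linarith
  unfold Edef
  simp only [hG, hDG, htr, key, hL]
  have b1 := hB X (L' Y)
  have b2 := hB Y (L' X)
  have b3 := hB Z (L' Y)
  have b4 := hB Z (L' X)
  have b5 := hB X Z
  have b6 := hB Y Z
  simp only [b1, b2, b3, b4, b5, b6]
  ring

end Covariance

section Fields
variable {V : Type*} [NormedAddCommGroup V] [NormedSpace ℝ V]
variable {V' : Type*} [NormedAddCommGroup V'] [NormedSpace ℝ V']

noncomputable def EF (G : V → V →L[ℝ] V →L[ℝ] ℝ) (L : V → V →L[ℝ] V) (x : V) (X Y Z : V) : ℝ :=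
  Edef (G x) (fderiv ℝ G x) (L x) (fderiv ℝ L x) X Y Z

open Filter Topology

lemma fderiv_clm_apply' {E F H : Type*} [NormedAddCommGroup E] [NormedSpace ℝ E]
    [NormedAddCommGroup F] [NormedSpace ℝ F] [NormedAddCommGroup H] [NormedSpace ℝ H]
    {c : E → F →L[ℝ] H} {x : E} (hc : DifferentiableAt ℝ c x) (v : F) (Z : E) :
    fderiv ℝ (fun y => c y v) x Z = fderiv ℝ c x Z v := by
  have := (hc.hasFDerivAt.clm_apply (hasFDerivAt_const v x)).fderiv
  rw [this]; simp

/-- Differentiated symmetry relations. -/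
lemma dsymm {G : V → V →L[ℝ] V →L[ℝ] ℝ} {x : V} (hG : DifferentiableAt ℝ G x)
    (hs : ∀ᶠ y in 𝓝 x, ∀ X Y, G y X Y = G y Y X) (Z X Y : V) :
    fderiv ℝ G x Z X Y = fderiv ℝ G x Z Y X := by
  have h1 : (fun y => G y X Y) =ᶠ[𝓝 x] fun y => G y Y X := hs.mono fun y h => h X Y
  have h2 := congrArg (fun T => T Z) (h1.fderiv_eq (𝕜 := ℝ))
  have a : ∀ X Y, fderiv ℝ (fun y => G y X Y) x Z = fderiv ℝ G x Z X Y := by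
    intro X Y
    rw [fderiv_clm_apply' (hG.clm_apply (differentiableAt_const X)), fderiv_clm_apply' hG]
  simpa [a] using h2

lemma dself {G : V → V →L[ℝ] V →L[ℝ] ℝ} {L : V → V →L[ℝ] V} {x : V}
    (hG : DifferentiableAt ℝ G x) (hL : DifferentiableAt ℝ L x)
    (hs : ∀ᶠ y in 𝓝 x, ∀ X Y, G y (L y X) Y = G y X (L y Y)) (Z X Y : V) :
    fderiv ℝ G x Z (L x X) Y + G x (fderiv ℝ L x Z X) Y
      = fderiv ℝ G x Z X (L x Y) + G x X (fderiv ℝ L x Z Y) := by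
  have h1 : (fun y => G y (L y X) Y) =ᶠ[𝓝 x] fun y => G y X (L y Y) := hs.mono fun y h => h X Y
  have h2 := congrArg (fun T => T Z) (h1.fderiv_eq (𝕜 := ℝ))
  have a1 := ((hG.hasFDerivAt.clm_apply (hL.hasFDerivAt.clm_apply
    (hasFDerivAt_const X x))).clm_apply (hasFDerivAt_const Y x)).fderiv
  have a2 := ((hG.hasFDerivAt.clm_apply (hasFDerivAt_const X x)).clm_apply
    (hL.hasFDerivAt.clm_apply (hasFDerivAt_const Y x))).fderiv
  rw [a1, a2] at h2
  simp at h2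
  linarith

lemma nij_of_EF {G : V → V →L[ℝ] V →L[ℝ] ℝ} {L : V → V →L[ℝ] V} {x : V}
    (hG : DifferentiableAt ℝ G x) (hL : DifferentiableAt ℝ L x)
    (hs : ∀ᶠ y in 𝓝 x, ∀ X Y, G y X Y = G y Y X)
    (hLs : ∀ᶠ y in 𝓝 x, ∀ X Y, G y (L y X) Y = G y X (L y Y))
    (hnd : ∀ N, (∀ W, G x W N = 0) → N = 0)
    (hE : ∀ X Y Z, EF G L x X Y Z = 0) : Nij (L x) (fderiv ℝ L x) :=
  nij_of_edef hs.self_of_nhds hLs.self_of_nhds (dsymm hG hs) (dself hG hL hLs) hnd hE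

lemma EF_pullback {G : V → V →L[ℝ] V →L[ℝ] ℝ} {L : V → V →L[ℝ] V}
    {G' : V' → V' →L[ℝ] V' →L[ℝ] ℝ} {L' : V' → V' →L[ℝ] V'} {φ : V' → V} {x : V'}
    (hφ : ContDiffAt ℝ 2 φ x) (J : V' ≃L[ℝ] V) (hJ : (J : V' →L[ℝ] V) = fderiv ℝ φ x)
    (hG : DifferentiableAt ℝ G (φ x)) (hL : DifferentiableAt ℝ L (φ x))
    (hG'd : DifferentiableAt ℝ G' x) (hL'd : DifferentiableAt ℝ L' x)
    (hs : ∀ X Y, G (φ x) X Y = G (φ x) Y X)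
    (hLs : ∀ X Y, G (φ x) (L (φ x) X) Y = G (φ x) X (L (φ x) Y))
    (hG' : ∀ᶠ y in 𝓝 x, ∀ X Y, G' y X Y = G (φ y) (fderiv ℝ φ y X) (fderiv ℝ φ y Y))
    (hL' : ∀ᶠ y in 𝓝 x, ∀ X, fderiv ℝ φ y (L' y X) = L (φ y) (fderiv ℝ φ y X))
    (X Y Z : V') : EF G' L' x X Y Z = EF G L (φ x) (J X) (J Y) (J Z) := by
  have hφ1 : HasFDerivAt φ (fderiv ℝ φ x) x := (hφ.differentiableAt (by norm_num)).hasFDerivAt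
  have hφ2 : HasFDerivAt (fderiv ℝ φ) (fderiv ℝ (fderiv ℝ φ) x) x :=
    ((hφ.fderiv_right (m := 1) (by norm_num)).differentiableAt (by norm_num)).hasFDerivAt
  have hJ' : ∀ X, J X = fderiv ℝ φ x X := fun X => by rw [← hJ]; rfl
  have hsym : IsSymmSndFDerivAt ℝ φ x := hφ.isSymmSndFDerivAt (by simp)
  have hGφ : HasFDerivAt (fun y => G (φ y)) ((fderiv ℝ G (φ x)).comp (fderiv ℝ φ x)) x :=
    HasFDerivAt.comp (g := G) x hG.hasFDerivAt hφ1
  have hLφ : HasFDerivAt (fun y => L (φ y)) ((fderiv ℝ L (φ x)).comp (fderiv ℝ φ x)) x :=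
    HasFDerivAt.comp (g := L) x hL.hasFDerivAt hφ1
  apply edef_pullback J (fderiv ℝ (fderiv ℝ φ) x) (fun X Y => hsym.eq X Y) hs hLs
  · intro X; rw [hJ', hJ']; exact hL'.self_of_nhds X
  · intro Z Y
    have h1 : (fun y => fderiv ℝ φ y (L' y Y)) =ᶠ[𝓝 x] fun y => L (φ y) (fderiv ℝ φ y Y) :=
      hL'.mono fun y h => h Y
    have h2 := congrArg (fun T => T Z) (h1.fderiv_eq (𝕜 := ℝ))
    have a1 := (hφ2.clm_apply (hL'd.hasFDerivAt.clm_apply (hasFDerivAt_const Y x))).fderiv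
    have a2 := (hLφ.clm_apply (hφ2.clm_apply (hasFDerivAt_const Y x))).fderiv

    rw [a1, a2] at h2
    simp at h2
    simp only [hJ']
    rw [add_comm, h2, add_comm]
  · intro X Y; rw [hJ', hJ']; exact hG'.self_of_nhds X Y
  · intro X Y Z
    have h1 : (fun y => G' y Y Z) =ᶠ[𝓝 x]
      fun y => G (φ y) (fderiv ℝ φ y Y) (fderiv ℝ φ y Z) := hG'.mono fun y h => h Y Z
    have h2 := congrArg (fun T => T X) (h1.fderiv_eq (𝕜 := ℝ))
    have a1 := ((hG'd.hasFDerivAt.clm_apply (hasFDerivAt_const Y x)).clm_apply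
      (hasFDerivAt_const Z x)).fderiv
    have a2 := ((hGφ.clm_apply (hφ2.clm_apply (hasFDerivAt_const Y x))).clm_apply
      (hφ2.clm_apply (hasFDerivAt_const Z x))).fderiv

    rw [a1, a2] at h2
    simp at h2
    simp only [hJ']
    linarith

end Fields
end PartP2

section PartP3
section Sylv
variable {V W : Type*} [NormedAddCommGroup V] [NormedSpace ℝ V]
  [NormedAddCommGroup W] [NormedSpace ℝ W]

lemma intertwine (σ : V →L[ℝ] W) (A : V →L[ℝ] V) (B : W →L[ℝ] W)
    (h : ∀ X, σ (A X) = B (σ X)) (q : ℝ[X]) (X : V) :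
    σ (aeval A q X) = aeval B q (σ X) := by
  induction q using Polynomial.induction_on' generalizing X with
  | add p q hp hq => simp [hp, hq]
  | monomial n a =>
    simp only [aeval_monomial, ContinuousLinearMap.mul_apply,
      Algebra.algebraMap_eq_smul_one, smul_mul_assoc, one_mul, ContinuousLinearMap.smul_apply,
      map_smul]
    congr 1
    induction n generalizing X with
    | zero => simp
    | succ n ih => rw [pow_succ, pow_succ, ContinuousLinearMap.mul_apply, ih, h]; rfl

lemma sylv_zero (σ : V →L[ℝ] W) (A : V →L[ℝ] V) (B : W →L[ℝ] W)
    (h : ∀ X, σ (A X) = B (σ X)) (q : ℝ[X]) (h0 : ∀ X, aeval B q (σ X) = 0)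
    (Y X : V) (hX : σ X = σ (aeval A q Y)) : σ X = 0 := by
  rw [hX, intertwine σ A B h, h0]

lemma frob_condition {L P : V →L[ℝ] V} {DL DP : V →L[ℝ] V →L[ℝ] V}
    (hPL : ∀ X, P (L X) = L (P X))
    (hDP : ∀ X Y, DP X (P Y) + P (DP X Y) = DP X Y)
    (hDPL : ∀ X Y, DP X (L Y) + P (DL X Y) = DL X (P Y) + L (DP X Y))
    (hPP : ∀ X, P (P X) = P X)
    (hN : Nij L DL) (q : ℝ[X]) (hq : ∀ X, aeval L q (P X) = 0)
    (hu : ∀ X, P X = 0 → ∃ Y, aeval L q Y = X ∧ P Y = 0)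
    (X Y : V) (hX : P X = 0) (hY : P Y = 0) : DP X Y = DP Y X := by
  let Q : V →L[ℝ] V := 1 - P
  have hQ : ∀ X, Q X = X - P X := fun X => by simp [Q]
  have hPQ : ∀ X, P (Q X) = 0 := fun X => by simp [hQ, hPP]
  have hQL : ∀ X, Q (L X) = L (Q X) := fun X => by simp [hQ, hPL]
  have hQ0 : ∀ X, P X = 0 → Q X = X := fun X h => by simp [hQ, h]
  have hL0 : ∀ X, P X = 0 → P (L X) = 0 := fun X h => by rw [hPL, h, map_zero]
  -- the curvature
  let τ : V →L[ℝ] V →L[ℝ] V := DP - DP.flip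
  have hτ : ∀ X Y, τ X Y = DP X Y - DP Y X := fun X Y => by simp [τ]
  have hτP : ∀ X Y, P X = 0 → P Y = 0 → P (τ X Y) = τ X Y := by
    intro X Y hX hY
    have h1 := hDP X Y
    have h2 := hDP Y X
    rw [hY, map_zero, zero_add] at h1
    rw [hX, map_zero, zero_add] at h2
    rw [hτ, map_sub, h1, h2]
  have hqP : ∀ Z, P Z = Z → aeval L q Z = 0 := fun Z h => by rw [← h, hq]
  have hmain : ∀ X Y, P X = 0 → P Y = 0 →
      τ (L X) (L Y) - L (τ X (L Y)) = L (τ (L X) Y - L (τ X Y)) := by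
    intro X Y hX hY
    have key : ∀ X Y, P Y = 0 → P (DL X Y) = L (DP X Y) - DP X (L Y) := by
      intro X Y hY
      have := hDPL X Y
      rw [hY, map_zero, zero_add] at this
      rw [← this]; abel
    have h1 := congrArg P (hN X Y)
    simp only [map_add, map_sub, map_zero, hPL] at h1
    rw [key _ _ hY, key _ _ hX, key _ _ hY, key _ _ hX] at h1
    simp only [map_sub] at h1
    simp only [hτ, map_sub]
    rw [← sub_eq_zero, ← neg_eq_zero, ← h1]
    abel
  have hstep : ∀ X Y, P X = 0 → P Y = 0 → τ (L X) Y = L (τ X Y) := by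
    intro X Y hX hY
    let σ : V →L[ℝ] V := (τ (L X)) * Q - L * (τ X) * Q
    have hσ : ∀ Y, σ Y = τ (L X) (Q Y) - L (τ X (Q Y)) := fun Y => by simp [σ]
    obtain ⟨Z, hZ, hPZ⟩ := hu Y hY
    have := sylv_zero σ L L (fun Y => by
      rw [hσ, hσ, hQL]; exact hmain X (Q Y) hX (hPQ Y)) q (fun Y => by
      apply hqP
      rw [hσ, map_sub, hPL, hτP _ _ (hL0 _ hX) (hPQ _), hτP _ _ hX (hPQ _)]) Z Y (by rw [hZ])
    rw [hσ, hQ0 _ hY] at this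
    exact sub_eq_zero.mp this
  let ρ : V →L[ℝ] V := (τ.flip Y) * Q
  have hρ : ∀ X, ρ X = τ (Q X) Y := fun X => by simp [ρ]
  obtain ⟨Z, hZ, hPZ⟩ := hu X hX
  have := sylv_zero ρ L L (fun X => by
    rw [hρ, hρ, hQL]; exact hstep _ _ (hPQ X) hY) q (fun X => by
    apply hqP; rw [hρ, hτP _ _ (hPQ _) hY]) Z X (by rw [hZ])
  rw [hρ, hQ0 _ hX, hτ] at this
  exact sub_eq_zero.mp this

end Sylv
end PartP3

section PartP4
section InvFun
open Filter Topology
variable {E F : Type*} [NormedAddCommGroup E] [NormedSpace ℝ E] [CompleteSpace E]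
  [NormedAddCommGroup F] [NormedSpace ℝ F]

lemma inv_fun_smooth {f : E → F} {s : Set E} (hs : IsOpen s) {a : E} (ha : a ∈ s)
    (hf : ContDiffOn ℝ (⊤ : ℕ∞) f s) (f' : E ≃L[ℝ] F) (hf' : HasFDerivAt f (f' : E →L[ℝ] F) a) :
    ∃ e : OpenPartialHomeomorph E F, (∀ x, e x = f x) ∧ a ∈ e.source ∧ e.source ⊆ s ∧
      (∀ x ∈ e.source, ∃ J : E ≃L[ℝ] F, HasFDerivAt f (J : E →L[ℝ] F) x) ∧
      ContDiffOn ℝ (⊤ : ℕ∞) e.symm e.target := by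
  have hat : ∀ x ∈ s, ContDiffAt ℝ (⊤ : ℕ∞) f x := fun x hx => hf.contDiffAt (hs.mem_nhds hx)
  have hne : ((⊤ : ℕ∞) : WithTop ℕ∞) ≠ 0 := by simp
  let e0 := (hat a ha).toOpenPartialHomeomorph f hf' hne
  let t : Set E := s ∩ (fderiv ℝ f) ⁻¹' (Set.range ((↑) : (E ≃L[ℝ] F) → (E →L[ℝ] F)))
  have ht : IsOpen t := by
    apply ContinuousOn.isOpen_inter_preimage _ hs (ContinuousLinearEquiv.isOpen)
    exact hf.continuousOn_fderiv_of_isOpen hs (by simp)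
  have hat' : a ∈ t := ⟨ha, ⟨f', hf'.fderiv.symm⟩⟩
  have hJ : ∀ x ∈ t, ∃ J : E ≃L[ℝ] F, HasFDerivAt f (J : E →L[ℝ] F) x := by
    rintro x ⟨hx, ⟨J, hJ⟩⟩
    refine ⟨J, ?_⟩
    have := ((hat x hx).differentiableAt hne).hasFDerivAt
    rwa [← hJ] at this
  refine ⟨e0.restrOpen t ht, fun x => rfl, ?_, ?_, ?_, ?_⟩
  · exact ⟨(hat a ha).mem_toOpenPartialHomeomorph_source hf' hne, hat'⟩
  · rintro x ⟨_, hx⟩; exact hx.1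
  · rintro x ⟨_, hx⟩; exact hJ x hx
  · intro y hy
    have hx := (e0.restrOpen t ht).map_target hy
    obtain ⟨J, hJ⟩ := hJ _ hx.2
    exact ((e0.restrOpen t ht).contDiffAt_symm hy hJ (hat _ hx.2.1)).contDiffWithinAt

end InvFun

section Superposition
open Filter Topology
variable {K : Type} [TopologicalSpace K] [CompactSpace K]
  {V F : Type} [NormedAddCommGroup V] [NormedSpace ℝ V]
  [NormedAddCommGroup F] [NormedSpace ℝ F]

/-- Pointwise application of an operator valued continuous map. -/
noncomputable def mulOp (K V F : Type) [TopologicalSpace K] [CompactSpace K]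
    [NormedAddCommGroup V] [NormedSpace ℝ V] [NormedAddCommGroup F] [NormedSpace ℝ F] :
    C(K, V →L[ℝ] F) →L[ℝ] C(K, V) →L[ℝ] C(K, F) :=
  LinearMap.mkContinuous₂
    (LinearMap.mk₂ ℝ (fun (a : C(K, V →L[ℝ] F)) (v : C(K, V)) => (⟨fun t => a t (v t), by fun_prop⟩ : C(K, F)))
      (by intros; ext; simp) (by intros; ext; simp) (by intros; ext; simp)
      (by intros; ext; simp)) 1 (by
    intro a v
    rw [ContinuousMap.norm_le _ (by positivity)]
    intro t
    rw [one_mul]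
    exact ((a t).le_opNorm (v t)).trans (mul_le_mul (a.norm_coe_le_norm t)
      (v.norm_coe_le_norm t) (by positivity) (by positivity)))

@[simp] lemma mulOp_apply (a : C(K, V →L[ℝ] F)) (v : C(K, V)) (t : K) :
    mulOp K V F a v t = a t (v t) := rfl

lemma hasFDerivAt_sup {f : V → F} (hf : ContDiff ℝ 1 f) (u : C(K, V)) :
    HasFDerivAt (fun u : C(K, V) => (ContinuousMap.mk f hf.continuous).comp u)
      (mulOp K V F ((ContinuousMap.mk (fderiv ℝ f) (hf.continuous_fderiv (by simp))).comp u)) u := by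
  rw [hasFDerivAt_iff_isLittleO, Asymptotics.isLittleO_iff]
  intro ε hε
  have hc : Continuous (fderiv ℝ f) := hf.continuous_fderiv (by simp)
  have hK : IsCompact (Set.range u) := isCompact_range u.continuous
  have hu := hK.uniformContinuousAt_of_continuousAt (fderiv ℝ f)
    (fun x _ => hc.continuousAt) (Metric.dist_mem_uniformity hε)
  obtain ⟨δ, hδ, hδ'⟩ := Metric.mem_uniformity_dist.mp hu
  filter_upwards [Metric.ball_mem_nhds u hδ] with w hw
  rw [ContinuousMap.norm_le _ (by positivity)]
  intro t
  have hwt : w t ∈ Metric.ball (u t) δ := lt_of_le_of_lt (ContinuousMap.dist_apply_le_dist t) hw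
  have := (convex_ball (u t) δ).norm_image_sub_le_of_norm_fderiv_le' (f := f) (𝕜 := ℝ)
    (φ := fderiv ℝ f (u t)) (C := ε)
    (fun x _ => hf.differentiable (by simp) x) (fun x hx => by
      have := hδ' (a := u t) (b := x) (by rw [dist_comm]; exact hx) ⟨t, rfl⟩
      simp only [Set.mem_setOf_eq] at this
      rw [← dist_eq_norm, dist_comm]; exact this.le) (Metric.mem_ball_self hδ) hwt
  calc _ = ‖f (w t) - f (u t) - fderiv ℝ f (u t) (w t - u t)‖ := by simp
    _ ≤ ε * ‖w t - u t‖ := this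
    _ ≤ ε * ‖w - u‖ := by
      gcongr
      exact (w - u).norm_coe_le_norm t

lemma contDiff_sup_nat (n : ℕ) : ∀ {F : Type} [NormedAddCommGroup F] [NormedSpace ℝ F]
    {f : V → F} (hf : ContDiff ℝ n f),
    ContDiff ℝ n (fun u : C(K, V) => (ContinuousMap.mk f hf.continuous).comp u) := by
  induction n with
  | zero =>
    intro F _ _ f hf
    exact contDiff_zero.mpr (ContinuousMap.continuous_postcomp _)
  | succ n ih =>
    intro F _ _ f hf
    have h1 : ContDiff ℝ 1 f := hf.of_le (by norm_cast; omega)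
    have hd : ContDiff ℝ n (fderiv ℝ f) := hf.fderiv_right (by norm_cast)
    have := fun u => hasFDerivAt_sup (K := K) h1 u
    have key : ContDiff ℝ (n + 1) (fun u : C(K, V) => (ContinuousMap.mk f h1.continuous).comp u) := by
      refine (contDiff_succ_iff_hasFDerivAt).mpr ⟨_, ?_, this⟩
      exact (mulOp K V F).contDiff.comp (ih hd)
    exact_mod_cast key

lemma contDiff_sup {f : V → F} (hf : ContDiff ℝ (⊤ : ℕ∞) f) :
    ContDiff ℝ (⊤ : ℕ∞) (fun u : C(K, V) => (ContinuousMap.mk f hf.continuous).comp u) := by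
  rw [contDiff_infty]
  intro n
  exact contDiff_sup_nat n (hf.of_le (by exact_mod_cast le_top))

end Superposition
end PartP4

section PartP5
section Frob
open Filter Topology unitInterval
variable {V : Type} [NormedAddCommGroup V] [NormedSpace ℝ V] [CompleteSpace V]

/-- Extension of a path by constants. -/
noncomputable def extI (u : C(I, V)) : ℝ → V := Set.IccExtend (zero_le_one' ℝ) u

lemma extI_cont (u : C(I, V)) : Continuous (extI u) := u.continuous.Icc_extend'

lemma extI_coe (u : C(I, V)) (t : I) : extI u t = u t := by simp [extI]

/-- The integration operator on paths. -/
noncomputable def Jop (V : Type) [NormedAddCommGroup V] [NormedSpace ℝ V] [CompleteSpace V] :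
    C(I, V) →L[ℝ] C(I, V) :=
  LinearMap.mkContinuous
    { toFun := fun u => ⟨fun t => ∫ s in (0:ℝ)..t, extI u s, by
        have := intervalIntegral.continuous_primitive (a := 0)
          (fun a b => (extI_cont u).intervalIntegrable (μ := MeasureTheory.volume) a b)
        exact this.comp continuous_subtype_val⟩
      map_add' := by
        intro u v; ext t
        exact intervalIntegral.integral_add ((extI_cont u).intervalIntegrable _ _)
          ((extI_cont v).intervalIntegrable _ _)
      map_smul' := by
        intro c u; ext t
        exact intervalIntegral.integral_smul c (extI u) } 1 (by
    intro u
    rw [one_mul, ContinuousMap.norm_le _ (norm_nonneg _)]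
    intro t
    have : ‖∫ s in (0:ℝ)..t, extI u s‖ ≤ ‖u‖ * |(t:ℝ) - 0| :=
      intervalIntegral.norm_integral_le_of_norm_le_const
        (fun s _ => by exact u.norm_coe_le_norm _)
    refine this.trans ?_
    have h1 : |(t:ℝ) - 0| ≤ 1 := by rw [sub_zero, abs_of_nonneg t.2.1]; exact t.2.2
    nlinarith [norm_nonneg u])

lemma Jop_apply (u : C(I, V)) (t : I) : Jop V u t = ∫ s in (0:ℝ)..t, extI u s := rfl

lemma Jop_norm (u : C(I, V)) : ‖Jop V u‖ ≤ ‖u‖ := by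
  have := (Jop V).le_of_opNorm_le (LinearMap.mkContinuous_norm_le _ zero_le_one _) u
  simpa using this

/-- Constant paths. -/
noncomputable def constI (V : Type) [NormedAddCommGroup V] [NormedSpace ℝ V] :
    V →L[ℝ] C(I, V) :=
  LinearMap.mkContinuous
    { toFun := fun v => ContinuousMap.const I v
      map_add' := by intros; rfl
      map_smul' := by intros; rfl } 1 (by
    intro v
    rw [one_mul, ContinuousMap.norm_le _ (norm_nonneg _)]
    intro t; rfl)

@[simp] lemma constI_apply (v : V) (t : I) : constI V v t = v := rfl

/-- Post composition. -/
def postc {F : Type} [NormedAddCommGroup F] (f : V → F) (hf : Continuous f) (u : C(I, V)) :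
    C(I, F) := (ContinuousMap.mk f hf).comp u

/-- If z is a path satisfying a pointwise derivative relation it is an integral. -/
lemma Jop_of_deriv (z : C(I, V)) (w : C(I, V)) (Z : ℝ → V) (hZ : ∀ t : I, Z t = z t)
    (h0 : Z 0 = 0) (hd : ∀ t : I, HasDerivAt Z (w t) t) : z = Jop V w := by
  ext t
  rw [Jop_apply, ← hZ]
  have hsub : ∀ s ∈ Set.uIcc (0:ℝ) t, s ∈ Set.Icc (0:ℝ) 1 := by
    intro s hs
    rw [Set.uIcc_of_le t.2.1] at hs
    exact ⟨hs.1, hs.2.trans t.2.2⟩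
  rw [intervalIntegral.integral_eq_sub_of_hasDerivAt (f := Z) (f' := extI w), h0, sub_zero]
  · intro s hs
    have := hd ⟨s, hsub s hs⟩
    rw [← extI_coe w ⟨s, hsub s hs⟩] at this
    exact this
  · exact (extI_cont w).intervalIntegrable _ _


variable (S : V → V →L[ℝ] V) (Pp : V →L[ℝ] V) (p : V)

/-- The integral equation. -/
noncomputable def flowF (S : V → V →L[ℝ] V) (hS : ContDiff ℝ (⊤ : ℕ∞) S) (Pp : V →L[ℝ] V) (p : V)
    (x : V × C(I, V)) : C(I, V) :=
  x.2 - constI V (p + Pp x.1)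
    - Jop V (mulOp I V V ((ContinuousMap.mk S hS.continuous).comp x.2) (constI V x.1))

lemma flowF_contDiff (hS : ContDiff ℝ (⊤ : ℕ∞) S) : ContDiff ℝ (⊤ : ℕ∞) (flowF S hS Pp p) := by
  unfold flowF
  have h1 : ContDiff ℝ (⊤ : ℕ∞) (fun x : V × C(I, V) =>
      (ContinuousMap.mk S hS.continuous).comp x.2) := (contDiff_sup hS).comp contDiff_snd
  refine (contDiff_snd.sub ((constI V).contDiff.comp (contDiff_const.add
    (Pp.contDiff.comp contDiff_fst)))).sub ((Jop V).contDiff.comp ?_)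
  exact ((mulOp I V V).contDiff.comp h1).clm_apply ((constI V).contDiff.comp contDiff_fst)

/-- Pointwise linear operator w ↦ DS(u)(w) v. -/
lemma flowF_hasFDerivAt (hS : ContDiff ℝ (⊤ : ℕ∞) S) (v : V) (u : C(I, V)) :
    ∃ F' : V × C(I, V) →L[ℝ] C(I, V), HasFDerivAt (flowF S hS Pp p) F' (v, u) ∧
      ∀ ζ w, F' (ζ, w) = w - constI V (Pp ζ) - Jop V (mulOp I V V
          (mulOp I V (V →L[ℝ] V) ((ContinuousMap.mk (fderiv ℝ S)
            (hS.continuous_fderiv (by simp))).comp u) w) (constI V v)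
          + mulOp I V V ((ContinuousMap.mk S hS.continuous).comp u) (constI V ζ)) := by
  have hS1 : ContDiff ℝ 1 S := hS.of_le (by exact_mod_cast le_top)
  have h1 := (hasFDerivAt_sup (K := I) hS1 u)
  have h1' : HasFDerivAt (fun x : V × C(I, V) => (ContinuousMap.mk S hS.continuous).comp x.2)
    _ (v, u) := HasFDerivAt.comp (g := fun u : C(I, V) => (ContinuousMap.mk S hS.continuous).comp u)
      (v, u) h1 hasFDerivAt_snd
  have h2 : HasFDerivAt (fun x : V × C(I, V) => constI V x.1) _ (v, u) :=
    HasFDerivAt.comp (g := fun v => constI V v) (v, u) (constI V).hasFDerivAt hasFDerivAt_fst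
  have h2' : HasFDerivAt (fun x : V × C(I, V) => constI V (p + Pp x.1)) _ (v, u) :=
    HasFDerivAt.comp (g := fun v => constI V v) (v, u) (constI V).hasFDerivAt
      ((HasFDerivAt.comp (g := fun v => Pp v) (v, u) Pp.hasFDerivAt hasFDerivAt_fst).const_add p)
  have h3 : HasFDerivAt (fun x : V × C(I, V) => mulOp I V V
      ((ContinuousMap.mk S hS.continuous).comp x.2)) _ (v, u) :=
    HasFDerivAt.comp (g := fun a => mulOp I V V a) (v, u) (mulOp I V V).hasFDerivAt h1'
  have h4 := h3.clm_apply h2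
  have h5 := HasFDerivAt.comp (g := fun a => Jop V a) (v, u) (Jop V).hasFDerivAt h4
  have h6 := ((hasFDerivAt_snd (𝕜 := ℝ) (p := (v, u))).sub h2').sub h5
  refine ⟨_, h6, ?_⟩
  intro ζ w
  simp only [ContinuousLinearMap.sub_apply, ContinuousLinearMap.comp_apply,
    ContinuousLinearMap.add_apply, ContinuousLinearMap.flip_apply, ContinuousLinearMap.coe_fst',
    ContinuousLinearMap.coe_snd']
  congr 2
  exact add_comm _ _

lemma flow_exists (hS : ContDiff ℝ (⊤ : ℕ∞) S) (O : Set V) (hO : O ∈ 𝓝 p) (hSp : ∀ ζ, S p ζ = ζ - Pp ζ)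
    (hinv : ∀ x ∈ O, ∀ ξ η, fderiv ℝ S x (S x ξ) η = fderiv ℝ S x (S x η) ξ) :
    ∃ (Φ : V → V) (s : Set V), IsOpen s ∧ (0 : V) ∈ s ∧ ContDiffOn ℝ (⊤ : ℕ∞) Φ s ∧ Φ 0 = p ∧
      HasFDerivAt Φ (1 : V →L[ℝ] V) 0 ∧
      ∀ v ∈ s, Φ v ∈ O ∧ ∀ ζ, Pp ζ = 0 → fderiv ℝ Φ v ζ = S (Φ v) ζ := by
  obtain ⟨F0, hF0, hF0'⟩ := flowF_hasFDerivAt S Pp p hS 0 (constI V p)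
  have hF00 : ∀ ζ w, F0 (ζ, w) = w + F0 (ζ, 0) := by
    intro ζ w
    rw [hF0', hF0']
    simp only [map_zero, zero_add, zero_sub]
    abel
  let c : V →L[ℝ] C(I, V) := F0.comp (ContinuousLinearMap.inl ℝ V C(I, V))
  have hc : ∀ ζ, c ζ = F0 (ζ, 0) := fun ζ => rfl
  let A : (V × C(I, V)) →L[ℝ] (V × C(I, V)) := (ContinuousLinearMap.fst ℝ V C(I, V)).prod F0
  let A' : (V × C(I, V)) →L[ℝ] (V × C(I, V)) := (ContinuousLinearMap.fst ℝ V C(I, V)).prod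
    (ContinuousLinearMap.snd ℝ V C(I, V) - c.comp (ContinuousLinearMap.fst ℝ V C(I, V)))
  let Ae : (V × C(I, V)) ≃L[ℝ] (V × C(I, V)) := ContinuousLinearEquiv.equivOfInverse A A'
    (by rintro ⟨ζ, w⟩; simp [A, A', hc]; rw [hF00]; abel)
    (by rintro ⟨ζ, w⟩; simp [A, A', hc]; rw [hF00]; abel)
  let f : V × C(I, V) → V × C(I, V) := fun x => (x.1, flowF S hS Pp p x)
  have hf : ContDiff ℝ (⊤ : ℕ∞) f := contDiff_fst.prodMk (flowF_contDiff S Pp p hS)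
  have hfd : HasFDerivAt f (Ae : (V × C(I, V)) →L[ℝ] (V × C(I, V))) (0, constI V p) :=
    (hasFDerivAt_fst (𝕜 := ℝ) (p := ((0 : V), constI V p))).prodMk hF0
  -- domain
  obtain ⟨ε, hε, hεO⟩ := Metric.mem_nhds_iff.mp hO
  -- bound on the derivative near p
  have hcd : Continuous (fderiv ℝ S) := hS.continuous_fderiv (by simp)
  obtain ⟨ε', hε', hε'b⟩ := Metric.mem_nhds_iff.mp
    ((hcd.continuousAt (x := p)).preimage_mem_nhds (Metric.ball_mem_nhds (fderiv ℝ S p) one_pos))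
  let M : ℝ := ‖fderiv ℝ S p‖ + 1
  have hM : 0 < M := by positivity
  let r := min ε ε'
  have hr : 0 < r := lt_min hε hε'
  let s0 : Set (V × C(I, V)) := Metric.ball 0 (1 / M) ×ˢ Metric.ball (constI V p) r
  have hs0 : IsOpen s0 := Metric.isOpen_ball.prod Metric.isOpen_ball
  obtain ⟨e, he, hae, hes, -, hesm⟩ := inv_fun_smooth hs0 (a := ((0 : V), constI V p))
    ⟨Metric.mem_ball_self (by positivity), Metric.mem_ball_self hr⟩ hf.contDiffOn Ae hfd
  have hF00' : flowF S hS Pp p (0, constI V p) = 0 := by simp [flowF]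
  let ι : V → V × C(I, V) := fun v => (v, 0)
  have hιc : Continuous ι := by fun_prop
  let s : Set V := ι ⁻¹' e.target
  have hs : IsOpen s := e.open_target.preimage hιc
  have h0t : e ((0 : V), constI V p) = ι 0 := by rw [he]; simp [f, ι, hF00']
  have h0s : (0 : V) ∈ s := by
    have := e.map_source hae
    rw [h0t] at this; exact this
  let u : V → C(I, V) := fun v => (e.symm (ι v)).2
  have hu0 : u 0 = constI V p := by
    simp only [u]; rw [← h0t, e.left_inv hae]
  have hus : ContDiffOn ℝ (⊤ : ℕ∞) u s := by
    have : ContDiffOn ℝ (⊤ : ℕ∞) (fun v => e.symm (ι v)) s :=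
      hesm.comp (by fun_prop) (fun v hv => hv)
    exact contDiff_snd.comp_contDiffOn this
  have hsol : ∀ v ∈ s, e.symm (ι v) = (v, u v) ∧ flowF S hS Pp p (v, u v) = 0 := by
    intro v hv
    have h1 := e.right_inv hv
    rw [he] at h1
    have h2 : (e.symm (ι v)).1 = v := congrArg Prod.fst h1
    have h3 : flowF S hS Pp p (e.symm (ι v)) = 0 := congrArg Prod.snd h1
    have h4 : e.symm (ι v) = (v, u v) := Prod.ext h2 rfl
    exact ⟨h4, h4 ▸ h3⟩
  have hmem : ∀ v ∈ s, ‖v‖ < 1 / M ∧ u v ∈ Metric.ball (constI V p) r := by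
    intro v hv
    have := hes (e.map_target hv)
    rw [(hsol v hv).1] at this
    exact ⟨by simpa using this.1, this.2⟩
  have hnear : ∀ v ∈ s, ∀ t, u v t ∈ O ∧ ‖fderiv ℝ S (u v t)‖ ≤ M := by
    intro v hv t
    have h1 : dist (u v t) p < r :=
      lt_of_le_of_lt (ContinuousMap.dist_apply_le_dist (f := u v) (g := constI V p) t) (hmem v hv).2
    refine ⟨hεO (lt_of_lt_of_le h1 (min_le_left _ _)), ?_⟩
    have h2 := hε'b (lt_of_lt_of_le h1 (min_le_right _ _))
    replace h2 : ‖fderiv ℝ S (u v t) - fderiv ℝ S p‖ < 1 :=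
      lt_of_eq_of_lt (dist_eq_norm (fderiv ℝ S (u v t)) (fderiv ℝ S p)).symm h2
    have := norm_le_norm_add_norm_sub' (fderiv ℝ S (u v t)) (fderiv ℝ S p)
    simp only [M]; linarith
  have hu' : ∀ v ∈ s, HasFDerivAt u (fderiv ℝ u v) v := fun v hv =>
    ((hus.contDiffAt (hs.mem_nhds hv)).differentiableAt (by simp)).hasFDerivAt
  -- the linearised equation
  have hlin : ∀ v ∈ s, ∀ ζ, fderiv ℝ u v ζ = constI V (Pp ζ) + Jop V (mulOp I V V
          (mulOp I V (V →L[ℝ] V) ((ContinuousMap.mk (fderiv ℝ S)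
            (hS.continuous_fderiv (by simp))).comp (u v)) (fderiv ℝ u v ζ)) (constI V v)
          + mulOp I V V ((ContinuousMap.mk S hS.continuous).comp (u v)) (constI V ζ)) := by
    intro v hv ζ
    obtain ⟨F', hF', hF''⟩ := flowF_hasFDerivAt S Pp p hS v (u v)
    have h1 : HasFDerivAt (fun v => flowF S hS Pp p (v, u v)) _ v :=
      HasFDerivAt.comp (g := flowF S hS Pp p) (f := fun v => (v, u v)) v hF'
        ((hasFDerivAt_id v).prodMk (hu' v hv))
    have h2 : (fun v => flowF S hS Pp p (v, u v)) =ᶠ[𝓝 v] fun _ => 0 :=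
      Filter.eventually_of_mem (hs.mem_nhds hv) (fun w hw => (hsol w hw).2)
    have h3 := h1.unique ((hasFDerivAt_const (0 : C(I, V)) v).congr_of_eventuallyEq h2)
    have h4 := congrArg (fun T => T ζ) h3
    simp only [ContinuousLinearMap.comp_apply, ContinuousLinearMap.prod_apply,
      ContinuousLinearMap.zero_apply, ContinuousLinearMap.id_apply] at h4
    rw [hF''] at h4
    rw [sub_sub, sub_eq_zero] at h4
    exact h4
  let ev : C(I, V) →L[ℝ] V := ContinuousMap.evalCLM ℝ (1 : I)
  have hΦ' : ∀ v ∈ s, HasFDerivAt (fun v => u v 1) (ev.comp (fderiv ℝ u v)) v := fun v hv =>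
    HasFDerivAt.comp (g := fun w => ev w) v ev.hasFDerivAt (hu' v hv)
  refine ⟨fun v => u v 1, s, hs, h0s, ev.contDiff.comp_contDiffOn hus, by simp [hu0], ?_, ?_⟩
  · have h1 := hΦ' 0 h0s
    convert h1 using 1
    ext ζ
    have h2 := hlin 0 h0s ζ
    have h3 := congrArg ev h2
    rw [ContinuousLinearMap.comp_apply, h3]
    simp only [map_zero, zero_add, hu0]
    have h4 : mulOp I V V ((ContinuousMap.mk S hS.continuous).comp (constI V p)) (constI V ζ)
      = constI V (ζ - Pp ζ) := by
      ext t; simp [hSp]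
    rw [h4]
    have h5 : Jop V (constI V (ζ - Pp ζ)) 1 = ζ - Pp ζ := by
      rw [Jop_apply]
      have : extI (constI V (ζ - Pp ζ)) = fun _ => ζ - Pp ζ := rfl
      rw [this]; simp
    simp only [map_add]
    have h6 : ev (Jop V (constI V (ζ - Pp ζ))) = ζ - Pp ζ := h5
    rw [h6]
    simp [ev]
  · intro v hv
    refine ⟨(hnear v hv 1).1, ?_⟩
    intro ζ hζ
    rw [(hΦ' v hv).fderiv]
    -- candidate
    let B : C(I, V) →L[ℝ] C(I, V) := (Jop V).comp (((mulOp I V V).flip (constI V v)).comp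
      (mulOp I V (V →L[ℝ] V) ((ContinuousMap.mk (fderiv ℝ S)
            (hS.continuous_fderiv (by simp))).comp (u v))))
    let b : C(I, V) := mulOp I V V ((ContinuousMap.mk S hS.continuous).comp (u v)) (constI V ζ)
    let z : C(I, V) := ⟨fun t => (t : ℝ) • S (u v t) ζ, by
      have := hS.continuous
      fun_prop⟩
    have hw : fderiv ℝ u v ζ = B (fderiv ℝ u v ζ) + Jop V b := by
      have := hlin v hv ζ
      rw [hζ, map_zero, zero_add, map_add] at this
      exact this
    have hz : z = B z + Jop V b := by
      let a0 : C(I, V) := mulOp I V V ((ContinuousMap.mk S hS.continuous).comp (u v)) (constI V v)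
      let Uu : ℝ → V := fun t => p + Pp v + ∫ s in (0:ℝ)..t, extI a0 s
      have hUu : ∀ t : I, Uu t = u v t := by
        intro t
        have h1 := congrArg (fun q : C(I, V) => q t) (hsol v hv).2
        simp only [flowF, ContinuousMap.sub_apply, constI_apply, ContinuousMap.zero_apply] at h1
        rw [sub_sub, sub_eq_zero] at h1
        rw [h1]; rfl
      have hUd : ∀ t : I, HasDerivAt Uu (S (u v t) v) t := by
        intro t
        have h1 := ((extI_cont a0).integral_hasStrictDerivAt 0 t).hasDerivAt.const_add (p + Pp v)
        rw [extI_coe] at h1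
        exact h1
      have : B z + Jop V b = Jop V (mulOp I V V
          (mulOp I V (V →L[ℝ] V) ((ContinuousMap.mk (fderiv ℝ S)
            (hS.continuous_fderiv (by simp))).comp (u v)) z) (constI V v) + b) := by
        rw [map_add]; rfl
      rw [this]
      refine Jop_of_deriv z _ (fun t => t • S (Uu t) ζ) ?_ (by simp) ?_
      · intro t; simp only [hUu]; rfl
      · intro t
        have h1 : HasFDerivAt S (fderiv ℝ S (Uu t)) (Uu t) :=
          (hS.differentiable (by simp) _).hasFDerivAt
        have h2 := (h1.comp_hasDerivAt (t : ℝ) (hUd t)).clm_apply (hasDerivAt_const (t : ℝ) ζ)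
        have h3 := (hasDerivAt_id (t : ℝ)).smul h2
        refine HasDerivAt.congr_deriv (f := fun t => t • S (Uu t) ζ) h3 ?_
        simp only [Function.comp, hUu, map_zero, add_zero, id, one_smul]
        symm
        show fderiv ℝ S (u v t) ((t : ℝ) • S (u v t) ζ) v + S (u v t) ζ = _
        rw [map_smul, _root_.smul_apply, hinv _ (hnear v hv t).1 ζ v]
    have hδ : fderiv ℝ u v ζ - z = B (fderiv ℝ u v ζ - z) := by
      rw [map_sub]
      nth_rewrite 1 [hw, hz]
      abel
    have hBn : ∀ w, ‖B w‖ ≤ M * ‖v‖ * ‖w‖ := by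
      intro w
      refine (Jop_norm _).trans ?_
      rw [ContinuousMap.norm_le _ (by positivity)]
      intro t
      show ‖fderiv ℝ S (u v t) (w t) v‖ ≤ _
      calc _ ≤ ‖fderiv ℝ S (u v t)‖ * ‖w t‖ * ‖v‖ := ContinuousLinearMap.le_opNorm₂ _ _ _
        _ ≤ M * ‖w‖ * ‖v‖ := by
          gcongr
          · exact (hnear v hv t).2
          · exact w.norm_coe_le_norm t
        _ = _ := by ring
    have h0 : fderiv ℝ u v ζ - z = 0 := by
      by_contra hne
      have h1 := hBn (fderiv ℝ u v ζ - z)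
      rw [← hδ] at h1
      have h2 : 0 < ‖fderiv ℝ u v ζ - z‖ := norm_pos_iff.mpr hne
      have h3 : M * ‖v‖ < 1 := by
        have := (hmem v hv).1
        rw [lt_div_iff₀ hM] at this
        linarith
      nlinarith
    rw [ContinuousLinearMap.comp_apply, sub_eq_zero.mp h0]
    show ((1 : I) : ℝ) • S (u v 1) ζ = _
    simp
end Frob
end PartP5

section PartP5b
section Frob2
open Filter Topology
variable {V : Type} [NormedAddCommGroup V] [NormedSpace ℝ V] [FiniteDimensional ℝ V]

lemma cutoff {F : Type} [NormedAddCommGroup F] [NormedSpace ℝ F] {S : V → F} {U1 : Set V} {p : V}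
    (hU1 : IsOpen U1) (hp : p ∈ U1) (hS : ContDiffOn ℝ (⊤ : ℕ∞) S U1) :
    ∃ S' : V → F, ContDiff ℝ (⊤ : ℕ∞) S' ∧ ∃ O, IsOpen O ∧ p ∈ O ∧ O ⊆ U1 ∧ ∀ x ∈ O, S' x = S x := by
  obtain ⟨ε, hε, hεO⟩ := Metric.isOpen_iff.mp hU1 p hp
  let f : ContDiffBump p := ⟨ε / 4, ε / 2, by positivity, by linarith⟩
  refine ⟨fun x => f x • S x, ?_, Metric.ball p (ε / 4), Metric.isOpen_ball,
    Metric.mem_ball_self (by positivity), fun x hx => hεO (Metric.ball_subset_ball (by linarith) hx),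
    ?_⟩
  · rw [contDiff_iff_contDiffAt]
    intro x
    by_cases hx : x ∈ U1
    · exact (f.contDiff.contDiffAt).smul (hS.contDiffAt (hU1.mem_nhds hx))
    · have h1 : x ∉ tsupport f := by
        rw [f.tsupport_eq]
        intro h
        exact hx (hεO (Metric.closedBall_subset_ball (by simp [f]; linarith) h))
      have h2 : (fun x => f x • S x) =ᶠ[𝓝 x] fun _ => 0 := by
        have := notMem_tsupport_iff_eventuallyEq.mp h1
        filter_upwards [this] with y hy
        simp [hy]
      exact contDiffAt_const.congr_of_eventuallyEq h2
  · intro x hx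
    have : f x = 1 := f.one_of_mem_closedBall (Metric.ball_subset_closedBall hx)
    simp [this]

lemma frob_integrate {U : Set V} (hU : IsOpen U) {p : V} (hp : p ∈ U) {P : V → V →L[ℝ] V}
    (hP : ContDiffOn ℝ (⊤ : ℕ∞) P U) (hPP : ∀ x ∈ U, ∀ X, P x (P x X) = P x X)
    (hinv : ∀ x ∈ U, ∀ X Y, P x X = 0 → P x Y = 0 → fderiv ℝ P x X Y = fderiv ℝ P x Y X) :
    ∃ (y : V → V) (U' : Set V), IsOpen U' ∧ p ∈ U' ∧ U' ⊆ U ∧ ContDiffOn ℝ (⊤ : ℕ∞) y U' ∧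
      (∀ x ∈ U', ∀ Y, P x Y = 0 → fderiv ℝ y x Y = 0) ∧
      (∀ x ∈ U', ∀ Y, P p (fderiv ℝ y x Y) = fderiv ℝ y x Y) ∧ HasFDerivAt y (P p) p := by
  have : CompleteSpace V := FiniteDimensional.complete ℝ V
  let Pp := P p
  let Qp : V →L[ℝ] V := 1 - Pp
  have hPpPp : ∀ X, Pp (Pp X) = Pp X := hPP p hp
  have hQp : ∀ X, Qp X = X - Pp X := fun X => by simp [Qp]
  have hQQ : ∀ X, Qp (Qp X) = Qp X := fun X => by simp [hQp, hPpPp]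
  have hPQ : ∀ X, Pp (Qp X) = 0 := fun X => by simp [hQp, hPpPp]
  have hQP : ∀ X, Qp (Pp X) = 0 := fun X => by simp [hQp, hPpPp]
  let N : V → V →L[ℝ] V := fun x => Qp + Pp * P x
  let T : V → V →L[ℝ] V := fun x => Pp * P x + Qp * (1 - P x)
  have hN : ContDiffOn ℝ (⊤ : ℕ∞) N U := contDiffOn_const.add (contDiffOn_const.mul hP)
  have hT : ContDiffOn ℝ (⊤ : ℕ∞) T U :=
    (contDiffOn_const.mul hP).add (contDiffOn_const.mul (contDiffOn_const.sub hP))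
  have hNp : N p = 1 := by
    ext X; simp [N, hQp]; show X - Pp X + Pp (Pp X) = X; simp [hPpPp]
  have hTp : T p = 1 := by
    ext X; simp [T, hQp]; show Pp (Pp X) + (Qp X - Qp (Pp X)) = X; simp [hPpPp, hQp]
  let U1 : Set V := (U ∩ N ⁻¹' {A | IsUnit A}) ∩ (U ∩ T ⁻¹' {A | IsUnit A})
  have hU1 : IsOpen U1 := (hN.continuousOn.isOpen_inter_preimage hU Units.isOpen).inter
    (hT.continuousOn.isOpen_inter_preimage hU Units.isOpen)
  have hpU1 : p ∈ U1 := ⟨⟨hp, by simp [hNp]⟩, ⟨hp, by simp [hTp]⟩⟩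
  let S : V → V →L[ℝ] V := fun x => Ring.inverse (N x) * Qp
  have hS : ContDiffOn ℝ (⊤ : ℕ∞) S U1 := by
    intro x hx
    obtain ⟨a, ha⟩ := hx.1.2
    have h1 : ContDiffAt ℝ (⊤ : ℕ∞) Ring.inverse (N x) := by
      rw [← ha]; exact contDiffAt_ringInverse ℝ a
    have h2 := h1.comp x (hN.contDiffAt (hU.mem_nhds hx.1.1))
    exact (h2.mul contDiffAt_const).contDiffWithinAt
  have hNS : ∀ x ∈ U1, ∀ ξ, N x (S x ξ) = Qp ξ := by
    intro x hx ξ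
    have : N x * S x = Qp := by
      simp only [S]; rw [← mul_assoc, Ring.mul_inverse_cancel _ hx.1.2, one_mul]
    exact congrArg (fun A => A ξ) this
  have hNinj : ∀ x ∈ U1, ∀ Z, N x Z = 0 → Z = 0 := by
    intro x hx Z hZ
    have : Ring.inverse (N x) * N x = 1 := Ring.inverse_mul_cancel _ hx.1.2
    have h1 := congrArg (fun A => A Z) this
    simpa [hZ] using h1.symm
  have hTinj : ∀ x ∈ U1, ∀ Z, T x Z = 0 → Z = 0 := by
    intro x hx Z hZ
    have : Ring.inverse (T x) * T x = 1 := Ring.inverse_mul_cancel _ hx.2.2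
    have h1 := congrArg (fun A => A Z) this
    simpa [hZ] using h1.symm
  have hNa : ∀ x Z, N x Z = Qp Z + Pp (P x Z) := fun x Z => rfl
  have hTa : ∀ x Z, T x Z = Pp (P x Z) + Qp (Z - P x Z) := fun x Z => rfl
  have hPS : ∀ x ∈ U1, ∀ ξ, P x (S x ξ) = 0 := by
    intro x hx ξ
    have h1 := hNS x hx ξ
    rw [hNa] at h1
    have h2 := congrArg Pp h1
    rw [map_add, hPQ, hPQ, zero_add, hPpPp] at h2
    apply hTinj x hx
    rw [hTa, hPP x hx.1.1, h2]; simp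
  have hQS : ∀ x ∈ U1, ∀ ξ, Qp (S x ξ) = Qp ξ := by
    intro x hx ξ
    have h1 := hNS x hx ξ
    rw [hNa, hPS x hx] at h1
    simpa using h1
  have hSQ : ∀ x ∈ U1, ∀ Y, P x Y = 0 → S x (Qp Y) = Y := by
    intro x hx Y hY
    have : N x (S x (Qp Y) - Y) = 0 := by
      rw [map_sub, hNS x hx, hNa, hY]; simp [hQQ]
    exact sub_eq_zero.mp (hNinj x hx _ this)
  have hSd : ∀ x ∈ U1, HasFDerivAt S (fderiv ℝ S x) x := fun x hx =>
    ((hS.contDiffAt (hU1.mem_nhds hx)).differentiableAt (by simp)).hasFDerivAt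
  have hPd : ∀ x ∈ U, HasFDerivAt P (fderiv ℝ P x) x := fun x hx =>
    ((hP.contDiffAt (hU.mem_nhds hx)).differentiableAt (by simp)).hasFDerivAt
  have hdPS : ∀ x ∈ U1, ∀ X ξ, fderiv ℝ P x X (S x ξ) + P x (fderiv ℝ S x X ξ) = 0 := by
    intro x hx X ξ
    have h1 := (hPd x hx.1.1).clm_apply ((hSd x hx).clm_apply (hasFDerivAt_const ξ x))
    have h2 : (fun y => P y (S y ξ)) =ᶠ[𝓝 x] fun _ => 0 :=
      Filter.eventually_of_mem (hU1.mem_nhds hx) (fun w hw => hPS w hw ξ)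
    have h3 := h1.unique ((hasFDerivAt_const (0 : V) x).congr_of_eventuallyEq h2)
    have h4 := congrArg (fun A => A X) h3
    simp at h4
    rw [← h4]; abel
  have hdQS : ∀ x ∈ U1, ∀ X ξ, Qp (fderiv ℝ S x X ξ) = 0 := by
    intro x hx X ξ
    have h1 := (hasFDerivAt_const Qp x).clm_apply ((hSd x hx).clm_apply (hasFDerivAt_const ξ x))
    have h2 : (fun y => Qp (S y ξ)) =ᶠ[𝓝 x] fun _ => Qp ξ :=
      Filter.eventually_of_mem (hU1.mem_nhds hx) (fun w hw => hQS w hw ξ)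
    have h3 := h1.unique ((hasFDerivAt_const (Qp ξ) x).congr_of_eventuallyEq h2)
    have h4 := congrArg (fun A => A X) h3
    simpa using h4
  have hinvS : ∀ x ∈ U1, ∀ ξ η, fderiv ℝ S x (S x ξ) η = fderiv ℝ S x (S x η) ξ := by
    intro x hx ξ η
    have h1 := hdPS x hx (S x ξ) η
    have h2 := hdPS x hx (S x η) ξ
    have h3 := hinv x hx.1.1 (S x ξ) (S x η) (hPS x hx ξ) (hPS x hx η)
    apply sub_eq_zero.mp
    apply hNinj x hx
    rw [hNa, map_sub, map_sub, hdQS x hx, hdQS x hx]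
    rw [← h3] at h2
    have : P x (fderiv ℝ S x (S x ξ) η) = P x (fderiv ℝ S x (S x η) ξ) := by
      rw [← add_right_inj, h1, h2]
    simp [this]
  obtain ⟨S', hS', O, hO, hpO, hOU, hSS⟩ := cutoff hU1 hpU1 hS
  have hfd : ∀ x ∈ O, fderiv ℝ S' x = fderiv ℝ S x := fun x hx =>
    Filter.EventuallyEq.fderiv_eq (Filter.eventually_of_mem (hO.mem_nhds hx) hSS)
  obtain ⟨Φ, s, hs, h0s, hΦ, hΦ0, hΦd, hΦs⟩ := flow_exists S' Pp p hS' O (hO.mem_nhds hpO)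
    (by
      intro ζ
      rw [hSS p hpO]
      have h1 := hNS p hpU1 ζ
      rw [hNp] at h1
      rw [← hQp]; exact h1)
    (by
      intro x hx ξ η
      rw [hfd x hx, hSS x hx]
      exact hinvS x (hOU hx) ξ η)
  obtain ⟨e, he, hae, hes, hJ, hesm⟩ := inv_fun_smooth hs h0s hΦ (ContinuousLinearEquiv.refl ℝ V)
    hΦd
  have he' : (e : V → V) = Φ := funext he
  have hsymm : ∀ x ∈ e.target, ∃ J : V ≃L[ℝ] V, HasFDerivAt Φ (J : V →L[ℝ] V) (e.symm x) ∧
      HasFDerivAt e.symm (J.symm : V →L[ℝ] V) x := by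
    intro x hx
    obtain ⟨J, hJ⟩ := hJ _ (e.map_target hx)
    exact ⟨J, hJ, e.hasFDerivAt_symm hx (by rw [he']; exact hJ)⟩
  have hy : ∀ x (A : V →L[ℝ] V), HasFDerivAt e.symm A x → HasFDerivAt (fun x => Pp (e.symm x))
    (Pp.comp A) x := fun x A hA => HasFDerivAt.comp (g := fun v => Pp v) x Pp.hasFDerivAt hA
  have hpt : p ∈ e.target := by
    have := e.map_source hae
    rwa [he, hΦ0] at this
  have hp0 : e.symm p = 0 := by
    rw [← hΦ0, ← he]; exact e.left_inv hae
  refine ⟨fun x => Pp (e.symm x), e.target, e.open_target, hpt, ?_,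
    Pp.contDiff.comp_contDiffOn hesm, ?_, ?_, ?_⟩
  · intro x hx
    have h1 := (hΦs _ (hes (e.map_target hx))).1
    rw [← he, e.right_inv hx] at h1
    exact (hOU h1).1.1
  · intro x hx Y hY
    obtain ⟨J, hJ1, hJ2⟩ := hsymm x hx
    rw [(hy x _ hJ2).fderiv]
    have h1 := (hΦs _ (hes (e.map_target hx)))
    have hx' : Φ (e.symm x) = x := by rw [← he, e.right_inv hx]
    rw [hx'] at h1
    have h2 := h1.2 (Qp Y) (hPQ Y)
    rw [hJ1.fderiv, hSS x h1.1, hSQ x (hOU h1.1) Y hY] at h2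
    rw [ContinuousLinearMap.comp_apply]
    have h3 : J.symm Y = Qp Y := by
      rw [ContinuousLinearEquiv.symm_apply_eq]; exact h2.symm
    show Pp (J.symm Y) = 0
    rw [h3, hPQ]
  · intro x hx Y
    obtain ⟨J, hJ1, hJ2⟩ := hsymm x hx
    rw [(hy x _ hJ2).fderiv]
    exact hPpPp _
  · obtain ⟨J, hJ1, hJ2⟩ := hsymm p hpt
    rw [hp0] at hJ1
    have h1 := hJ1.unique hΦd
    have h2 : (J.symm : V →L[ℝ] V) = 1 := by
      ext Y
      have : J Y = Y := congrArg (fun A : V →L[ℝ] V => A Y) h1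
      show J.symm Y = Y
      rw [ContinuousLinearEquiv.symm_apply_eq, this]
    have := hy p _ hJ2
    rw [h2] at this
    exact this
end Frob2
end PartP5b

section PartP6
section Alg
variable {ι : Type} [Fintype ι] [DecidableEq ι]

/-- Product of all factors but one. -/
noncomputable def cof (χ : ι → ℝ[X]) (i : ι) : ℝ[X] := ∏ j ∈ Finset.univ.erase i, χ j

lemma cof_mul (χ : ι → ℝ[X]) (i : ι) : χ i * cof χ i = ∏ j, χ j :=
  Finset.mul_prod_erase _ _ (Finset.mem_univ i)

lemma cof_dvd (χ : ι → ℝ[X]) {i j : ι} (h : j ≠ i) : χ j ∣ cof χ i :=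
  Finset.dvd_prod_of_mem _ (Finset.mem_erase.mpr ⟨h, Finset.mem_univ j⟩)

lemma cof_coprime {χ : ι → ℝ[X]} (hc : ∀ i j, i ≠ j → IsCoprime (χ i) (χ j)) (i : ι) :
    IsCoprime (χ i) (cof χ i) :=
  IsCoprime.prod_right fun j hj => hc i j (Finset.ne_of_mem_erase hj).symm

lemma sumcof_coprime {χ : ι → ℝ[X]} (hc : ∀ i j, i ≠ j → IsCoprime (χ i) (χ j)) :
    IsCoprime (∑ i, cof χ i) (∏ i, χ i) := by
  refine IsCoprime.prod_right fun i _ => ?_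
  rw [← Finset.add_sum_erase _ _ (Finset.mem_univ i)]
  obtain ⟨q, hq⟩ : χ i ∣ ∑ j ∈ Finset.univ.erase i, cof χ j :=
    Finset.dvd_sum fun j hj => cof_dvd χ (Finset.ne_of_mem_erase hj).symm
  rw [hq]
  exact IsCoprime.add_mul_left_left (cof_coprime hc i).symm q

variable {A : Type*} [Ring A] [Algebra ℝ A] {a : A} {χ : ι → ℝ[X]}

lemma sumcof_unit (hc : ∀ i j, i ≠ j → IsCoprime (χ i) (χ j)) (h0 : aeval a (∏ i, χ i) = 0) :
    ∃ u : ℝ[X], aeval a (u * ∑ i, cof χ i) = 1 ∧ IsUnit (aeval a (∑ i, cof χ i)) ∧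
      Ring.inverse (aeval a (∑ i, cof χ i)) = aeval a u := by
  obtain ⟨u, v, huv⟩ := sumcof_coprime hc
  have h1 : aeval a (u * ∑ i, cof χ i) = 1 := by
    have := congrArg (aeval a) huv
    rw [map_add, map_mul _ v, h0, mul_zero, add_zero, map_one] at this
    exact this
  have h2 : aeval a u * aeval a (∑ i, cof χ i) = 1 := by rw [← map_mul, h1]
  have h3 : aeval a (∑ i, cof χ i) * aeval a u = 1 := by rw [← map_mul, mul_comm, h1]
  refine ⟨u, h1, ⟨⟨_, _, h3, h2⟩, rfl⟩, ?_⟩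
  exact Ring.inverse_unit ⟨_, _, h3, h2⟩

/-- The spectral projections. -/
noncomputable def prj (a : A) (χ : ι → ℝ[X]) (i : ι) : A :=
  aeval a (cof χ i) * Ring.inverse (aeval a (∑ i, cof χ i))

lemma prj_poly (hc : ∀ i j, i ≠ j → IsCoprime (χ i) (χ j)) (h0 : aeval a (∏ i, χ i) = 0) :
    ∃ u : ℝ[X], (∀ i, prj a χ i = aeval a (cof χ i * u)) ∧ aeval a (u * ∑ i, cof χ i) = 1 := by
  obtain ⟨u, h1, h2, h3⟩ := sumcof_unit hc h0
  exact ⟨u, fun i => by rw [prj, h3, map_mul], h1⟩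

lemma aeval_dvd_zero {p q : ℝ[X]} (h : p ∣ q) (hp : aeval a p = 0) : aeval a q = 0 := by
  obtain ⟨r, rfl⟩ := h
  rw [map_mul, hp, zero_mul]

lemma prj_sum (hc : ∀ i j, i ≠ j → IsCoprime (χ i) (χ j)) (h0 : aeval a (∏ i, χ i) = 0) :
    ∑ i, prj a χ i = 1 := by
  obtain ⟨u, h1, h2⟩ := prj_poly hc h0
  simp_rw [h1]
  rw [← map_sum, ← Finset.sum_mul, mul_comm, h2]

lemma prj_orth (hc : ∀ i j, i ≠ j → IsCoprime (χ i) (χ j)) (h0 : aeval a (∏ i, χ i) = 0)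
    {i j : ι} (hij : i ≠ j) : prj a χ i * prj a χ j = 0 := by
  obtain ⟨u, h1, h2⟩ := prj_poly hc h0
  rw [h1, h1, ← map_mul]
  refine aeval_dvd_zero ?_ h0
  rw [← cof_mul χ j]
  obtain ⟨q, hq⟩ := cof_dvd χ hij.symm
  exact ⟨q * u * u, by rw [hq]; ring⟩

lemma prj_idem (hc : ∀ i j, i ≠ j → IsCoprime (χ i) (χ j)) (h0 : aeval a (∏ i, χ i) = 0)
    (i : ι) : prj a χ i * prj a χ i = prj a χ i := by
  have h := congrArg (fun x => prj a χ i * x) (prj_sum hc h0)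
  simp only [mul_one, Finset.mul_sum] at h
  rwa [Finset.sum_eq_single i (fun j _ hj => prj_orth hc h0 hj.symm) (by simp)] at h

lemma prj_comm (hc : ∀ i j, i ≠ j → IsCoprime (χ i) (χ j)) (h0 : aeval a (∏ i, χ i) = 0)
    (i : ι) (q : ℝ[X]) : prj a χ i * aeval a q = aeval a q * prj a χ i := by
  obtain ⟨u, h1, h2⟩ := prj_poly hc h0
  rw [h1, ← map_mul, ← map_mul, mul_comm]

lemma prj_kill (hc : ∀ i j, i ≠ j → IsCoprime (χ i) (χ j)) (h0 : aeval a (∏ i, χ i) = 0)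
    (i : ι) : aeval a (χ i) * prj a χ i = 0 := by
  obtain ⟨u, h1, h2⟩ := prj_poly hc h0
  rw [h1, ← map_mul, ← mul_assoc, cof_mul, map_mul, h0, zero_mul]

lemma prj_cof (hc : ∀ i j, i ≠ j → IsCoprime (χ i) (χ j)) (h0 : aeval a (∏ i, χ i) = 0)
    (i : ι) : aeval a (∑ i, cof χ i) * prj a χ i = aeval a (cof χ i) := by
  obtain ⟨u, h1, h2⟩ := prj_poly hc h0
  rw [h1, ← map_mul, mul_left_comm, map_mul, mul_comm _ u, h2, mul_one]

/-- On the complement of the range of a projection the factor is invertible. -/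
lemma prj_inv (hc : ∀ i j, i ≠ j → IsCoprime (χ i) (χ j)) (h0 : aeval a (∏ i, χ i) = 0)
    (i : ι) : ∃ s t : ℝ[X], aeval a (χ i) * aeval a s + aeval a (cof χ i) * aeval a t = 1 := by
  obtain ⟨s, t, h⟩ := cof_coprime hc i
  refine ⟨s, t, ?_⟩
  rw [← map_mul, ← map_mul, ← map_add, mul_comm, mul_comm _ t, h, map_one]

end Alg

section Blocks
variable {k : ℕ} {m' : Fin k → Type} [∀ i, Fintype (m' i)] [∀ i, DecidableEq (m' i)]

lemma det_blockDiag' {R : Type} [CommRing R] (B : ∀ i, Matrix (m' i) (m' i) R) :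
    (blockDiagonal' B).det = ∏ i, (B i).det := by
  rw [(blockTriangular_blockDiagonal' B).det_fintype]
  refine Finset.prod_congr rfl fun i _ => ?_
  let e : m' i ≃ {x : (i : Fin k) × m' i // x.1 = i} :=
    { toFun := fun a => ⟨⟨i, a⟩, rfl⟩
      invFun := fun x => x.2 ▸ x.1.2
      left_inv := fun a => rfl
      right_inv := by rintro ⟨⟨j, a⟩, rfl⟩; rfl }
  rw [← Matrix.det_submatrix_equiv_self e]
  congr 1
  ext a b
  simp [toSquareBlock, toSquareBlockProp, e, blockDiagonal'_apply_eq]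

lemma charpoly_blockDiag' {R : Type} [CommRing R] (B : ∀ i, Matrix (m' i) (m' i) R) :
    (blockDiagonal' B).charpoly = ∏ i, (B i).charpoly := by
  unfold Matrix.charpoly
  rw [← det_blockDiag']
  congr 1
  ext ⟨i, a⟩ ⟨j, b⟩
  by_cases h : i = j
  · subst h
    simp only [blockDiagonal'_apply_eq, charmatrix_apply]
    congr 1
    simp [diagonal_apply]
  · rw [blockDiagonal'_apply_ne _ _ _ h, charmatrix_apply, blockDiagonal'_apply_ne _ _ _ h]
    rw [diagonal_apply_ne]
    · simp
    · intro h'; exact h (congrArg Sigma.fst h')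

lemma charpoly_coprime {m : Type} [Fintype m] [DecidableEq m] (B : Matrix m m ℝ) {p q : ℝ[X]}
    (hpq : IsCoprime p q) (hp : aeval B p = 0) : IsCoprime B.charpoly q := by
  classical
  rw [← Polynomial.isCoprime_map (algebraMap ℝ ℂ)]
  by_contra hn
  -- common root
  have hne : (B.charpoly.map (algebraMap ℝ ℂ)) ≠ 0 := (B.charpoly_monic.map _).ne_zero
  have hg : ¬ IsUnit (gcd (B.charpoly.map (algebraMap ℝ ℂ)) (q.map (algebraMap ℝ ℂ))) := by
    rwa [gcd_isUnit_iff]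
  have hg0 : gcd (B.charpoly.map (algebraMap ℝ ℂ)) (q.map (algebraMap ℝ ℂ)) ≠ 0 := by
    intro h; rw [gcd_eq_zero_iff] at h; exact hne h.1
  obtain ⟨z, hz⟩ := IsAlgClosed.exists_root (k := ℂ)
    (gcd (B.charpoly.map (algebraMap ℝ ℂ)) (q.map (algebraMap ℝ ℂ)))
    (fun h => hg (Polynomial.isUnit_iff_degree_eq_zero.mpr h))
  have hz1 : (B.charpoly.map (algebraMap ℝ ℂ)).IsRoot z := hz.dvd (gcd_dvd_left _ _)
  have hz2 : (q.map (algebraMap ℝ ℂ)).IsRoot z := hz.dvd (gcd_dvd_right _ _)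
  rw [← Matrix.charpoly_map] at hz1
  -- eigenvector
  have hz3 : ∃ v ≠ 0, (B.map (algebraMap ℝ ℂ)) *ᵥ v = z • v := by
    have : ((Matrix.scalar m z) - B.map (algebraMap ℝ ℂ)).det = 0 := by
      rw [← Matrix.eval_charpoly]; exact hz1
    obtain ⟨v, hv, hv'⟩ := Matrix.exists_mulVec_eq_zero_iff.mpr this
    refine ⟨v, hv, ?_⟩
    rw [sub_mulVec, sub_eq_zero] at hv'
    rw [← hv']
    ext i
    simp [Matrix.scalar_apply, mulVec_diagonal]
  obtain ⟨v, hv, hv'⟩ := hz3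
  have hpz : (p.map (algebraMap ℝ ℂ)).eval z • v = 0 := by
    have h1 : ∀ r : ℂ[X], (aeval (B.map (algebraMap ℝ ℂ)) r) *ᵥ v = r.eval z • v := by
      intro r
      have := Module.End.aeval_apply_of_hasEigenvector (f := Matrix.toLin' (B.map (algebraMap ℝ ℂ)))
        (p := r) (μ := z) (x := v) ⟨Module.End.mem_eigenspace_iff.mpr (by simpa using hv'), hv⟩
      rw [← this]
      have h2 := Polynomial.aeval_algHom_apply (Matrix.toLinAlgEquiv' (R := ℂ) (n := m)).toAlgHom
        (B.map (algebraMap ℝ ℂ)) r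
      have h3 := congrArg (fun T => T v) h2
      exact h3.symm
    rw [← h1]
    have h2 : aeval (B.map (algebraMap ℝ ℂ)) (p.map (algebraMap ℝ ℂ)) = (aeval B p).map (algebraMap ℝ ℂ) := by
      have h4 : (aeval B p).map (algebraMap ℝ ℂ) = eval₂ ((algebraMap ℝ ℂ).mapMatrix.comp (algebraMap ℝ (Matrix m m ℝ))) (B.map (algebraMap ℝ ℂ)) p := by
        have := Polynomial.hom_eval₂ p (algebraMap ℝ (Matrix m m ℝ)) ((algebraMap ℝ ℂ).mapMatrix) B
        rw [← RingHom.mapMatrix_apply, aeval_def, this]; rfl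
      rw [h4, aeval_def, eval₂_map]
      congr 1
      ext r i j
      simp only [Matrix.algebraMap_matrix_apply, RingHom.comp_apply, RingHom.mapMatrix_apply,
        Matrix.map_apply]
      split_ifs <;> simp
    rw [h2, hp]
    simp
  have hpz' : (p.map (algebraMap ℝ ℂ)).eval z = 0 := by
    rcases smul_eq_zero.mp hpz with h | h
    · exact h
    · exact absurd h hv
  have := (Polynomial.isCoprime_map (algebraMap ℝ ℂ)).mpr hpq
  obtain ⟨s, t, hst⟩ := this
  have h5 := congrArg (Polynomial.eval z) hst
  rw [eval_add, eval_mul, eval_mul, hpz', hz2.eq_zero] at h5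
  simp at h5

lemma block_charpoly (B : ∀ i, Matrix (m' i) (m' i) ℝ) (χ : Fin k → ℝ[X])
    (hm : ∀ i, (χ i).Monic) (hc : ∀ i j, i ≠ j → IsCoprime (χ i) (χ j))
    (hprod : ∏ i, (B i).charpoly = ∏ i, χ i) (h0 : ∀ i, aeval (B i) (χ i) = 0) (i : Fin k) :
    (B i).charpoly = χ i := by
  have hd : ∀ i, (B i).charpoly ∣ χ i := by
    intro i
    have h1 : (B i).charpoly ∣ ∏ i, χ i := by
      rw [← hprod]; exact Finset.dvd_prod_of_mem _ (Finset.mem_univ i)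
    rw [← cof_mul χ i] at h1
    refine IsCoprime.dvd_of_dvd_mul_right ?_ h1
    exact IsCoprime.prod_right fun j hj =>
      charpoly_coprime (B i) (hc i j (Finset.ne_of_mem_erase hj).symm) (h0 i)
  have hle : ∀ i, (B i).charpoly.natDegree ≤ (χ i).natDegree := fun i =>
    Polynomial.natDegree_le_of_dvd (hd i) (hm i).ne_zero
  have hsum : ∑ i, (B i).charpoly.natDegree = ∑ i, (χ i).natDegree := by
    rw [← Polynomial.natDegree_prod_of_monic _ _ (fun i _ => (B i).charpoly_monic),
      ← Polynomial.natDegree_prod_of_monic _ _ (fun i _ => hm i), hprod]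
  have heq := (Finset.sum_eq_sum_iff_of_le (fun i _ => hle i)).mp hsum i (Finset.mem_univ i)
  exact (Polynomial.eq_of_monic_of_dvd_of_natDegree_le (B i).charpoly_monic (hm i) (hd i) heq.ge).symm
end Blocks
end PartP6

section PartP6b
section Chi

/-- The factors of the characteristic polynomial. -/
noncomputable def chi (r i : ℕ) (z : ℂ) (m : ℕ) : ℝ[X] :=
  if i < r then (X ^ 2 - C (2 * z.re) * X + C (Complex.normSq z)) ^ m else (X - C z.re) ^ m

lemma chi_quad (z : ℂ) : (X ^ 2 - C (2 * z.re) * X + C (Complex.normSq z) : ℝ[X]).map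
    (algebraMap ℝ ℂ) = (X - C z) * (X - C ((starRingEnd ℂ) z)) := by
  have h1 : C z + C ((starRingEnd ℂ) z) = C ((2 * z.re : ℝ) : ℂ) := by
    rw [← C_add, Complex.add_conj]
  have h2 : C z * C ((starRingEnd ℂ) z) = C ((Complex.normSq z : ℝ) : ℂ) := by
    rw [← C_mul, Complex.mul_conj]
  simp only [Polynomial.map_add, Polynomial.map_sub, Polynomial.map_mul, Polynomial.map_pow,
    map_X, map_C, Complex.coe_algebraMap]
  rw [← h1, ← h2]; ring

lemma chi_map_lt {r i : ℕ} (h : i < r) (z : ℂ) (m : ℕ) :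
    (chi r i z m).map (algebraMap ℝ ℂ) = (X - C z) ^ m * (X - C ((starRingEnd ℂ) z)) ^ m := by
  rw [chi, if_pos h, Polynomial.map_pow, chi_quad, mul_pow]

lemma chi_map_ge {r i : ℕ} (h : ¬ i < r) {z : ℂ} (hz : z.im = 0) (m : ℕ) :
    (chi r i z m).map (algebraMap ℝ ℂ) = (X - C z) ^ m := by
  have : ((z.re : ℝ) : ℂ) = z := Complex.ext (by simp) (by simp [hz])
  rw [chi, if_neg h, Polynomial.map_pow]
  simp [this]

lemma quad_monic (z : ℂ) : (X ^ 2 - C (2 * z.re) * X + C (Complex.normSq z) : ℝ[X]).Monic ∧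
    (X ^ 2 - C (2 * z.re) * X + C (Complex.normSq z) : ℝ[X]).natDegree = 2 := by
  have : (X ^ 2 - C (2 * z.re) * X + C (Complex.normSq z) : ℝ[X]) =
    X ^ 2 + C (-(2 * z.re)) * X + C (Complex.normSq z) := by simp; ring
  rw [this]
  refine ⟨?_, ?_⟩
  · monicity!
  · compute_degree!

lemma chi_monic (r i : ℕ) (z : ℂ) (m : ℕ) : (chi r i z m).Monic := by
  unfold chi
  split_ifs
  · exact (quad_monic z).1.pow m
  · exact (monic_X_sub_C _).pow m

lemma chi_natDegree (r i : ℕ) (z : ℂ) (m : ℕ) :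
    (chi r i z m).natDegree = if i < r then 2 * m else m := by
  unfold chi
  split_ifs
  · rw [(quad_monic z).1.natDegree_pow, (quad_monic z).2, mul_comm]
  · rw [(monic_X_sub_C _).natDegree_pow, natDegree_X_sub_C, mul_one]

lemma cop_lin {a b : ℂ} (h : a ≠ b) (m n : ℕ) : IsCoprime ((X - C a) ^ m) ((X - C b) ^ n) :=
  (isCoprime_X_sub_C_of_isUnit_sub (sub_ne_zero.mpr h).isUnit).pow

lemma chi_coprime {r i j : ℕ} {z w : ℂ} (hz : ¬ i < r → z.im = 0) (hw : ¬ j < r → w.im = 0)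
    (h1 : z ≠ w) (h2 : z ≠ (starRingEnd ℂ) w) (m n : ℕ) :
    IsCoprime (chi r i z m) (chi r j w n) := by
  rw [← Polynomial.isCoprime_map (algebraMap ℝ ℂ)]
  have h3 : (starRingEnd ℂ) z ≠ w := by
    intro h; apply h2; rw [← h]; simp
  have h4 : (starRingEnd ℂ) z ≠ (starRingEnd ℂ) w := by
    intro h; exact h1 ((starRingEnd ℂ).injective h)
  by_cases hi : i < r <;> by_cases hj : j < r
  · rw [chi_map_lt hi, chi_map_lt hj]
    exact ((cop_lin h1 m n).mul_right (cop_lin h2 m n)).mul_left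
      ((cop_lin h3 m n).mul_right (cop_lin h4 m n))
  · rw [chi_map_lt hi, chi_map_ge hj (hw hj)]
    exact (cop_lin h1 m n).mul_left (cop_lin h3 m n)
  · rw [chi_map_ge hi (hz hi), chi_map_lt hj]
    exact (cop_lin h1 m n).mul_right (cop_lin h2 m n)
  · rw [chi_map_ge hi (hz hi), chi_map_ge hj (hw hj)]
    exact cop_lin h1 m n

lemma mem_spec_iff {m : Type} [Fintype m] [DecidableEq m] (B : Matrix m m ℂ) (w : ℂ) :
    w ∈ spectrum ℂ B ↔ B.charpoly.eval w = 0 := by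
  rw [spectrum.mem_iff, Matrix.isUnit_iff_isUnit_det, isUnit_iff_ne_zero, not_not,
    Matrix.eval_charpoly]
  rfl

lemma spec_lt {m' : Type} [Fintype m'] [DecidableEq m'] {B : Matrix m' m' ℝ} {r i : ℕ} (h : i < r)
    {z : ℂ} {m : ℕ} (hm : 0 < m) (hB : B.charpoly = chi r i z m) :
    spectrum ℂ (B.map (algebraMap ℝ ℂ)) = {z, (starRingEnd ℂ) z} := by
  ext w
  rw [mem_spec_iff, Matrix.charpoly_map, hB, chi_map_lt h]
  simp [sub_eq_zero, hm.ne']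

lemma spec_ge {m' : Type} [Fintype m'] [DecidableEq m'] {B : Matrix m' m' ℝ} {r i : ℕ} (h : ¬ i < r)
    {z : ℂ} (hz : z.im = 0) {m : ℕ} (hm : 0 < m) (hB : B.charpoly = chi r i z m) :
    spectrum ℂ (B.map (algebraMap ℝ ℂ)) = {z} := by
  ext w
  rw [mem_spec_iff, Matrix.charpoly_map, hB, chi_map_ge h hz]
  simp [sub_eq_zero, hm.ne']

end Chi

section SmP
variable {V : Type} [NormedAddCommGroup V] [NormedSpace ℝ V]

/-- Polynomials with smooth coefficients. -/
def SmP (U : Set V) (q : V → ℝ[X]) : Prop :=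
  ∃ d : ℕ, (∀ x, (q x).natDegree ≤ d) ∧ ∀ n, ContDiffOn ℝ (⊤ : ℕ∞) (fun x => (q x).coeff n) U

lemma SmP.mul {U : Set V} {q s : V → ℝ[X]} (hq : SmP U q) (hs : SmP U s) :
    SmP U (fun x => q x * s x) := by
  obtain ⟨d, hd, hd'⟩ := hq
  obtain ⟨e, he, he'⟩ := hs
  refine ⟨d + e, fun x => natDegree_mul_le.trans (add_le_add (hd x) (he x)), fun n => ?_⟩
  simp_rw [coeff_mul]
  exact ContDiffOn.sum fun a _ => (hd' _).mul (he' _)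

lemma SmP.add {U : Set V} {q s : V → ℝ[X]} (hq : SmP U q) (hs : SmP U s) :
    SmP U (fun x => q x + s x) := by
  obtain ⟨d, hd, hd'⟩ := hq
  obtain ⟨e, he, he'⟩ := hs
  refine ⟨max d e, fun x => (natDegree_add_le _ _).trans (max_le_max (hd x) (he x)), fun n => ?_⟩
  simp_rw [coeff_add]
  exact (hd' _).add (he' _)

lemma SmP.const {U : Set V} (q : ℝ[X]) : SmP U (fun _ => q) :=
  ⟨q.natDegree, fun _ => le_rfl, fun _ => contDiffOn_const⟩

lemma SmP.C {U : Set V} {c : V → ℝ} (hc : ContDiffOn ℝ (⊤ : ℕ∞) c U) :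
    SmP U (fun x => Polynomial.C (c x)) := by
  refine ⟨0, fun x => by simp, fun n => ?_⟩
  simp_rw [coeff_C]
  split_ifs
  · exact hc
  · exact contDiffOn_const

lemma SmP.pow {U : Set V} {q : V → ℝ[X]} (hq : SmP U q) (n : ℕ) : SmP U (fun x => q x ^ n) := by
  induction n with
  | zero => simpa using SmP.const 1
  | succ n ih => simp_rw [pow_succ]; exact ih.mul hq

lemma SmP.prod {U : Set V} {ι : Type} (s : Finset ι) {q : ι → V → ℝ[X]} (hq : ∀ i, SmP U (q i)) :
    SmP U (fun x => ∏ i ∈ s, q i x) := by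
  classical
  induction s using Finset.induction_on with
  | empty => simpa using SmP.const 1
  | insert a s ha ih => simp_rw [Finset.prod_insert ha]; exact (hq a).mul ih

lemma SmP.sum {U : Set V} {ι : Type} (s : Finset ι) {q : ι → V → ℝ[X]} (hq : ∀ i, SmP U (q i)) :
    SmP U (fun x => ∑ i ∈ s, q i x) := by
  classical
  induction s using Finset.induction_on with
  | empty => simpa using SmP.const 0
  | insert a s ha ih => simp_rw [Finset.sum_insert ha]; exact (hq a).add ih

lemma SmP.aeval {U : Set V} {A : Type} [NormedRing A] [NormedAlgebra ℝ A] {q : V → ℝ[X]}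
    (hq : SmP U q) {L : V → A} (hL : ContDiffOn ℝ (⊤ : ℕ∞) L U) :
    ContDiffOn ℝ (⊤ : ℕ∞) (fun x => Polynomial.aeval (L x) (q x)) U := by
  obtain ⟨d, hd, hd'⟩ := hq
  have : (fun x => Polynomial.aeval (L x) (q x)) =
      fun x => ∑ n ∈ Finset.range (d + 1), (q x).coeff n • L x ^ n := by
    ext1 x
    exact Polynomial.aeval_eq_sum_range' (Nat.lt_succ_of_le (hd x)) _
  rw [this]
  exact ContDiffOn.sum fun n _ => (hd' n).smul (hL.pow n)

lemma SmP.comp {W : Type} [NormedAddCommGroup W] [NormedSpace ℝ W] {U : Set V} {D : Set W}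
    {q : V → ℝ[X]} (hq : SmP U q) {φ : W → V} (hφ : ContDiffOn ℝ (⊤ : ℕ∞) φ D)
    (hm : Set.MapsTo φ D U) : SmP D (fun x => q (φ x)) := by
  obtain ⟨d, hd, hd'⟩ := hq
  exact ⟨d, fun x => hd _, fun n => (hd' n).comp hφ hm⟩

lemma chi_smP {U : Set V} {lam : V → ℂ} (hl : ContDiffOn ℝ (⊤ : ℕ∞) lam U) (r i m : ℕ) :
    SmP U (fun x => chi r i (lam x) m) := by
  have hre : ContDiffOn ℝ (⊤ : ℕ∞) (fun x => (lam x).re) U :=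
    Complex.reCLM.contDiff.comp_contDiffOn hl
  have him : ContDiffOn ℝ (⊤ : ℕ∞) (fun x => (lam x).im) U :=
    Complex.imCLM.contDiff.comp_contDiffOn hl
  unfold chi
  split_ifs
  · apply SmP.pow
    have h1 : (fun x => (X ^ 2 - Polynomial.C (2 * (lam x).re) * X + Polynomial.C (Complex.normSq (lam x)) : ℝ[X]))
      = fun x => X ^ 2 + Polynomial.C (-(2 * (lam x).re)) * X + Polynomial.C ((lam x).re * (lam x).re
        + (lam x).im * (lam x).im) := by
      ext1 x
      rw [Complex.normSq_apply, Polynomial.C_neg]; ring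
    rw [h1]
    exact ((SmP.const (X ^ 2)).add ((SmP.C (contDiffOn_const.mul hre).neg).mul (SmP.const X))).add
      (SmP.C ((hre.mul hre).add (him.mul him)))
  · apply SmP.pow
    simp_rw [sub_eq_add_neg, ← Polynomial.C_neg]
    exact (SmP.const X).add (SmP.C hre.neg)
end SmP
end PartP6b

section PartP7
section Jacobi
variable {V : Type} [NormedAddCommGroup V] [NormedSpace ℝ V] [FiniteDimensional ℝ V]

/-- Determinant of a continuous endomorphism. -/
noncomputable def cdet (T : V →L[ℝ] V) : ℝ := LinearMap.det (T : V →ₗ[ℝ] V)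

lemma cdet_mul (S T : V →L[ℝ] V) : cdet (S * T) = cdet S * cdet T := by
  unfold cdet
  rw [← map_mul]; rfl

lemma cdet_one : cdet (1 : V →L[ℝ] V) = 1 := by
  unfold cdet
  exact map_one _

lemma cdet_differentiable : Differentiable ℝ (cdet (V := V)) := by
  let b := Module.finBasis ℝ V
  have h : ∀ T : V →L[ℝ] V, cdet T = (LinearMap.toMatrix b b (T : V →ₗ[ℝ] V)).det := by
    intro T; rw [LinearMap.det_toMatrix]; rfl
  have h' : (cdet (V := V)) = fun T : V →L[ℝ] V => (LinearMap.toMatrix b b (T : V →ₗ[ℝ] V)).det := funext h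
  rw [h']
  simp_rw [Matrix.det_apply]
  refine Differentiable.fun_sum fun σ _ => ?_
  refine Differentiable.const_smul ?_ _
  refine ContDiff.differentiable (n := 1) (contDiff_prod fun i _ => ?_) one_ne_zero
  have : ContDiff ℝ 1 fun T : V →L[ℝ] V => (b.coord (σ i)).toContinuousLinearMap (T (b i)) := by
    exact (b.coord (σ i)).toContinuousLinearMap.contDiff.comp
      (contDiff_id.clm_apply contDiff_const)
  have h3 : (fun T : V →L[ℝ] V => LinearMap.toMatrix b b (T : V →ₗ[ℝ] V) (σ i) i) = fun T => (b.coord (σ i)).toContinuousLinearMap (T (b i)) := by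
    funext T; rw [LinearMap.toMatrix_apply]; rfl
  rw [h3]; exact this

lemma cdet_line (M : V →L[ℝ] V) : HasDerivAt (fun s : ℝ => cdet (1 + s • M)) (ctr M) 0 := by
  let b := Module.finBasis ℝ V
  let A := LinearMap.toMatrix b b (M : V →ₗ[ℝ] V)
  let q : ℝ[X] := det (1 + (X : ℝ[X]) • A.map C)
  have hq : ∀ s, cdet (1 + s • M) = q.eval s := by
    intro s
    have : cdet (1 + s • M) = (LinearMap.toMatrix b b ((1 + s • M : V →L[ℝ] V) : V →ₗ[ℝ] V)).det := by
      rw [LinearMap.det_toMatrix]; rfl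
    rw [this]
    have h2 : LinearMap.toMatrix b b ((1 + s • M : V →L[ℝ] V) : V →ₗ[ℝ] V) = 1 + s • A := by
      have : ((1 + s • M : V →L[ℝ] V) : V →ₗ[ℝ] V) = 1 + s • (M : V →ₗ[ℝ] V) := rfl
      rw [this, map_add, map_smul, LinearMap.toMatrix_one]
    rw [h2]
    simp only [q]
    rw [← Polynomial.coe_evalRingHom, RingHom.map_det]
    congr 1
    ext i j
    simp [Matrix.one_apply, apply_ite]
    ring
  simp_rw [hq]
  have h3 := q.hasDerivAt 0
  rw [derivative_det_one_add_X_smul] at h3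
  have h4 : ctr M = A.trace := by
    unfold ctr
    rw [LinearMap.trace_eq_matrix_trace ℝ b]
  rw [h4]
  exact h3

lemma cdet_fderiv {T S : V →L[ℝ] V} (h : T * S = 1) (M : V →L[ℝ] V) :
    fderiv ℝ cdet T M = cdet T * ctr (S * M) := by
  have h1 : HasDerivAt (fun s : ℝ => cdet (T + s • M)) (fderiv ℝ cdet T M) 0 := by
    have hl : HasDerivAt (fun s : ℝ => T + s • M) M 0 := by
      simpa using ((hasDerivAt_id (0:ℝ)).smul_const M).const_add T
    have hd : HasFDerivAt (cdet (V := V)) (fderiv ℝ cdet T) (T + (0:ℝ) • M) := by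
      simpa using (cdet_differentiable T).hasFDerivAt
    exact hd.comp_hasDerivAt (0:ℝ) hl
  have h2 := (cdet_line (S * M)).const_mul (cdet T)
  refine h1.unique (h2.congr_of_eventuallyEq (Filter.Eventually.of_forall fun s => ?_))
  simp only
  rw [← cdet_mul, mul_add, mul_one, mul_smul_comm, ← mul_assoc, h, one_mul]

lemma cdet_unit {T : V →L[ℝ] V} (h : cdet T ≠ 0) : ∃ S, T * S = 1 ∧ S * T = 1 := by
  have hu : IsUnit (LinearMap.det (T : V →ₗ[ℝ] V)) := isUnit_iff_ne_zero.mpr h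
  let e := LinearEquiv.ofIsUnitDet (v := Module.finBasis ℝ V) (v' := Module.finBasis ℝ V)
    (f := (T : V →ₗ[ℝ] V)) (h := by rw [LinearMap.det_toMatrix]; exact hu)
  have he : ∀ x, e x = T x := fun x => rfl
  refine ⟨(e.symm : V →ₗ[ℝ] V).toContinuousLinearMap, ?_, ?_⟩
  · ext x; simp [← he]
  · ext x
    show e.symm (T x) = x
    rw [← he]; simp

/-- Differential identity for the characteristic polynomial of a Nijenhuis operator. -/
lemma char_nij {L : V → V →L[ℝ] V} {x : V} (hL : DifferentiableAt ℝ L x)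
    (hN : Nij (L x) (fderiv ℝ L x)) (t : ℝ) (ht : cdet (t • 1 - L x) ≠ 0) (X : V) :
    fderiv ℝ (fun y => cdet (t • 1 - L y)) x (L x X) - t * fderiv ℝ (fun y => cdet (t • 1 - L y)) x X
      = ctr (fderiv ℝ L x X) * cdet (t • 1 - L x) := by
  obtain ⟨S, hS, hS'⟩ := cdet_unit ht
  have hD : ∀ Y, fderiv ℝ (fun y => cdet (t • 1 - L y)) x Y
      = - (cdet (t • 1 - L x) * ctr (S * fderiv ℝ L x Y)) := by
    intro Y
    have h1 : HasFDerivAt (fun y => t • 1 - L y) (-(fderiv ℝ L x)) x :=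
      hL.hasFDerivAt.const_sub (t • 1)
    have h2 : HasFDerivAt (fun y => cdet (t • 1 - L y)) _ x :=
      HasFDerivAt.comp (g := cdet) x (cdet_differentiable (t • 1 - L x)).hasFDerivAt h1
    rw [h2.fderiv]
    simp only [ContinuousLinearMap.comp_apply, ContinuousLinearMap.neg_apply, map_neg]
    rw [cdet_fderiv hS]
  rw [hD, hD]
  let B : V →L[ℝ] V := (fderiv ℝ L x).flip X
  have hB : ∀ Y, B Y = fderiv ℝ L x Y X := fun Y => rfl
  let K : V →L[ℝ] V := t • 1 - L x
  have e : fderiv ℝ L x (L x X) = t • fderiv ℝ L x X - K * fderiv ℝ L x X + (K * B - B * K) := by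
    ext Y
    have := hN X Y
    simp only [K, ContinuousLinearMap.add_apply, ContinuousLinearMap.sub_apply,
      ContinuousLinearMap.mul_apply, ContinuousLinearMap.smul_apply,
      ContinuousLinearMap.one_apply, hB, map_sub, map_smul]
    rw [← sub_eq_zero, ← this]
    abel
  have e2 : S * fderiv ℝ L x (L x X) = t • (S * fderiv ℝ L x X) - fderiv ℝ L x X
      + (B - S * (B * K)) := by
    rw [e, mul_add, mul_sub, mul_sub, ← mul_assoc, ← mul_assoc S K B, hS', one_mul, one_mul,
      mul_smul_comm]
  have e3 : ctr (S * (B * K)) = ctr B := by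
    rw [ctr_comm, mul_assoc, hS, mul_one]
  rw [e2, ctr_add, ctr_sub, ctr_sub, ctr_smul, e3]
  ring
end Jacobi
end PartP7

section PartP8
open Filter Topology

section SplitA
variable {V : Type} [NormedAddCommGroup V] [NormedSpace ℝ V] [FiniteDimensional ℝ V]

lemma line_deriv {F : Type*} [NormedAddCommGroup F] [NormedSpace ℝ F] {f : V → F} {x : V}
    (hf : DifferentiableAt ℝ f x) (X : V) :
    HasDerivAt (fun s : ℝ => f (x + s • X)) (fderiv ℝ f x X) 0 := by
  have hl : HasDerivAt (fun s : ℝ => x + s • X) X 0 := by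
    simpa using ((hasDerivAt_id (0:ℝ)).smul_const X).const_add x
  have hd : HasFDerivAt f (fderiv ℝ f x) (x + (0:ℝ) • X) := by
    simpa using hf.hasFDerivAt
  exact hd.comp_hasDerivAt (0:ℝ) hl

lemma line_mem {D : Set V} (hD : IsOpen D) {x : V} (hx : x ∈ D) (X : V) :
    ∀ᶠ s : ℝ in 𝓝 0, x + s • X ∈ D := by
  have hc : Continuous (fun s : ℝ => x + s • X) := by fun_prop
  have : Tendsto (fun s : ℝ => x + s • X) (𝓝 0) (𝓝 x) := by
    simpa using hc.tendsto 0
  exact this.eventually (hD.mem_nhds hx)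

lemma fderiv_zero_of_const {F : Type*} [NormedAddCommGroup F] [NormedSpace ℝ F] {f : V → F}
    {D : Set V} (hD : IsOpen D) {x : V} (hx : x ∈ D) (hf : DifferentiableAt ℝ f x) {π : V →L[ℝ] V}
    (h : ∀ y ∈ D, π y = π x → f y = f x) {X : V} (hX : π X = 0) : fderiv ℝ f x X = 0 := by
  refine (line_deriv hf X).unique ((hasDerivAt_const (0:ℝ) (f x)).congr_of_eventuallyEq ?_)
  filter_upwards [line_mem hD hx X] with s hs
  exact h _ hs (by simp [hX])

lemma const_of_fderiv_zero {F : Type*} [NormedAddCommGroup F] [NormedSpace ℝ F] {f : V → F}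
    {D : Set V} (hD : IsOpen D) (hconv : Convex ℝ D) (hf : ∀ x ∈ D, DifferentiableAt ℝ f x)
    {π : V →L[ℝ] V} (h : ∀ x ∈ D, ∀ X, π X = 0 → fderiv ℝ f x X = 0)
    {x y : V} (hx : x ∈ D) (hy : y ∈ D) (hxy : π x = π y) : f x = f y := by
  have hmem : ∀ s ∈ Set.Icc (0:ℝ) 1, x + s • (y - x) ∈ D := fun s hs =>
    hconv.add_smul_sub_mem hx hy hs
  have hd : ∀ s ∈ Set.Icc (0:ℝ) 1, HasDerivWithinAt (fun s : ℝ => f (x + s • (y - x))) 0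
      (Set.Icc 0 1) s := by
    intro s hs
    have hl : HasDerivAt (fun s : ℝ => x + s • (y - x)) (y - x) s := by
      simpa using ((hasDerivAt_id s).smul_const (y - x)).const_add x
    have h1 := ((hf _ (hmem s hs)).hasFDerivAt.comp_hasDerivAt s hl).hasDerivWithinAt (s := Set.Icc (0:ℝ) 1)
    rw [h _ (hmem s hs) (y - x) (by simp [hxy])] at h1
    exact h1
  have := constant_of_has_deriv_right_zero (f := fun s : ℝ => f (x + s • (y - x))) (a := 0) (b := 1)
    (fun s hs => (hd s hs).continuousWithinAt)
    (fun s hs => ((hd s ⟨hs.1, hs.2.le⟩).mono_of_mem_nhdsWithin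
      (Icc_mem_nhdsGE_of_mem hs)))
    1 (by simp)
  simpa using this.symm

lemma aeval_selfadj {H : V →L[ℝ] V →L[ℝ] ℝ} {L : V →L[ℝ] V}
    (h : ∀ X Y, H (L X) Y = H X (L Y)) (q : ℝ[X]) (X Y : V) :
    H (aeval L q X) Y = H X (aeval L q Y) := by
  induction q using Polynomial.induction_on' generalizing X Y with
  | add p q hp hq => simp [hp, hq]
  | monomial n a =>
    simp only [aeval_monomial, ContinuousLinearMap.mul_apply,
      Algebra.algebraMap_eq_smul_one, smul_mul_assoc, one_mul, ContinuousLinearMap.smul_apply,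
      map_smul]
    congr 1
    induction n generalizing X Y with
    | zero => simp
    | succ n ih => rw [pow_succ', ContinuousLinearMap.mul_apply, h, ih, ← pow_succ', pow_succ]; rfl

lemma aeval_mul_apply (L : V →L[ℝ] V) (p q : ℝ[X]) (X : V) :
    aeval L (p * q) X = aeval L p (aeval L q X) := by rw [map_mul]; rfl

lemma aeval_X_apply (L : V →L[ℝ] V) (X : V) : aeval L (Polynomial.X : ℝ[X]) X = L X := by
  rw [aeval_X]

/-- The bilinear form twisted by an operator. -/
noncomputable def twist (H : V →L[ℝ] V →L[ℝ] ℝ) (A : V →L[ℝ] V) : V →L[ℝ] V →L[ℝ] ℝ :=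
  ((ContinuousLinearMap.compL ℝ V V ℝ).flip A).comp H

lemma twist_apply (H : V →L[ℝ] V →L[ℝ] ℝ) (A : V →L[ℝ] V) (X Y : V) :
    twist H A X Y = H X (A Y) := rfl

lemma twist_diff {H : V → V →L[ℝ] V →L[ℝ] ℝ} {A : V → V →L[ℝ] V} {x : V}
    (hH : DifferentiableAt ℝ H x) (hA : DifferentiableAt ℝ A x) :
    DifferentiableAt ℝ (fun y => twist (H y) (A y)) x := by
  unfold twist
  exact ((ContinuousLinearMap.differentiableAt _).comp x hA).clm_comp hH

lemma twist_fderiv {H : V → V →L[ℝ] V →L[ℝ] ℝ} {A : V → V →L[ℝ] V} {x : V}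
    (hH : DifferentiableAt ℝ H x) (hA : DifferentiableAt ℝ A x) (Z X Y : V) :
    fderiv ℝ (fun y => twist (H y) (A y)) x Z X Y
      = fderiv ℝ H x Z X (A x Y) + H x X (fderiv ℝ A x Z Y) := by
  have h := twist_diff hH hA
  rw [← fderiv_clm_apply' h, ← fderiv_clm_apply' (h.clm_apply (differentiableAt_const X))]
  simp only [twist_apply]
  have := ((hH.hasFDerivAt.clm_apply (hasFDerivAt_const X x)).clm_apply
    (hA.hasFDerivAt.clm_apply (hasFDerivAt_const Y x))).fderiv
  rw [this]
  simp
  ring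

lemma aeval_diff {L : V → V →L[ℝ] V} {x : V} (hL : DifferentiableAt ℝ L x) (q : ℝ[X]) :
    DifferentiableAt ℝ (fun y => aeval (L y) q) x := by
  induction q using Polynomial.induction_on' with
  | add p q hp hq => simp only [map_add]; exact hp.add hq
  | monomial n a =>
    simp only [aeval_monomial, Algebra.algebraMap_eq_smul_one, smul_mul_assoc, one_mul]
    exact (hL.pow n).const_smul a

lemma edef_add {G G' G'' : V →L[ℝ] V →L[ℝ] ℝ} {DG DG' DG'' : V →L[ℝ] V →L[ℝ] V →L[ℝ] ℝ}
    {L : V →L[ℝ] V} {DL : V →L[ℝ] V →L[ℝ] V} (h : ∀ X Y, G'' X Y = G X Y + G' X Y)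
    (hD : ∀ X Y Z, DG'' X Y Z = DG X Y Z + DG' X Y Z) (X Y Z : V) :
    Edef G'' DG'' L DL X Y Z = Edef G DG L DL X Y Z + Edef G' DG' L DL X Y Z := by
  simp only [Edef, h, hD]; ring

lemma edef_smul {G G'' : V →L[ℝ] V →L[ℝ] ℝ} {DG DG'' : V →L[ℝ] V →L[ℝ] V →L[ℝ] ℝ}
    {L : V →L[ℝ] V} {DL : V →L[ℝ] V →L[ℝ] V} (c : ℝ) (h : ∀ X Y, G'' X Y = c * G X Y)
    (hD : ∀ X Y Z, DG'' X Y Z = c * DG X Y Z) (X Y Z : V) :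
    Edef G'' DG'' L DL X Y Z = c * Edef G DG L DL X Y Z := by
  simp only [Edef, h, hD]; ring

lemma edef_addZ {G : V →L[ℝ] V →L[ℝ] ℝ} {DG : V →L[ℝ] V →L[ℝ] V →L[ℝ] ℝ}
    {L : V →L[ℝ] V} {DL : V →L[ℝ] V →L[ℝ] V} (X Y Z Z' : V) :
    Edef G DG L DL X Y (Z + Z') = Edef G DG L DL X Y Z + Edef G DG L DL X Y Z' := by
  simp [Edef]; ring

lemma edef_smulZ {G : V →L[ℝ] V →L[ℝ] ℝ} {DG : V →L[ℝ] V →L[ℝ] V →L[ℝ] ℝ}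
    {L : V →L[ℝ] V} {DL : V →L[ℝ] V →L[ℝ] V} (c : ℝ) (X Y Z : V) :
    Edef G DG L DL X Y (c • Z) = c * Edef G DG L DL X Y Z := by
  simp [Edef]; ring

lemma EF_poly {H : V → V →L[ℝ] V →L[ℝ] ℝ} {L : V → V →L[ℝ] V} {x : V}
    (hH : DifferentiableAt ℝ H x) (hL : DifferentiableAt ℝ L x)
    (hs : ∀ X Y, H x X Y = H x Y X) (hLs : ∀ X Y, H x (L x X) Y = H x X (L x Y))
    (hN : Nij (L x) (fderiv ℝ L x)) (q : ℝ[X]) (X Y Z : V) :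
    EF (fun y => twist (H y) (aeval (L y) q)) L x X Y Z = EF H L x X Y (aeval (L x) q Z) := by
  induction q using Polynomial.induction_on' generalizing X Y Z with
  | add p q hp hq =>
    have hpd := aeval_diff hL p
    have hqd := aeval_diff hL q
    have hD : ∀ Z Y, fderiv ℝ (fun y => aeval (L y) (p + q)) x Z Y
        = fderiv ℝ (fun y => aeval (L y) p) x Z Y + fderiv ℝ (fun y => aeval (L y) q) x Z Y := by
      intro Z Y
      simp only [map_add]
      rw [(hpd.hasFDerivAt.fun_add hqd.hasFDerivAt).fderiv]
      rfl
    unfold EF at hp hq ⊢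
    rw [edef_add (G := twist (H x) (aeval (L x) p)) (G' := twist (H x) (aeval (L x) q))
      (DG := fderiv ℝ (fun y => twist (H y) (aeval (L y) p)) x)
      (DG' := fderiv ℝ (fun y => twist (H y) (aeval (L y) q)) x) ?_ ?_,
      hp, hq, map_add, ContinuousLinearMap.add_apply, edef_addZ]
    · intro X Y; simp [twist_apply]
    · intro X Y Z
      rw [twist_fderiv hH (aeval_diff hL (p + q)), twist_fderiv hH hpd, twist_fderiv hH hqd, hD]
      simp only [map_add, ContinuousLinearMap.add_apply]
      ring
  | monomial n a =>
    have key : ∀ n X Y Z, EF (fun y => twist (H y) (L y ^ n)) L x X Y Z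
        = EF H L x X Y ((L x ^ n) Z) := by
      intro n
      induction n with
      | zero =>
        intro X Y Z
        have e : (fun y => twist (H y) (L y ^ 0)) = H := by
          ext y X Y; simp [twist_apply]
        rw [e]; simp
      | succ n ih =>
        intro X Y Z
        rw [pow_succ, ContinuousLinearMap.mul_apply, ← ih]
        have hp : DifferentiableAt ℝ (fun y => L y ^ n) x := hL.pow n
        have hd := twist_diff hH hp
        unfold EF
        have hpow : ∀ X Y, H x ((L x ^ n) X) Y = H x X ((L x ^ n) Y) := by
          intro X Y
          have := aeval_selfadj hLs (Polynomial.X ^ n) X Y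
          simpa using this
        have hcom : ∀ X, (L x ^ n) (L x X) = L x ((L x ^ n) X) := by
          intro X
          have : L x ^ n * L x = L x * L x ^ n := by rw [← pow_succ, pow_succ']
          exact congrArg (fun T => T X) this
        refine edef_mul ?_ ?_ hN ?_ ?_ X Y Z
        · intro X Y; rw [twist_apply, twist_apply, ← hpow, hs]
        · intro X Y; rw [twist_apply, twist_apply, hcom, hLs]
        · intro X Y; rw [twist_apply, twist_apply, pow_succ]; rfl
        · intro Z X Y
          have e : (fun y => twist (H y) (L y ^ (n+1))) =
            fun y => twist (twist (H y) (L y ^ n)) (L y) := by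
            ext y X Y; simp only [twist_apply]; rw [pow_succ]; rfl
          rw [e, twist_fderiv hd hL]
    have hpd : DifferentiableAt ℝ (fun y => L y ^ n) x := hL.pow n
    have e : (fun y => aeval (L y) (monomial n a)) = fun y => a • L y ^ n := by
      ext1 y
      simp [aeval_monomial, Algebra.algebraMap_eq_smul_one]
    have e0 : aeval (L x) (monomial n a) = a • L x ^ n := congrFun e x
    have hD : ∀ Z Y, fderiv ℝ (fun y => aeval (L y) (monomial n a)) x Z Y
        = a • fderiv ℝ (fun y => L y ^ n) x Z Y := by
      intro Z Y
      rw [e, (hpd.hasFDerivAt.fun_const_smul a).fderiv]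
      rfl
    have k := key n X Y Z
    unfold EF at k ⊢
    rw [edef_smul (G := twist (H x) (L x ^ n))
      (DG := fderiv ℝ (fun y => twist (H y) (L y ^ n)) x) a ?_ ?_, k, e0,
      ContinuousLinearMap.smul_apply, edef_smulZ]
    · intro X Y; rw [twist_apply, twist_apply, e0]; simp
    · intro X Y Z
      rw [twist_fderiv hH (aeval_diff hL _), twist_fderiv hH hpd, hD, e0]
      simp only [map_smul, ContinuousLinearMap.smul_apply, smul_eq_mul]
      ring
end SplitA
end PartP8

section PartP9
open Filter Topology

section SplitB
variable {V : Type} [NormedAddCommGroup V] [NormedSpace ℝ V] [FiniteDimensional ℝ V]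
  {ι : Type} [Fintype ι] [DecidableEq ι]

/-- The data of a pair whose spectral projections are constant. -/
structure SData (D : Set V) (G H : V → V →L[ℝ] V →L[ℝ] ℝ) (L : V → V →L[ℝ] V)
    (χ : ι → V → ℝ[X]) (π : ι → V →L[ℝ] V) : Prop where
  hD : IsOpen D
  hconv : Convex ℝ D
  hG : ∀ x ∈ D, DifferentiableAt ℝ G x
  hH : ∀ x ∈ D, DifferentiableAt ℝ H x
  hL : ∀ x ∈ D, DifferentiableAt ℝ L x
  hχ : ∀ i, SmP D (χ i)
  hmon : ∀ x ∈ D, ∀ i, (χ i x).Monic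
  hc : ∀ x ∈ D, ∀ i j, i ≠ j → IsCoprime (χ i x) (χ j x)
  h0 : ∀ x ∈ D, aeval (L x) (∏ i, χ i x) = 0
  hπ : ∀ x ∈ D, ∀ i, prj (L x) (fun i => χ i x) i = π i
  hHs : ∀ x ∈ D, ∀ X Y, H x X Y = H x Y X
  hHL : ∀ x ∈ D, ∀ X Y, H x (L x X) Y = H x X (L x Y)
  hHnd : ∀ x ∈ D, ∀ N, (∀ W, H x W N = 0) → N = 0
  hGH : ∀ x ∈ D, ∀ X Y, G x X Y = H x X (aeval (L x) (∑ i, cof (fun i => χ i x) i) Y)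
  hE : ∀ x ∈ D, ∀ X Y Z, EF G L x X Y Z = 0

namespace SData
variable {D : Set V} {G H : V → V →L[ℝ] V →L[ℝ] ℝ} {L : V → V →L[ℝ] V}
    {χ : ι → V → ℝ[X]} {π : ι → V →L[ℝ] V}

lemma pp (S : SData D G H L χ π) {x : V} (hx : x ∈ D) (i : ι) (X : V) : π i (π i X) = π i X := by
  have := prj_idem (S.hc x hx) (S.h0 x hx) i
  rw [S.hπ x hx] at this
  exact congrArg (fun T => T X) this

lemma porth (S : SData D G H L χ π) {x : V} (hx : x ∈ D) {i j : ι} (hij : i ≠ j) (X : V) :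
    π i (π j X) = 0 := by
  have := prj_orth (S.hc x hx) (S.h0 x hx) hij
  rw [S.hπ x hx, S.hπ x hx] at this
  exact congrArg (fun T => T X) this

lemma psum (S : SData D G H L χ π) {x : V} (hx : x ∈ D) (X : V) : ∑ i, π i X = X := by
  have := prj_sum (S.hc x hx) (S.h0 x hx)
  simp_rw [S.hπ x hx] at this
  have h := congrArg (fun T => T X) this
  simpa using h

lemma pcomm (S : SData D G H L χ π) {x : V} (hx : x ∈ D) (i : ι) (q : ℝ[X]) (X : V) :
    π i (aeval (L x) q X) = aeval (L x) q (π i X) := by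
  have := prj_comm (S.hc x hx) (S.h0 x hx) i q
  rw [S.hπ x hx] at this
  exact congrArg (fun T => T X) this

lemma pcommL (S : SData D G H L χ π) {x : V} (hx : x ∈ D) (i : ι) (X : V) :
    π i (L x X) = L x (π i X) := by
  have := S.pcomm hx i Polynomial.X X
  simpa using this

lemma pkill (S : SData D G H L χ π) {x : V} (hx : x ∈ D) (i : ι) (X : V) :
    aeval (L x) (χ i x) (π i X) = 0 := by
  have := prj_kill (S.hc x hx) (S.h0 x hx) i
  rw [S.hπ x hx] at this
  exact congrArg (fun T => T X) this

lemma pcof (S : SData D G H L χ π) {x : V} (hx : x ∈ D) (i : ι) (X : V) :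
    aeval (L x) (∑ i, cof (fun i => χ i x) i) (π i X) = aeval (L x) (cof (fun i => χ i x) i) X := by
  have := prj_cof (S.hc x hx) (S.h0 x hx) i
  rw [S.hπ x hx] at this
  exact congrArg (fun T => T X) this

lemma pinv (S : SData D G H L χ π) {x : V} (hx : x ∈ D) (i : ι) :
    ∃ s t : ℝ[X], ∀ X, aeval (L x) (χ i x) (aeval (L x) s X)
      + aeval (L x) (cof (fun i => χ i x) i) (aeval (L x) t X) = X := by
  obtain ⟨s, t, h⟩ := prj_inv (S.hc x hx) (S.h0 x hx) i
  exact ⟨s, t, fun X => congrArg (fun T => T X) h⟩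

/-- cofactor vanishes on the kernel -/
lemma cof_ker (S : SData D G H L χ π) {x : V} (hx : x ∈ D) {i : ι} {X : V} (hX : π i X = 0) :
    aeval (L x) (cof (fun i => χ i x) i) X = 0 := by
  rw [← S.pcof hx, hX, map_zero]

lemma ker_surj (S : SData D G H L χ π) {x : V} (hx : x ∈ D) {i : ι} {X : V} (hX : π i X = 0) :
    ∃ Y, aeval (L x) (χ i x) Y = X ∧ π i Y = 0 := by
  obtain ⟨s, t, h⟩ := S.pinv hx i
  refine ⟨aeval (L x) s X, ?_, by rw [S.pcomm hx, hX, map_zero]⟩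
  have h1 := h X
  rwa [S.cof_ker hx (by rw [S.pcomm hx, hX, map_zero]), add_zero] at h1

lemma im_surj (S : SData D G H L χ π) {x : V} (hx : x ∈ D) {i : ι} {X : V} (hX : π i X = X) :
    ∃ Y, aeval (L x) (cof (fun i => χ i x) i) Y = X ∧ π i Y = Y := by
  obtain ⟨s, t, h⟩ := S.pinv hx i
  refine ⟨aeval (L x) t X, ?_, by rw [S.pcomm hx, hX]⟩
  have h1 := h X
  rw [← hX] at h1
  rwa [← S.pcomm hx, S.pkill hx, zero_add, hX] at h1

lemma hGs (S : SData D G H L χ π) {x : V} (hx : x ∈ D) (X Y : V) : G x X Y = G x Y X := by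
  rw [S.hGH x hx, S.hGH x hx, ← aeval_selfadj (S.hHL x hx), S.hHs x hx]

lemma hGL (S : SData D G H L χ π) {x : V} (hx : x ∈ D) (X Y : V) :
    G x (L x X) Y = G x X (L x Y) := by
  rw [S.hGH x hx, S.hGH x hx, S.hHL x hx, ← aeval_X_apply (L x), ← aeval_mul_apply, mul_comm,
    aeval_mul_apply, aeval_X_apply]

lemma hGnd (S : SData D G H L χ π) {x : V} (hx : x ∈ D) (N : V) (h : ∀ W, G x W N = 0) : N = 0 := by
  obtain ⟨u, h1, h2, h3⟩ := sumcof_unit (S.hc x hx) (S.h0 x hx)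
  have h4 := S.hHnd x hx _ (fun W => (S.hGH x hx W N).symm.trans (h W))
  have h5 := congrArg (fun T => T N) h1
  simp only [ContinuousLinearMap.one_apply] at h5
  rw [← h5, aeval_mul_apply, h4, map_zero]

lemma nij (S : SData D G H L χ π) {x : V} (hx : x ∈ D) : Nij (L x) (fderiv ℝ L x) := by
  have hm : ∀ᶠ y in 𝓝 x, y ∈ D := S.hD.mem_nhds hx
  exact nij_of_EF (S.hG x hx) (S.hL x hx) (hm.mono fun y hy X Y => S.hGs hy X Y)
    (hm.mono fun y hy X Y => S.hGL hy X Y) (S.hGnd hx) (S.hE x hx)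

/-- The derivative of `L` commutes with the projections. -/
lemma dcomm (S : SData D G H L χ π) {x : V} (hx : x ∈ D) (i : ι) (X Y : V) :
    π i (fderiv ℝ L x X Y) = fderiv ℝ L x X (π i Y) := by
  have h1 := (π i).hasFDerivAt.comp_hasDerivAt (0:ℝ)
    (line_deriv ((S.hL x hx).clm_apply (differentiableAt_const Y)) X)
  have h2 := line_deriv ((S.hL x hx).clm_apply (differentiableAt_const (π i Y))) X
  rw [fderiv_clm_apply' (S.hL x hx)] at h1 h2
  refine h1.unique (h2.congr_of_eventuallyEq ?_)
  filter_upwards [line_mem S.hD hx X] with s hs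
  exact S.pcommL hs i Y

lemma dL_zero (S : SData D G H L χ π) {x : V} (hx : x ∈ D) (i : ι) {X : V} (hX : π i X = 0) (Y : V) :
    fderiv ℝ L x X (π i Y) = 0 := by
  have hmain : ∀ X, π i X = 0 → fderiv ℝ L x (L x X) (π i Y) = L x (fderiv ℝ L x X (π i Y)) := by
    intro X hX
    have h1 := congrArg (π i) (S.nij hx X (π i Y))
    simp only [map_add, map_sub, map_zero, S.pcommL hx, S.dcomm hx, S.pp hx, hX] at h1
    simpa [sub_eq_zero] using h1
  let σ : V →L[ℝ] V := ((fderiv ℝ L x).flip (π i Y)).comp (1 - π i)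
  have hσ : ∀ X, σ X = fderiv ℝ L x (X - π i X) (π i Y) := fun X => rfl
  obtain ⟨Z, hZ, hZ'⟩ := S.ker_surj hx hX
  have := sylv_zero σ (L x) (L x) (fun X => by
    rw [hσ, hσ, ← hmain _ (by rw [map_sub, S.pp hx, sub_self]), S.pcommL hx, map_sub (L x)])
    (χ i x) (fun X => by rw [hσ, ← S.dcomm hx, S.pkill hx]) Z X (by rw [hZ])
  rwa [hσ, hX, sub_zero] at this

lemma dL_zero' (S : SData D G H L χ π) {x : V} (hx : x ∈ D) (i : ι) {X : V} (hX : π i X = X)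
    {Y : V} (hY : π i Y = 0) : fderiv ℝ L x X Y = 0 := by
  rw [← S.psum hx Y, map_sum]
  refine Finset.sum_eq_zero fun j _ => ?_
  by_cases h : j = i
  · rw [h, hY, map_zero]
  · exact S.dL_zero hx j (by rw [← hX, S.porth hx h]) Y

/-- The blocks of `L` depend only on their own coordinates. -/
lemma L_const (S : SData D G H L χ π) {x y : V} (hx : x ∈ D) (hy : y ∈ D) {i : ι}
    (h : π i x = π i y) (Y : V) : L x (π i Y) = L y (π i Y) := by
  refine const_of_fderiv_zero (f := fun x => L x (π i Y)) S.hD S.hconv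
    (fun z hz => (S.hL z hz).clm_apply (differentiableAt_const _)) (π := π i) ?_ hx hy h
  intro z hz X hX
  rw [fderiv_clm_apply' (S.hL z hz), S.dL_zero hz i hX]

lemma Lq_const (S : SData D G H L χ π) {x y : V} (hx : x ∈ D) (hy : y ∈ D) {i : ι}
    (h : π i x = π i y) (q : ℝ[X]) {Z : V} (hZ : π i Z = Z) :
    aeval (L y) q Z = aeval (L x) q Z := by
  have := intertwine (π i) (L x) (L y) (fun X => by
    rw [S.pcommL hx, S.L_const hx hy h]) q Z
  rw [S.pcomm hx, hZ] at this
  exact this.symm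

lemma Gorth (S : SData D G H L χ π) {x : V} (hx : x ∈ D) {i : ι} {X Y : V} (hX : π i X = 0)
    (hY : π i Y = Y) : G x X Y = 0 := by
  obtain ⟨u, hu, -⟩ := prj_poly (S.hc x hx) (S.h0 x hx)
  have h1 := hu i
  rw [S.hπ x hx] at h1
  rw [← hY, h1, ← aeval_selfadj (S.hGL hx), ← h1, hX, map_zero, ContinuousLinearMap.zero_apply]

lemma Horth (S : SData D G H L χ π) {x : V} (hx : x ∈ D) {i : ι} {X Y : V} (hX : π i X = 0)
    (hY : π i Y = Y) : H x X Y = 0 := by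
  obtain ⟨u, hu, -⟩ := prj_poly (S.hc x hx) (S.h0 x hx)
  have h1 := hu i
  rw [S.hπ x hx] at h1
  rw [← hY, h1, ← aeval_selfadj (S.hHL x hx), ← h1, hX, map_zero, ContinuousLinearMap.zero_apply]

lemma Gcof (S : SData D G H L χ π) {x : V} (hx : x ∈ D) {i : ι} (Y : V) {Z : V}
    (hZ : π i Z = Z) : G x Y Z = H x Y (aeval (L x) (cof (fun i => χ i x) i) Z) := by
  rw [S.hGH x hx, ← S.pcof hx, hZ]

lemma DGorth (S : SData D G H L χ π) {x : V} (hx : x ∈ D) {i : ι} {X Y : V} (hX : π i X = 0)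
    (hY : π i Y = Y) (Z : V) : fderiv ℝ G x Z X Y = 0 := by
  have h := line_deriv (((S.hG x hx).clm_apply (differentiableAt_const X)).clm_apply
    (differentiableAt_const Y)) Z
  rw [fderiv_clm_apply' ((S.hG x hx).clm_apply (differentiableAt_const X)),
    fderiv_clm_apply' (S.hG x hx)] at h
  refine h.unique ((hasDerivAt_const (0:ℝ) (0:ℝ)).congr_of_eventuallyEq ?_)
  filter_upwards [line_mem S.hD hx Z] with s hs
  exact S.Gorth hs hX hY

/-- The polynomial with differentiated coefficients. -/
noncomputable def dpol (q : V → ℝ[X]) (d : ℕ) (x X : V) : ℝ[X] :=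
  ∑ n ∈ Finset.range (d + 1), Polynomial.C (fderiv ℝ (fun y => (q y).coeff n) x X) * Polynomial.X ^ n

lemma cof_smP (S : SData D G H L χ π) (i : ι) : SmP D (fun y => cof (fun i => χ i y) i) :=
  SmP.prod _ S.hχ

lemma poly_identity (S : SData D G H L χ π)
    (hχc : ∀ i, ∀ x ∈ D, ∀ y ∈ D, π i x = π i y → χ i x = χ i y)
    (hdet : ∀ x ∈ D, ∀ t : ℝ, cdet (t • 1 - L x) = (∏ i, χ i x).eval t)
    {x : V} (hx : x ∈ D) (i : ι) (d : ℕ) (hd : ∀ y, (cof (fun i => χ i y) i).natDegree ≤ d)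
    {X : V} (hX : π i X = 0) :
    dpol (fun y => cof (fun i => χ i y) i) d x (L x X)
      - Polynomial.X * dpol (fun y => cof (fun i => χ i y) i) d x X
      = Polynomial.C (ctr (fderiv ℝ L x X)) * cof (fun i => χ i x) i := by
  obtain ⟨-, -, hsm⟩ := S.cof_smP i
  obtain ⟨e, he, hsm'⟩ := S.hχ i
  have hx' := S.hD.mem_nhds hx
  have hda : ∀ n, DifferentiableAt ℝ (fun y => (cof (fun i => χ i y) i).coeff n) x := fun n =>
    ((hsm n).contDiffAt hx').differentiableAt (by simp)
  have hdb : ∀ n, DifferentiableAt ℝ (fun y => (χ i y).coeff n) x := fun n =>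
    ((hsm' n).contDiffAt hx').differentiableAt (by simp)
  have hFe : ∀ t : ℝ, (fun y => (cof (fun i => χ i y) i).eval t) =
      fun y => ∑ n ∈ Finset.range (d + 1), (cof (fun i => χ i y) i).coeff n * t ^ n := by
    intro t; ext1 y
    exact eval_eq_sum_range' (Nat.lt_succ_of_le (hd y)) t
  have hFd : ∀ (t : ℝ) (Y : V), fderiv ℝ (fun y => (cof (fun i => χ i y) i).eval t) x Y
      = (dpol (fun y => cof (fun i => χ i y) i) d x Y).eval t := by
    intro t Y
    rw [hFe, (HasFDerivAt.fun_sum fun n _ => ((hda n).hasFDerivAt.mul_const (t ^ n))).fderiv]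
    simp only [dpol, eval_finsetSum, eval_mul, eval_C, eval_pow, eval_X]
    rw [ContinuousLinearMap.sum_apply]
    refine Finset.sum_congr rfl fun n _ => ?_
    rw [ContinuousLinearMap.smul_apply, smul_eq_mul, mul_comm]
  have hFdd : ∀ t : ℝ, DifferentiableAt ℝ (fun y => (cof (fun i => χ i y) i).eval t) x := by
    intro t
    rw [hFe]
    exact DifferentiableAt.fun_sum fun n _ => (hda n).mul_const _
  have hcdd : ∀ t : ℝ, DifferentiableAt ℝ (fun y => (χ i y).eval t) x := by
    intro t
    have : (fun y => (χ i y).eval t) =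
      fun y => ∑ n ∈ Finset.range (e + 1), (χ i y).coeff n * t ^ n := by
      ext1 y
      exact eval_eq_sum_range' (Nat.lt_succ_of_le (he y)) t
    rw [this]
    exact DifferentiableAt.fun_sum fun n _ => (hdb n).mul_const _
  have hc0 : ∀ (t : ℝ) (Y : V), π i Y = 0 → fderiv ℝ (fun y => (χ i y).eval t) x Y = 0 := by
    intro t Y hY
    exact fderiv_zero_of_const S.hD hx (hcdd t) (fun y hy h => by
      rw [hχc i y hy x hx h]) hY
  have hne : (∏ i, χ i x) ≠ 0 := (monic_prod_of_monic _ _ fun i _ => S.hmon x hx i).ne_zero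
  refine Polynomial.eq_of_infinite_eval_eq _ _ (Set.Infinite.mono (s := {t | (∏ i, χ i x).IsRoot t}ᶜ)
    ?_ (Set.Finite.infinite_compl (Polynomial.finite_setOf_isRoot hne)))
  intro t ht
  have ht' : (∏ i, χ i x).eval t ≠ 0 := ht
  have hci : (χ i x).eval t ≠ 0 := by
    intro h; apply ht'
    rw [← cof_mul _ i, eval_mul, h, zero_mul]
  have key := char_nij (S.hL x hx) (S.nij hx) t (by rw [hdet x hx]; exact ht') X
  have hev : (fun y => cdet (t • 1 - L y)) =ᶠ[𝓝 x]
      fun y => (χ i y).eval t * (cof (fun i => χ i y) i).eval t := by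
    filter_upwards [hx'] with y hy
    rw [hdet y hy, ← cof_mul _ i, eval_mul]
  have hev0 : cdet (t • 1 - L x) = _ := hev.eq_of_nhds
  rw [hev.fderiv_eq, hev0, ((hcdd t).hasFDerivAt.fun_mul (hFdd t).hasFDerivAt).fderiv] at key
  simp only [ContinuousLinearMap.add_apply, ContinuousLinearMap.smul_apply, smul_eq_mul, hFd] at key
  rw [hc0 t X hX, hc0 t (L x X) (by rw [S.pcommL hx, hX, map_zero])] at key
  simp only [Set.mem_setOf_eq, eval_sub, eval_mul, eval_X, eval_C]
  apply mul_left_cancel₀ hci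
  linarith
end SData
end SplitB
end PartP9

section PartP10
open Filter Topology

section SplitC
variable {V : Type} [NormedAddCommGroup V] [NormedSpace ℝ V] [FiniteDimensional ℝ V]
  {ι : Type} [Fintype ι] [DecidableEq ι]

namespace SData
variable {D : Set V} {G H : V → V →L[ℝ] V →L[ℝ] ℝ} {L : V → V →L[ℝ] V}
    {χ : ι → V → ℝ[X]} {π : ι → V →L[ℝ] V}

lemma DG_formula (S : SData D G H L χ π)
    {x : V} (hx : x ∈ D) (i : ι) (d : ℕ) (hd : ∀ y, (cof (fun i => χ i y) i).natDegree ≤ d)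
    {X : V} (hX : π i X = 0) (Y : V) {Z : V} (hZ : π i Z = Z) :
    fderiv ℝ G x X Y Z = H x Y (aeval (L x) (dpol (fun y => cof (fun i => χ i y) i) d x X) Z)
      + fderiv ℝ H x X Y (aeval (L x) (cof (fun i => χ i x) i) Z) := by
  obtain ⟨-, -, hsm⟩ := S.cof_smP i
  have hx' := S.hD.mem_nhds hx
  have hda : ∀ n, DifferentiableAt ℝ (fun y => (cof (fun i => χ i y) i).coeff n) x := fun n =>
    ((hsm n).contDiffAt hx').differentiableAt (by simp)
  have hG1 := (S.hG x hx).clm_apply (differentiableAt_const Y)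
  have h := line_deriv (hG1.clm_apply (differentiableAt_const Z)) X
  rw [fderiv_clm_apply' hG1, fderiv_clm_apply' (S.hG x hx)] at h
  have hH1 := (S.hH x hx).clm_apply (differentiableAt_const Y)
  have hk : ∀ n : ℕ, HasDerivAt (fun s : ℝ => (cof (fun i => χ i (x + s • X)) i).coeff n *
      H (x + s • X) Y ((L x ^ n) Z))
      (fderiv ℝ (fun y => (cof (fun i => χ i y) i).coeff n) x X * H x Y ((L x ^ n) Z)
        + (cof (fun i => χ i x) i).coeff n * fderiv ℝ H x X Y ((L x ^ n) Z)) 0 := by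
    intro n
    have h1 := line_deriv (hda n) X
    have h2 := line_deriv (hH1.clm_apply (differentiableAt_const ((L x ^ n) Z))) X
    rw [fderiv_clm_apply' hH1, fderiv_clm_apply' (S.hH x hx)] at h2
    have h3 := h1.fun_mul h2
    simpa using h3
  have hsum := HasDerivAt.fun_sum fun n (_ : n ∈ Finset.range (d + 1)) => hk n
  have e1 : ∀ q : ℝ[X], q.natDegree ≤ d → ∀ T : V →L[ℝ] ℝ,
      T (aeval (L x) q Z) = ∑ n ∈ Finset.range (d + 1), q.coeff n * T ((L x ^ n) Z) := by
    intro q hq T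
    rw [aeval_eq_sum_range' (Nat.lt_succ_of_le hq), ContinuousLinearMap.sum_apply, map_sum]
    simp
  have e2 : ∀ T : V →L[ℝ] ℝ, T (aeval (L x) (dpol (fun y => cof (fun i => χ i y) i) d x X) Z)
      = ∑ n ∈ Finset.range (d + 1), fderiv ℝ (fun y => (cof (fun i => χ i y) i).coeff n) x X
        * T ((L x ^ n) Z) := by
    intro T
    unfold dpol
    rw [map_sum, ContinuousLinearMap.sum_apply, map_sum]
    refine Finset.sum_congr rfl fun n _ => ?_
    simp [Algebra.algebraMap_eq_smul_one]
  rw [e2, e1 _ (hd x), ← Finset.sum_add_distrib]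
  refine h.unique (hsum.congr_of_eventuallyEq ?_)
  filter_upwards [line_mem S.hD hx X] with s hs
  rw [S.Gcof hs Y hZ, S.Lq_const hx hs (by simp [hX]) _ hZ, e1 _ (hd _)]

lemma DG_step (S : SData D G H L χ π)
    {x : V} (hx : x ∈ D) (i : ι) {X : V} (hX : π i X = 0) {Y : V} (hY : π i Y = Y)
    {Z : V} (hZ : π i Z = Z) :
    fderiv ℝ G x (L x X) Y Z - fderiv ℝ G x X (L x Y) Z = ctr (fderiv ℝ L x X) * G x Y Z := by
  have h := S.hE x hx X Y Z
  unfold EF Edef at h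
  rw [S.Gorth hx hX (by rw [S.dcomm hx, hY] : π i (fderiv ℝ L x Z Y) = _),
    S.dL_zero' hx i hZ hX, S.DGorth hx hX hZ, S.Gorth hx hX hZ,
    S.DGorth hx (by rw [S.pcommL hx, hX, map_zero] : π i (L x X) = 0) hZ, map_zero] at h
  linarith

/-- The blocks of `H` have vanishing derivative in foreign directions. -/
lemma dH_zero (S : SData D G H L χ π)
    (hχc : ∀ i, ∀ x ∈ D, ∀ y ∈ D, π i x = π i y → χ i x = χ i y)
    (hdet : ∀ x ∈ D, ∀ t : ℝ, cdet (t • 1 - L x) = (∏ i, χ i x).eval t)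
    {x : V} (hx : x ∈ D) (i : ι) {X : V} (hX : π i X = 0) {Y : V} (hY : π i Y = Y)
    {W : V} (hW : π i W = W) : fderiv ℝ H x X Y W = 0 := by
  obtain ⟨d, hd, -⟩ := S.cof_smP i
  have step : ∀ X, π i X = 0 → ∀ Y, π i Y = Y → ∀ W, π i W = W →
      fderiv ℝ H x (L x X) Y W = fderiv ℝ H x X (L x Y) W := by
    intro X hX Y hY W hW
    obtain ⟨Z, rfl, hZ⟩ := S.im_surj hx hW
    have h1 := S.DG_step hx i hX hY hZ
    have hLX : π i (L x X) = 0 := by rw [S.pcommL hx, hX, map_zero]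
    rw [S.DG_formula hx i d hd hLX Y hZ, S.DG_formula hx i d hd hX (L x Y) hZ, S.hHL x hx,
      S.Gcof hx Y hZ] at h1
    have h2 := congrArg (fun q => H x Y (aeval (L x) q Z)) (S.poly_identity hχc hdet hx i d hd hX)
    simp only [map_sub, ContinuousLinearMap.sub_apply, aeval_mul_apply, aeval_X_apply] at h2
    simp only [aeval_C, Algebra.algebraMap_eq_smul_one, ContinuousLinearMap.smul_apply,
      ContinuousLinearMap.one_apply, map_smul, smul_eq_mul] at h2
    linarith
  have poly : ∀ q : ℝ[X], ∀ X, π i X = 0 → ∀ Y, π i Y = Y → ∀ W, π i W = W →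
      fderiv ℝ H x (aeval (L x) q X) Y W = fderiv ℝ H x X (aeval (L x) q Y) W := by
    intro q
    induction q using Polynomial.induction_on' with
    | add p q hp hq =>
      intro X hX Y hY W hW
      simp only [map_add, ContinuousLinearMap.add_apply]
      rw [hp X hX Y hY W hW, hq X hX Y hY W hW]
    | monomial n a =>
      intro X hX Y hY W hW
      simp only [aeval_monomial, ContinuousLinearMap.mul_apply,
        Algebra.algebraMap_eq_smul_one, smul_mul_assoc, one_mul, ContinuousLinearMap.smul_apply,
        map_smul]
      congr 1
      induction n generalizing X Y with
      | zero => simp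
      | succ n ih =>
        have hp : ∀ X, π i ((L x ^ n) X) = (L x ^ n) (π i X) := by
          intro X
          have := S.pcomm hx i (Polynomial.X ^ n) X
          simpa using this
        rw [pow_succ', ContinuousLinearMap.mul_apply, step _ (by rw [hp, hX, map_zero]) Y hY W hW,
          ih X hX _ (by rw [S.pcommL hx, hY]), ← pow_succ', pow_succ]
        rfl
  obtain ⟨Y', rfl, hY'⟩ := S.im_surj hx hY
  rw [← poly _ X hX Y' hY' W hW, S.cof_ker hx hX, map_zero]
  rfl

lemma H_const (S : SData D G H L χ π)
    (hχc : ∀ i, ∀ x ∈ D, ∀ y ∈ D, π i x = π i y → χ i x = χ i y)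
    (hdet : ∀ x ∈ D, ∀ t : ℝ, cdet (t • 1 - L x) = (∏ i, χ i x).eval t)
    {x y : V} (hx : x ∈ D) (hy : y ∈ D) {i : ι} (h : π i x = π i y) {Y : V} (hY : π i Y = Y)
    {W : V} (hW : π i W = W) : H x Y W = H y Y W := by
  have hd : ∀ z ∈ D, DifferentiableAt ℝ (fun x => H x Y) z := fun z hz =>
    (S.hH z hz).clm_apply (differentiableAt_const Y)
  refine const_of_fderiv_zero (f := fun x => H x Y W) S.hD S.hconv
    (fun z hz => (hd z hz).clm_apply (differentiableAt_const W)) (π := π i) ?_ hx hy h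
  intro z hz X hX
  rw [fderiv_clm_apply' (hd z hz), fderiv_clm_apply' (S.hH z hz), S.dH_zero hχc hdet hz i hX hY hW]

/-- Block compatibility. -/
lemma EF_block (S : SData D G H L χ π)
    (hχc : ∀ i, ∀ x ∈ D, ∀ y ∈ D, π i x = π i y → χ i x = χ i y)
    {x : V} (hx : x ∈ D) (i : ι) {X Y W : V} (hX : π i X = X) (hY : π i Y = Y)
    (hW : π i W = W) : EF H L x X Y W = 0 := by
  obtain ⟨Z, rfl, hZ⟩ := S.im_surj hx hW
  rw [← EF_poly (S.hH x hx) (S.hL x hx) (S.hHs x hx) (S.hHL x hx) (S.nij hx),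
    ← S.hE x hx X Y Z]
  set f := cof (fun i => χ i x) i with hf
  have hGd : ∀ X Y Z, π i X = X → π i Z = Z →
      fderiv ℝ (fun y => twist (H y) (aeval (L y) f)) x X Y Z = fderiv ℝ G x X Y Z := by
    intro X Y Z hX hZ
    have ht := twist_diff (S.hH x hx) (aeval_diff (S.hL x hx) f)
    have ht1 := ht.clm_apply (differentiableAt_const Y)
    have hG1 := (S.hG x hx).clm_apply (differentiableAt_const Y)
    rw [← fderiv_clm_apply' ht, ← fderiv_clm_apply' ht1, ← fderiv_clm_apply' (S.hG x hx),
      ← fderiv_clm_apply' hG1]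
    refine (line_deriv (ht1.clm_apply (differentiableAt_const Z)) X).unique
      ((line_deriv (hG1.clm_apply (differentiableAt_const Z)) X).congr_of_eventuallyEq ?_)
    filter_upwards [line_mem S.hD hx X] with s hs
    rw [twist_apply, S.Gcof hs Y hZ, hf]
    congr 3
    refine Finset.prod_congr rfl fun j hj => ?_
    refine hχc j x hx _ hs ?_
    rw [map_add, map_smul, ← hX, S.porth hx (Finset.ne_of_mem_erase hj), smul_zero, add_zero]
  have hG0 : ∀ Y Z, π i Z = Z → twist (H x) (aeval (L x) f) Y Z = G x Y Z := by
    intro Y Z hZ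
    rw [twist_apply, S.Gcof hx Y hZ]
  have hLi : ∀ X, π i X = X → π i (L x X) = L x X := fun X hX => by rw [S.pcommL hx, hX]
  have hDi : ∀ Z X, π i X = X → π i (fderiv ℝ L x Z X) = fderiv ℝ L x Z X :=
    fun Z X hX => by rw [S.dcomm hx, hX]
  unfold EF Edef
  rw [hG0 _ _ (hDi _ _ hY), hG0 _ _ (hDi _ _ hX), hG0 _ _ hZ, hG0 _ _ hZ, hGd _ _ _ hX hZ,
    hGd _ _ _ hY hZ, hGd _ _ _ (hLi _ hX) hZ, hGd _ _ _ (hLi _ hY) hZ]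

end SData

/-- Restriction of a pair to an affine subspace. -/
lemma EF_restrict {V' : Type} [NormedAddCommGroup V'] [NormedSpace ℝ V'] [FiniteDimensional ℝ V']
    {H : V → V →L[ℝ] V →L[ℝ] ℝ} {L : V → V →L[ℝ] V} (x0 : V) (j : V' →L[ℝ] V) (q : V →L[ℝ] V')
    {h : V' → V' →L[ℝ] V' →L[ℝ] ℝ} {l : V' → V' →L[ℝ] V'} {u : V'}
    (hh : ∀ u X Y, h u X Y = H (x0 + j u) (j X) (j Y))
    (hl : ∀ u X, l u X = q (L (x0 + j u) (j X)))
    (hhd : DifferentiableAt ℝ h u) (hld : DifferentiableAt ℝ l u)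
    (hH : DifferentiableAt ℝ H (x0 + j u)) (hL : DifferentiableAt ℝ L (x0 + j u))
    (hjq : ∀ X, j (q (L (x0 + j u) (j X))) = L (x0 + j u) (j X))
    (hjd : ∀ Z X, j (q (fderiv ℝ L (x0 + j u) (j Z) (j X))) = fderiv ℝ L (x0 + j u) (j Z) (j X))
    (hd0 : ∀ Z X, fderiv ℝ L (x0 + j u) (j Z) (j (q X)) = fderiv ℝ L (x0 + j u) (j Z) X)
    (X Y Z : V') : EF h l u X Y Z = EF H L (x0 + j u) (j X) (j Y) (j Z) := by
  have hj : HasFDerivAt (fun u => x0 + j u) j u := j.hasFDerivAt.const_add x0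
  have hHj : HasFDerivAt (fun u => H (x0 + j u)) ((fderiv ℝ H (x0 + j u)).comp j) u :=
    HasFDerivAt.comp (g := H) u hH.hasFDerivAt hj
  have hLj : HasFDerivAt (fun u => L (x0 + j u)) ((fderiv ℝ L (x0 + j u)).comp j) u :=
    HasFDerivAt.comp (g := L) u hL.hasFDerivAt hj
  have hDh : ∀ Z X Y, fderiv ℝ h u Z X Y = fderiv ℝ H (x0 + j u) (j Z) (j X) (j Y) := by
    intro Z X Y
    rw [← fderiv_clm_apply' hhd, ← fderiv_clm_apply' (hhd.clm_apply (differentiableAt_const X))]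
    simp only [hh]
    rw [((hHj.clm_apply (hasFDerivAt_const (j X) u)).clm_apply (hasFDerivAt_const (j Y) u)).fderiv]
    simp
  have hDl : ∀ Z X, fderiv ℝ l u Z X = q (fderiv ℝ L (x0 + j u) (j Z) (j X)) := by
    intro Z X
    rw [← fderiv_clm_apply' hld]
    simp only [hl]
    have := (q.hasFDerivAt.comp u (hLj.clm_apply (hasFDerivAt_const (j X) u))).fderiv
    have e : (fun y => q (L (x0 + j y) (j X))) = q ∘ fun y => L (x0 + j y) (j X) := rfl
    rw [e, this]
    simp
  have htr : ∀ Z, ctr (fderiv ℝ l u Z) = ctr (fderiv ℝ L (x0 + j u) (j Z)) := by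
    intro Z
    unfold ctr
    have e : ((fderiv ℝ l u Z : V' →L[ℝ] V') : V' →ₗ[ℝ] V') = (q : V →ₗ[ℝ] V') ∘ₗ
        (((fderiv ℝ L (x0 + j u) (j Z) : V →L[ℝ] V) : V →ₗ[ℝ] V) ∘ₗ (j : V' →ₗ[ℝ] V)) := by
      ext X; exact hDl Z X
    rw [e, LinearMap.trace_comp_comm']
    congr 1
    ext X
    exact hd0 Z X
  unfold EF Edef
  simp only [hDh, hDl, htr, hh, hl, hjq, hjd]
end SplitC
end PartP10

section PartP11
open Filter Topology

section Straight
variable {V : Type} [NormedAddCommGroup V] [NormedSpace ℝ V] [FiniteDimensional ℝ V]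
  {ι : Type} [Fintype ι] [DecidableEq ι]

lemma prj_smooth {U : Set V} {L : V → V →L[ℝ] V} (hL : ContDiffOn ℝ (⊤ : ℕ∞) L U)
    {χ : ι → V → ℝ[X]} (hχ : ∀ i, SmP U (χ i))
    (hc : ∀ x ∈ U, ∀ i j, i ≠ j → IsCoprime (χ i x) (χ j x))
    (h0 : ∀ x ∈ U, aeval (L x) (∏ i, χ i x) = 0) (i : ι) :
    ContDiffOn ℝ (⊤ : ℕ∞) (fun x => prj (L x) (fun i => χ i x) i) U := by
  have : CompleteSpace V := FiniteDimensional.complete ℝ V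
  unfold prj
  have h1 : ContDiffOn ℝ (⊤ : ℕ∞) (fun x => aeval (L x) (cof (fun i => χ i x) i)) U :=
    SmP.aeval (SmP.prod _ hχ) hL
  have h2 : ContDiffOn ℝ (⊤ : ℕ∞) (fun x => aeval (L x) (∑ i, cof (fun i => χ i x) i)) U :=
    SmP.aeval (SmP.sum _ fun i => SmP.prod _ hχ) hL
  refine h1.mul ?_
  intro x hx
  obtain ⟨u, -, hu, -⟩ := sumcof_unit (hc x hx) (h0 x hx)
  obtain ⟨w, hw⟩ := hu
  have h3 : ContDiffAt ℝ (⊤ : ℕ∞) Ring.inverse (aeval (L x) (∑ i, cof (fun i => χ i x) i)) := by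
    rw [← hw]; exact contDiffAt_ringInverse ℝ w
  exact ContDiffAt.comp_contDiffWithinAt (g := Ring.inverse)
    (f := fun x => aeval (L x) (∑ i, cof (fun i => χ i x) i)) x h3 (h2 x hx)

lemma prj_frob {U : Set V} (hU : IsOpen U) {L : V → V →L[ℝ] V} (hL : ContDiffOn ℝ (⊤ : ℕ∞) L U)
    {χ : ι → V → ℝ[X]} (hχ : ∀ i, SmP U (χ i))
    (hc : ∀ x ∈ U, ∀ i j, i ≠ j → IsCoprime (χ i x) (χ j x))
    (h0 : ∀ x ∈ U, aeval (L x) (∏ i, χ i x) = 0)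
    (hN : ∀ x ∈ U, Nij (L x) (fderiv ℝ L x)) (i : ι) (x : V) (hx : x ∈ U) (X Y : V)
    (hX : prj (L x) (fun i => χ i x) i X = 0) (hY : prj (L x) (fun i => χ i x) i Y = 0) :
    fderiv ℝ (fun x => prj (L x) (fun i => χ i x) i) x X Y
      = fderiv ℝ (fun x => prj (L x) (fun i => χ i x) i) x Y X := by
  set P : V → V →L[ℝ] V := fun x => prj (L x) (fun i => χ i x) i with hPdef
  have hPd : DifferentiableAt ℝ P x :=
    ((prj_smooth hL hχ hc h0 i).contDiffAt (hU.mem_nhds hx)).differentiableAt (by simp)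
  have hLd : DifferentiableAt ℝ L x := (hL.contDiffAt (hU.mem_nhds hx)).differentiableAt (by simp)
  have hPP : ∀ x ∈ U, P x * P x = P x := fun x hx => prj_idem (hc x hx) (h0 x hx) i
  have hPL : ∀ x ∈ U, P x * L x = L x * P x := fun x hx => by
    have := prj_comm (hc x hx) (h0 x hx) i Polynomial.X
    rwa [aeval_X] at this
  refine frob_condition (L := L x) (P := P x) (DL := fderiv ℝ L x)
    (fun X => congrArg (fun T => T X) (hPL x hx)) ?_ ?_
    (fun X => congrArg (fun T => T X) (hPP x hx)) (hN x hx) (χ i x) ?_ ?_ X Y hX hY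
  · intro X Y
    have h1 : (fun y => P y (P y Y)) =ᶠ[𝓝 x] fun y => P y Y := by
      filter_upwards [hU.mem_nhds hx] with y hy
      exact congrArg (fun T => T Y) (hPP y hy)
    have h2 := congrArg (fun T => T X) (h1.fderiv_eq (𝕜 := ℝ))
    rw [(hPd.hasFDerivAt.clm_apply (hPd.hasFDerivAt.clm_apply (hasFDerivAt_const Y x))).fderiv,
      fderiv_clm_apply' hPd] at h2
    simp at h2
    rw [add_comm]; exact h2
  · intro X Y
    have h1 : (fun y => P y (L y Y)) =ᶠ[𝓝 x] fun y => L y (P y Y) := by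
      filter_upwards [hU.mem_nhds hx] with y hy
      exact congrArg (fun T => T Y) (hPL y hy)
    have h2 := congrArg (fun T => T X) (h1.fderiv_eq (𝕜 := ℝ))
    rw [(hPd.hasFDerivAt.clm_apply (hLd.hasFDerivAt.clm_apply (hasFDerivAt_const Y x))).fderiv,
      (hLd.hasFDerivAt.clm_apply (hPd.hasFDerivAt.clm_apply (hasFDerivAt_const Y x))).fderiv] at h2
    simp at h2
    rw [add_comm, h2, add_comm]
  · intro X
    exact congrArg (fun T => T X) (prj_kill (hc x hx) (h0 x hx) i)
  · intro X hX
    obtain ⟨s, t, h⟩ := prj_inv (hc x hx) (h0 x hx) i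
    have hk : ∀ q : ℝ[X], P x (aeval (L x) q X) = 0 := fun q => by
      have := congrArg (fun T => T X) (prj_comm (hc x hx) (h0 x hx) i q)
      exact this.trans (by simp only [ContinuousLinearMap.mul_apply]; rw [hX, map_zero])
    refine ⟨aeval (L x) s X, ?_, hk s⟩
    have h1 := congrArg (fun T => T X) h
    have h2 := congrArg (fun T => T (aeval (L x) t X)) (prj_cof (hc x hx) (h0 x hx) i)
    have h3 : aeval (L x) (cof (fun i => χ i x) i) (aeval (L x) t X) = 0 := by
      rw [← h2]
      show aeval (L x) (∑ i, cof (fun i => χ i x) i) (P x (aeval (L x) t X)) = 0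
      rw [hk t, map_zero]
    simp only [ContinuousLinearMap.add_apply, ContinuousLinearMap.mul_apply,
      ContinuousLinearMap.one_apply] at h1
    rwa [h3, add_zero] at h1

lemma straighten {U : Set V} (hU : IsOpen U) {p : V} (hp : p ∈ U)
    {L : V → V →L[ℝ] V} (hL : ContDiffOn ℝ (⊤ : ℕ∞) L U)
    {χ : ι → V → ℝ[X]} (hχ : ∀ i, SmP U (χ i))
    (hc : ∀ x ∈ U, ∀ i j, i ≠ j → IsCoprime (χ i x) (χ j x))
    (h0 : ∀ x ∈ U, aeval (L x) (∏ i, χ i x) = 0)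
    (hN : ∀ x ∈ U, Nij (L x) (fderiv ℝ L x)) :
    ∃ e : OpenPartialHomeomorph V V, p ∈ e.source ∧ e.source ⊆ U ∧
      ContDiffOn ℝ (⊤ : ℕ∞) e.symm e.target ∧
      ∀ x ∈ e.source, ∃ J : V ≃L[ℝ] V, HasFDerivAt e (J : V →L[ℝ] V) x ∧
        ∀ i X, J (prj (L x) (fun i => χ i x) i X) = prj (L p) (fun i => χ i p) i (J X) := by
  have : CompleteSpace V := FiniteDimensional.complete ℝ V
  have hfi := fun i => frob_integrate hU hp (prj_smooth hL hχ hc h0 i)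
    (fun x hx X => congrArg (fun T => T X) (prj_idem (hc x hx) (h0 x hx) i))
    (prj_frob hU hL hχ hc h0 hN i)
  choose y U' hU' hpU' hUU' hy hker him hyp using hfi
  let s : Set V := U ∩ ⋂ i, U' i
  have hs : IsOpen s := hU.inter (isOpen_iInter_of_finite hU')
  have hps : p ∈ s := ⟨hp, Set.mem_iInter.mpr hpU'⟩
  have hsU : ∀ i, s ⊆ U' i := fun i x hx => Set.mem_iInter.mp hx.2 i
  let f : V → V := fun x => ∑ i, y i x
  have hf : ContDiffOn ℝ (⊤ : ℕ∞) f s := ContDiffOn.sum fun i _ => (hy i).mono (hsU i)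
  have hyd : ∀ x ∈ s, ∀ i, HasFDerivAt (y i) (fderiv ℝ (y i) x) x := fun x hx i =>
    (((hy i).contDiffAt ((hU' i).mem_nhds (hsU i hx))).differentiableAt (by simp)).hasFDerivAt
  have hf' : HasFDerivAt f ((ContinuousLinearEquiv.refl ℝ V : V ≃L[ℝ] V) : V →L[ℝ] V) p := by
    have h1 : HasFDerivAt f (∑ i, prj (L p) (fun i => χ i p) i) p :=
      HasFDerivAt.fun_sum fun i _ => hyp i
    rw [prj_sum (hc p hp) (h0 p hp)] at h1
    exact h1
  obtain ⟨e, he, hpe, hes, hJ, hsymm⟩ := inv_fun_smooth hs hps hf _ hf'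
  have hef : (e : V → V) = f := funext he
  refine ⟨e, hpe, fun x hx => (hes hx).1, hsymm, ?_⟩
  intro x hx
  obtain ⟨J, hJ⟩ := hJ x hx
  refine ⟨J, hef ▸ hJ, ?_⟩
  have hxs := hes hx
  have hxU : x ∈ U := hxs.1
  have hJs : ∀ X, J X = ∑ i, fderiv ℝ (y i) x X := by
    intro X
    have h1 : HasFDerivAt f (∑ i, fderiv ℝ (y i) x) x := HasFDerivAt.fun_sum fun i _ => hyd x hxs i
    have h2 := congrArg (fun T => T X) (hJ.unique h1)
    simpa using h2
  intro i X
  have e1 : J (prj (L x) (fun i => χ i x) i X) = fderiv ℝ (y i) x X := by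
    rw [hJs, Finset.sum_eq_single i]
    · have h1 := hker i x (hsU i hxs) (X - prj (L x) (fun i => χ i x) i X) (by
        have := congrArg (fun T => T X) (prj_idem (hc x hxU) (h0 x hxU) i)
        rw [map_sub, sub_eq_zero]
        exact this.symm)
      rw [map_sub, sub_eq_zero] at h1
      exact h1.symm
    · intro j _ hj
      apply hker j x (hsU j hxs)
      exact congrArg (fun T => T X) (prj_orth (hc x hxU) (h0 x hxU) hj)
    · simp
  have e2 : prj (L p) (fun i => χ i p) i (J X) = fderiv ℝ (y i) x X := by
    rw [hJs, map_sum, Finset.sum_eq_single i]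
    · exact him i x (hsU i hxs) X
    · intro j _ hj
      rw [← him j x (hsU j hxs) X]
      exact congrArg (fun T : V →L[ℝ] V => T (fderiv ℝ (y j) x X)) (prj_orth (hc p hp) (h0 p hp) hj.symm)
    · simp
  rw [e1, e2]
end Straight
end PartP11

section PartP12
open Filter Topology

section Bridge
variable {ι : Type} [Fintype ι] [DecidableEq ι]

/-- A matrix as a continuous endomorphism. -/
noncomputable def mL : Matrix ι ι ℝ →ₐ[ℝ] ((ι → ℝ) →L[ℝ] (ι → ℝ)) :=
  ((Module.End.toContinuousLinearMap (𝕜 := ℝ) (ι → ℝ)).toAlgHom).comp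
    (Matrix.toLinAlgEquiv' (R := ℝ) (n := ι)).toAlgHom

lemma mL_apply (A : Matrix ι ι ℝ) (X : ι → ℝ) : mL A X = A *ᵥ X := rfl

lemma mL_single (A : Matrix ι ι ℝ) (i j : ι) : mL A (Pi.single j 1) i = A i j := by
  rw [mL_apply]; simp

/-- A matrix as a continuous bilinear form. -/
noncomputable def mG (A : Matrix ι ι ℝ) : (ι → ℝ) →L[ℝ] (ι → ℝ) →L[ℝ] ℝ :=
  ∑ i, ∑ j, A i j • (ContinuousLinearMap.proj (R := ℝ) (φ := fun _ : ι => ℝ) i).smulRight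
    (ContinuousLinearMap.proj (R := ℝ) (φ := fun _ : ι => ℝ) j)

lemma mG_apply (A : Matrix ι ι ℝ) (X Y : ι → ℝ) : mG A X Y = X ⬝ᵥ A *ᵥ Y := by
  simp [mG, dotProduct, mulVec, Finset.mul_sum]
  refine Finset.sum_congr rfl fun i _ => Finset.sum_congr rfl fun j _ => by ring

lemma mG_single (A : Matrix ι ι ℝ) (i j : ι) : mG A (Pi.single i 1) (Pi.single j 1) = A i j := by
  rw [mG_apply]; simp

lemma mL_eq (A : Matrix ι ι ℝ) : mL A = ∑ i, ∑ j, A i j •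
    (ContinuousLinearMap.proj (R := ℝ) (φ := fun _ : ι => ℝ) j).smulRight
      (Pi.single i (1 : ℝ) : ι → ℝ) := by
  ext X a
  simp [mL_apply, mulVec, dotProduct, Finset.sum_apply, Pi.single_apply]

variable {E : Type} [NormedAddCommGroup E] [NormedSpace ℝ E]

lemma ssum_contDiffOn {F : Type} [NormedAddCommGroup F] [NormedSpace ℝ F] {U : Set E}
    {n : WithTop ℕ∞} {a : E → ι → ι → ℝ} (c : ι → ι → F)
    (h : ∀ i j, ContDiffOn ℝ n (fun y => a y i j) U) :
    ContDiffOn ℝ n (fun y => ∑ i, ∑ j, a y i j • c i j) U :=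
  ContDiffOn.sum fun i _ => ContDiffOn.sum fun j _ => (h i j).smul contDiffOn_const

lemma ssum_fderiv {F : Type} [NormedAddCommGroup F] [NormedSpace ℝ F] {x : E}
    {a : E → ι → ι → ℝ} (c : ι → ι → F) (h : ∀ i j, DifferentiableAt ℝ (fun y => a y i j) x)
    (Z : E) : DifferentiableAt ℝ (fun y => ∑ i, ∑ j, a y i j • c i j) x ∧
    fderiv ℝ (fun y => ∑ i, ∑ j, a y i j • c i j) x Z =
      ∑ i, ∑ j, fderiv ℝ (fun y => a y i j) x Z • c i j := by
  have : HasFDerivAt (fun y => ∑ i, ∑ j, a y i j • c i j)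
      (∑ i, ∑ j, (fderiv ℝ (fun y => a y i j) x).smulRight (c i j)) x :=
    HasFDerivAt.fun_sum fun i _ => HasFDerivAt.fun_sum fun j _ =>
      (h i j).hasFDerivAt.smul_const _
  refine ⟨this.differentiableAt, ?_⟩
  rw [this.fderiv]
  simp [ContinuousLinearMap.sum_apply]

lemma mL_contDiffOn {U : Set E} {n : WithTop ℕ∞} {L : E → Matrix ι ι ℝ}
    (h : ∀ i j, ContDiffOn ℝ n (fun y => L y i j) U) : ContDiffOn ℝ n (fun y => mL (L y)) U := by
  simp_rw [mL_eq]
  exact ssum_contDiffOn (F := (ι → ℝ) →L[ℝ] (ι → ℝ)) (a := fun y i j => L y i j) _ h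

lemma mG_contDiffOn {U : Set E} {n : WithTop ℕ∞} {L : E → Matrix ι ι ℝ}
    (h : ∀ i j, ContDiffOn ℝ n (fun y => L y i j) U) : ContDiffOn ℝ n (fun y => mG (L y)) U :=
  ssum_contDiffOn (F := (ι → ℝ) →L[ℝ] (ι → ℝ) →L[ℝ] ℝ) (a := fun y i j => L y i j) _ h

lemma mL_differentiableAt {x : E} {L : E → Matrix ι ι ℝ}
    (h : ∀ i j, DifferentiableAt ℝ (fun y => L y i j) x) :
    DifferentiableAt ℝ (fun y => mL (L y)) x := by
  simp_rw [mL_eq]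
  exact (ssum_fderiv (F := (ι → ℝ) →L[ℝ] (ι → ℝ)) (a := fun y i j => L y i j) _ h 0).1

lemma mG_differentiableAt {x : E} {L : E → Matrix ι ι ℝ}
    (h : ∀ i j, DifferentiableAt ℝ (fun y => L y i j) x) :
    DifferentiableAt ℝ (fun y => mG (L y)) x :=
  (ssum_fderiv (F := (ι → ℝ) →L[ℝ] (ι → ℝ) →L[ℝ] ℝ) (a := fun y i j => L y i j) _ h 0).1

lemma mL_fderiv {x : ι → ℝ} {L : (ι → ℝ) → Matrix ι ι ℝ}
    (h : ∀ i j, DifferentiableAt ℝ (fun y => L y i j) x) (k : ι) :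
    fderiv ℝ (fun y => mL (L y)) x (Pi.single k 1) =
      mL (Matrix.of fun i j => pd k (fun y => L y i j) x) := by
  rw [mL_eq (Matrix.of fun i j => pd k (fun y => L y i j) x)]
  simp_rw [mL_eq (L _)]
  exact (ssum_fderiv (F := (ι → ℝ) →L[ℝ] (ι → ℝ)) (a := fun y i j => L y i j) _ h _).2

lemma mG_fderiv {x : ι → ℝ} {L : (ι → ℝ) → Matrix ι ι ℝ}
    (h : ∀ i j, DifferentiableAt ℝ (fun y => L y i j) x) (k : ι) :
    fderiv ℝ (fun y => mG (L y)) x (Pi.single k 1) =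
      mG (Matrix.of fun i j => pd k (fun y => L y i j) x) :=
  (ssum_fderiv (F := (ι → ℝ) →L[ℝ] (ι → ℝ) →L[ℝ] ℝ) (a := fun y i j => L y i j) _ h _).2

lemma ctr_mL (A : Matrix ι ι ℝ) : ctr (mL A) = A.trace := by
  unfold ctr
  rw [show ((mL A : (ι → ℝ) →L[ℝ] (ι → ℝ)) : (ι → ℝ) →ₗ[ℝ] (ι → ℝ)) = Matrix.toLin' A from rfl]
  exact Matrix.trace_toLin'_eq A

lemma cdet_mL (A : Matrix ι ι ℝ) : cdet (mL A) = A.det := by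
  unfold cdet
  rw [show ((mL A : (ι → ℝ) →L[ℝ] (ι → ℝ)) : (ι → ℝ) →ₗ[ℝ] (ι → ℝ)) = Matrix.toLin' A from rfl]
  exact LinearMap.det_toLin' A

lemma chr_contract (g : (ι → ℝ) → Matrix ι ι ℝ) (x : ι → ℝ) (M : Matrix ι ι ℝ)
    (hu : IsUnit (g x).det) (hs : (g x).IsSymm) (k i j : ι) :
    ∑ l, christoffel g x l k i * (g x * M) l j = (1/2) * ∑ s, M s j *
      (pd k (fun y => g y s i) x + pd i (fun y => g y s k) x - pd s (fun y => g y k i) x) := by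
  have h1 : ∀ s, ∑ l, (g x)⁻¹ l s * (g x * M) l j = M s j := by
    intro s
    have hsi : (g x)⁻¹ᵀ = (g x)⁻¹ := by rw [Matrix.transpose_nonsing_inv, hs.eq]
    have h2 : ((g x)⁻¹ * (g x * M)) s j = M s j := by
      rw [← Matrix.mul_assoc, Matrix.nonsing_inv_mul _ hu, Matrix.one_mul]
    rw [← h2, Matrix.mul_apply]
    refine Finset.sum_congr rfl fun l _ => ?_
    congr 1
    conv_lhs => rw [← hsi]
    rfl
  simp only [christoffel, mul_assoc, Finset.sum_mul, Finset.mul_sum]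
  rw [Finset.sum_comm]
  refine Finset.sum_congr rfl fun s _ => ?_
  rw [← h1 s, Finset.sum_mul, Finset.mul_sum]
  refine Finset.sum_congr rfl fun l _ => ?_
  ring

/-- The coordinate form of the compatibility defect. -/
lemma EF_basis {g L : (ι → ℝ) → Matrix ι ι ℝ} {x : ι → ℝ}
    (hg : ∀ i j, DifferentiableAt ℝ (fun y => g y i j) x)
    (hL : ∀ i j, DifferentiableAt ℝ (fun y => L y i j) x)
    (hs : ∀ᶠ y in 𝓝 x, (g y).IsSymm) (hLs : ∀ᶠ y in 𝓝 x, (g y * L y).IsSymm)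
    (hu : IsUnit (g x).det) (i j k : ι) :
    EF (fun y => mG (g y)) (fun y => mL (L y)) x (Pi.single i 1) (Pi.single j 1) (Pi.single k 1) =
    2 * (pd k (fun y => (g y * L y) i j) x
      - (∑ l, christoffel g x l k i * (g x * L x) l j)
      - (∑ l, christoffel g x l k j * (g x * L x) i l)
      - (pd i (fun y => (1/2) * (L y).trace) x * g x j k
      + pd j (fun y => (1/2) * (L y).trace) x * g x i k)) := by
  have a_symm : ∀ c a b, pd c (fun y => g y a b) x = pd c (fun y => g y b a) x := by
    intro c a b
    have : (fun y => g y a b) =ᶠ[𝓝 x] (fun y => g y b a) := by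
      filter_upwards [hs] with y hy
      exact hy.apply b a
    unfold pd
    rw [this.fderiv_eq]
  have prodrule : ∀ a b, pd k (fun y => (g y * L y) a b) x =
      ∑ s, (g x a s * pd k (fun y => L y s b) x + L x s b * pd k (fun y => g y a s) x) := by
    intro a b
    have : HasFDerivAt (fun y => (g y * L y) a b) (∑ s, (g x a s • fderiv ℝ (fun y => L y s b) x
        + L x s b • fderiv ℝ (fun y => g y a s) x)) x := by
      simp only [Matrix.mul_apply]
      exact HasFDerivAt.fun_sum fun s _ => (hg a s).hasFDerivAt.mul (hL s b).hasFDerivAt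
    unfold pd
    rw [this.fderiv]
    simp
  have gl_symm : pd k (fun y => (g y * L y) i j) x = pd k (fun y => (g y * L y) j i) x := by
    have : (fun y => (g y * L y) i j) =ᶠ[𝓝 x] (fun y => (g y * L y) j i) := by
      filter_upwards [hLs] with y hy
      exact hy.apply j i
    unfold pd
    rw [this.fderiv_eq]
  have trrule : ∀ c, pd c (fun y => (1/2) * (L y).trace) x =
      (1/2) * ∑ s, pd c (fun y => L y s s) x := by
    intro c
    have : HasFDerivAt (fun y => (1/2) * (L y).trace)
        ((1/2 : ℝ) • ∑ s, fderiv ℝ (fun y => L y s s) x) x := by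
      simp only [Matrix.trace, Matrix.diag]
      exact (HasFDerivAt.fun_sum fun s _ => (hL s s).hasFDerivAt).const_mul _
    unfold pd
    rw [this.fderiv]
    simp
  have c2 : ∑ l, christoffel g x l k j * (g x * L x) i l =
      ∑ l, christoffel g x l k j * (g x * L x) l i :=
    Finset.sum_congr rfl fun l _ => by rw [(hLs.self_of_nhds).apply l i]
  rw [c2, chr_contract g x (L x) hu hs.self_of_nhds, chr_contract g x (L x) hu hs.self_of_nhds]
  have two : 2 * pd k (fun y => (g y * L y) i j) x = pd k (fun y => (g y * L y) i j) x +
      pd k (fun y => (g y * L y) j i) x := by rw [← gl_symm]; ring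
  simp only [mul_sub, two]
  rw [prodrule, prodrule, trrule, trrule]
  have dG : ∀ (c b : ι), fderiv ℝ (fun y => mG (g y)) x (Pi.single c 1) (mL (L x) (Pi.single b 1))
      (Pi.single k 1) = ∑ s, L x s b * pd c (fun y => g y s k) x := by
    intro c b
    rw [mG_fderiv hg, mG_apply, mL_apply]
    simp [dotProduct]
  have dG2 : ∀ (c b : ι), fderiv ℝ (fun y => mG (g y)) x (mL (L x) (Pi.single b 1)) (Pi.single c 1)
      (Pi.single k 1) = ∑ s, L x s b * pd s (fun y => g y c k) x := by
    intro c b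
    have : mL (L x) (Pi.single b 1) = ∑ s, L x s b • (Pi.single s 1 : ι → ℝ) := by
      ext a; rw [mL_single]; simp [Finset.sum_apply, Pi.single_apply]
    rw [this, map_sum]
    simp only [map_smul, ContinuousLinearMap.sum_apply, ContinuousLinearMap.smul_apply,
      mG_fderiv hg, mG_single, smul_eq_mul, Matrix.of_apply]
  have gd : ∀ a b, mG (g x) (Pi.single a 1) (fderiv ℝ (fun y => mL (L y)) x (Pi.single k 1)
      (Pi.single b 1)) = ∑ s, g x a s * pd k (fun y => L y s b) x := by
    intro a b
    rw [mL_fderiv hL, mG_apply, mL_apply]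
    simp [mulVec, dotProduct, Pi.single_apply]
  unfold EF Edef
  rw [dG, dG, dG2, dG2, gd, gd, mL_fderiv hL, mL_fderiv hL, ctr_mL, ctr_mL, mG_single, mG_single]
  simp only [Matrix.trace, Matrix.diag, Matrix.of_apply, Finset.sum_add_distrib, mul_add, mul_sub,
    Finset.sum_sub_distrib]
  simp only [a_symm k _ i, a_symm k _ j, a_symm _ k i, a_symm _ k j]
  ring

lemma lin_zero {f : (ι → ℝ) → ℝ} (ha : ∀ X Y, f (X + Y) = f X + f Y)
    (hm : ∀ (c : ℝ) X, f (c • X) = c * f X) (h : ∀ i, f (Pi.single i 1) = 0) (X : ι → ℝ) :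
    f X = 0 := by
  let F : (ι → ℝ) →ₗ[ℝ] ℝ := { toFun := f, map_add' := ha, map_smul' := hm }
  have : F = 0 := by
    apply (Pi.basisFun ℝ ι).ext
    intro i
    simpa [F] using h i
  exact congrArg (fun T => T X) this

lemma EF_zero_of_basis {G : (ι → ℝ) → (ι → ℝ) →L[ℝ] (ι → ℝ) →L[ℝ] ℝ}
    {L : (ι → ℝ) → (ι → ℝ) →L[ℝ] (ι → ℝ)} {x : ι → ℝ}
    (h : ∀ i j k, EF G L x (Pi.single i 1) (Pi.single j 1) (Pi.single k 1) = 0) (X Y Z : ι → ℝ) :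
    EF G L x X Y Z = 0 := by
  refine lin_zero (f := fun X => EF G L x X Y Z) ?_ ?_ (fun i => ?_) X
  · intro X X'; simp only [EF, Edef, map_add, ContinuousLinearMap.add_apply, ctr_add]; ring
  · intro c X; simp only [EF, Edef, map_smul, ContinuousLinearMap.smul_apply, ctr_smul,
      smul_eq_mul]; ring
  refine lin_zero (f := fun Y => EF G L x _ Y Z) ?_ ?_ (fun j => ?_) Y
  · intro X X'; simp only [EF, Edef, map_add, ContinuousLinearMap.add_apply, ctr_add]; ring
  · intro c X; simp only [EF, Edef, map_smul, ContinuousLinearMap.smul_apply, ctr_smul,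
      smul_eq_mul]; ring
  refine lin_zero (f := fun Z => EF G L x _ _ Z) ?_ ?_ (fun k => h i j k) Z
  · intro X X'; simp only [EF, Edef, map_add, ContinuousLinearMap.add_apply, ctr_add]; ring
  · intro c X; simp only [EF, Edef, map_smul, ContinuousLinearMap.smul_apply, ctr_smul,
      smul_eq_mul]; ring

lemma sym_iff (A : Matrix ι ι ℝ) : A.IsSymm ↔ ∀ X Y, mG A X Y = mG A Y X := by
  constructor
  · intro h X Y
    rw [mG_apply, mG_apply, Matrix.dotProduct_mulVec, ← Matrix.mulVec_transpose, h.eq,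
      dotProduct_comm]
  · intro h
    ext i j
    rw [Matrix.transpose_apply, ← mG_single A, h, mG_single]

lemma mG_mul (A B : Matrix ι ι ℝ) (X Y : ι → ℝ) : mG (A * B) X Y = mG A X (mL B Y) := by
  rw [mG_apply, mG_apply, mL_apply, Matrix.mulVec_mulVec]

lemma self_of_sym {A B : Matrix ι ι ℝ} (hA : A.IsSymm) (h : (A * B).IsSymm) (X Y : ι → ℝ) :
    mG A (mL B X) Y = mG A X (mL B Y) := by
  rw [(sym_iff A).1 hA, ← mG_mul, ← mG_mul, (sym_iff _).1 h]

lemma sym_of_self {A B : Matrix ι ι ℝ} (hA : A.IsSymm)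
    (h : ∀ X Y, mG A (mL B X) Y = mG A X (mL B Y)) : (A * B).IsSymm := by
  rw [sym_iff]
  intro X Y
  rw [mG_mul, mG_mul, ← h, (sym_iff A).1 hA]

lemma mG_nd {A : Matrix ι ι ℝ} (h : IsUnit A.det) (N : ι → ℝ) (hN : ∀ W, mG A W N = 0) :
    N = 0 := by
  have : A *ᵥ N = 0 := by
    ext i
    have := hN (Pi.single i 1)
    rw [mG_apply] at this
    simpa using this
  have h2 : A⁻¹ *ᵥ (A *ᵥ N) = 0 := by rw [this, Matrix.mulVec_zero]
  rwa [Matrix.mulVec_mulVec, Matrix.nonsing_inv_mul _ h, Matrix.one_mulVec] at h2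

lemma det_of_nd {A : Matrix ι ι ℝ} (h : ∀ N, (∀ W, mG A W N = 0) → N = 0) : IsUnit A.det := by
  rw [isUnit_iff_ne_zero]
  intro h0
  obtain ⟨v, hv, hv0⟩ := Matrix.exists_mulVec_eq_zero_iff.2 h0
  exact hv (h v fun W => by rw [mG_apply, hv0, dotProduct_zero])

lemma EF_of_compat {U : Set (ι → ℝ)} (hU : IsOpen U) {g L : (ι → ℝ) → Matrix ι ι ℝ}
    (h : IsCompatiblePair U g L) {x : ι → ℝ} (hx : x ∈ U) (X Y Z : ι → ℝ) :
    EF (fun y => mG (g y)) (fun y => mL (L y)) x X Y Z = 0 := by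
  obtain ⟨h1, h2, h3, h4⟩ := h
  apply EF_zero_of_basis
  intro i j k
  rw [EF_basis (fun i j => ((h1 i j).contDiffAt (hU.mem_nhds hx)).differentiableAt (by simp))
    (fun i j => ((h2 i j).contDiffAt (hU.mem_nhds hx)).differentiableAt (by simp))
    (by filter_upwards [hU.mem_nhds hx] with y hy using (h3 y hy).1)
    (by filter_upwards [hU.mem_nhds hx] with y hy using (h3 y hy).2.2.2) (h3 x hx).2.1,
    h4 x hx i j k]
  ring

lemma compat_of_EF {U : Set (ι → ℝ)} (hU : IsOpen U) {g L : (ι → ℝ) → Matrix ι ι ℝ}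
    (h1 : ∀ i j : ι, ContDiffOn ℝ (⊤ : ℕ∞) (fun y => g y i j) U)
    (h2 : ∀ i j : ι, ContDiffOn ℝ (⊤ : ℕ∞) (fun y => L y i j) U)
    (h3 : ∀ x ∈ U, (g x).IsSymm ∧ IsUnit (g x).det ∧ IsUnit (L x).det ∧ (g x * L x).IsSymm)
    (h4 : ∀ x ∈ U, ∀ X Y Z, EF (fun y => mG (g y)) (fun y => mL (L y)) x X Y Z = 0) :
    IsCompatiblePair U g L := by
  refine ⟨h1, h2, h3, fun x hx i j k => ?_⟩
  have := h4 x hx (Pi.single i 1) (Pi.single j 1) (Pi.single k 1)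
  rw [EF_basis (fun i j => ((h1 i j).contDiffAt (hU.mem_nhds hx)).differentiableAt (by simp))
    (fun i j => ((h2 i j).contDiffAt (hU.mem_nhds hx)).differentiableAt (by simp))
    (by filter_upwards [hU.mem_nhds hx] with y hy using (h3 y hy).1)
    (by filter_upwards [hU.mem_nhds hx] with y hy using (h3 y hy).2.2.2) (h3 x hx).2.1] at this
  linarith

lemma jacM_apply {κ : Type} [Fintype κ] {φ : (ι → ℝ) → (κ → ℝ)} {x : ι → ℝ}
    (h : DifferentiableAt ℝ φ x) (X : ι → ℝ) : jacM φ x *ᵥ X = fderiv ℝ φ x X := by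
  have h1 : jacM φ x = LinearMap.toMatrix' (fderiv ℝ φ x : (ι → ℝ) →ₗ[ℝ] (κ → ℝ)) := by
    ext c a
    rw [LinearMap.toMatrix'_apply]
    unfold jacM
    have := (hasFDerivAt_pi'.1 h.hasFDerivAt c).fderiv
    rw [this]
    simp [Pi.single_apply]
  rw [h1, ← Matrix.toLin'_apply, Matrix.toLin'_toMatrix']
  rfl
end Bridge
end PartP12

section PartP13
open Filter Topology

section Coords
variable {k : ℕ} {d : Fin k → ℕ}

/-- restriction to the i-th group of coordinates -/
noncomputable def qi (i : Fin k) : (((i : Fin k) × Fin (d i)) → ℝ) →L[ℝ] (Fin (d i) → ℝ) :=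
  ContinuousLinearMap.pi fun a =>
    ContinuousLinearMap.proj (R := ℝ) (φ := fun _ : ((i : Fin k) × Fin (d i)) => ℝ) ⟨i, a⟩

/-- inclusion of the i-th group of coordinates -/
noncomputable def ji (i : Fin k) : (Fin (d i) → ℝ) →L[ℝ] (((i : Fin k) × Fin (d i)) → ℝ) :=
  ∑ a, (ContinuousLinearMap.proj (R := ℝ) (φ := fun _ : Fin (d i) => ℝ) a).smulRight
    (Pi.single (⟨i, a⟩ : (i : Fin k) × Fin (d i)) (1 : ℝ) : ((i : Fin k) × Fin (d i)) → ℝ)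

/-- projection onto the i-th group of coordinates -/
noncomputable def cpr (i : Fin k) :
    (((i : Fin k) × Fin (d i)) → ℝ) →L[ℝ] (((i : Fin k) × Fin (d i)) → ℝ) := (ji i).comp (qi i)

lemma qi_apply (i : Fin k) (X : ((i : Fin k) × Fin (d i)) → ℝ) : qi i X = fun a => X ⟨i, a⟩ := rfl

lemma ji_apply (i : Fin k) (u : Fin (d i) → ℝ) (s : (i : Fin k) × Fin (d i)) :
    ji i u s = ∑ a, u a * (Pi.single (⟨i, a⟩ : (i : Fin k) × Fin (d i)) (1 : ℝ) :
      ((i : Fin k) × Fin (d i)) → ℝ) s := by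
  simp [ji, ContinuousLinearMap.sum_apply, Finset.sum_apply]

lemma qi_ji (i : Fin k) (u : Fin (d i) → ℝ) : qi i (ji i u) = u := by
  ext b
  rw [qi_apply]
  simp [ji_apply, Pi.single_apply]

lemma qi_ji_ne {i l : Fin k} (h : l ≠ i) (u : Fin (d i) → ℝ) : qi l (ji i u) = 0 := by
  ext b
  rw [qi_apply]
  simp only [ji_apply, Pi.single_apply, Pi.zero_apply]
  refine Finset.sum_eq_zero fun a _ => ?_
  rw [if_neg (fun hh => h (congrArg Sigma.fst hh)), mul_zero]

lemma qi_ext {X Y : ((i : Fin k) × Fin (d i)) → ℝ} (h : ∀ i, qi i X = qi i Y) : X = Y := by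
  ext ⟨i, a⟩
  exact congrFun (h i) a

lemma cpr_apply (i : Fin k) (X : ((i : Fin k) × Fin (d i)) → ℝ) : cpr i X = ji i (qi i X) := rfl

lemma qi_cpr (i : Fin k) (X : ((i : Fin k) × Fin (d i)) → ℝ) : qi i (cpr i X) = qi i X := qi_ji _ _

lemma qi_cpr_ne {i l : Fin k} (h : l ≠ i) (X : ((i : Fin k) × Fin (d i)) → ℝ) :
    qi l (cpr i X) = 0 := qi_ji_ne h _

lemma cpr_ji (i : Fin k) (u : Fin (d i) → ℝ) : cpr i (ji i u) = ji i u := by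
  rw [cpr_apply, qi_ji]

lemma cpr_ji_ne {i l : Fin k} (h : l ≠ i) (u : Fin (d i) → ℝ) : cpr l (ji i u) = 0 := by
  rw [cpr_apply, qi_ji_ne h, map_zero]

lemma qi_mL_bd (B : ∀ i : Fin k, Matrix (Fin (d i)) (Fin (d i)) ℝ) (i : Fin k)
    (X : ((i : Fin k) × Fin (d i)) → ℝ) :
    qi i (mL (blockDiagonal' B) X) = mL (B i) (qi i X) := by
  ext a
  simp only [qi_apply, mL_apply, mulVec, dotProduct]
  rw [Fintype.sum_sigma, Finset.sum_eq_single i]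
  · simp
  · intro j _ hj
    refine Finset.sum_eq_zero fun b _ => ?_
    rw [blockDiagonal'_apply_ne _ _ _ hj.symm, zero_mul]
  · simp

lemma mG_bd (B : ∀ i : Fin k, Matrix (Fin (d i)) (Fin (d i)) ℝ)
    (X Y : ((i : Fin k) × Fin (d i)) → ℝ) :
    mG (blockDiagonal' B) X Y = ∑ i, mG (B i) (qi i X) (qi i Y) := by
  rw [mG_apply, dotProduct, Fintype.sum_sigma]
  refine Finset.sum_congr rfl fun i _ => ?_
  have := qi_mL_bd B i Y
  rw [mG_apply, ← mL_apply (B i), ← this]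
  rfl

/-- diagonal block of an endomorphism -/
noncomputable def blkM (T : (((i : Fin k) × Fin (d i)) → ℝ) →L[ℝ] (((i : Fin k) × Fin (d i)) → ℝ))
    (i : Fin k) : Matrix (Fin (d i)) (Fin (d i)) ℝ :=
  Matrix.of fun a b => qi i (T (ji i (Pi.single b 1))) a

lemma mL_of_clm {ι : Type} [Fintype ι] [DecidableEq ι] (T : (ι → ℝ) →L[ℝ] (ι → ℝ)) :
    mL (Matrix.of fun a b => T (Pi.single b 1) a) = T := by
  have : (Matrix.of fun a b => T (Pi.single b 1) a) =
      LinearMap.toMatrix' (T : (ι → ℝ) →ₗ[ℝ] (ι → ℝ)) := by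
    ext a b; rw [LinearMap.toMatrix'_apply]; rfl
  rw [this]
  ext1 X
  rw [mL_apply, ← Matrix.toLin'_apply, Matrix.toLin'_toMatrix']
  rfl

lemma mL_inj {ι : Type} [Fintype ι] [DecidableEq ι] {A B : Matrix ι ι ℝ} (h : mL A = mL B) :
    A = B := by
  ext i j
  rw [← mL_single A, h, mL_single]

lemma mL_blkM (T : (((i : Fin k) × Fin (d i)) → ℝ) →L[ℝ] (((i : Fin k) × Fin (d i)) → ℝ))
    (i : Fin k) (X : Fin (d i) → ℝ) : mL (blkM T i) X = qi i (T (ji i X)) :=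
  congrArg (fun S => S X) (mL_of_clm (((qi i).comp T).comp (ji i)))

lemma blkM_comm {T : (((i : Fin k) × Fin (d i)) → ℝ) →L[ℝ] (((i : Fin k) × Fin (d i)) → ℝ)}
    (h : ∀ i X, cpr i (T X) = T (cpr i X)) (i : Fin k) (X) :
    qi i (T X) = mL (blkM T i) (qi i X) := by
  rw [mL_blkM, ← cpr_apply, ← h, qi_cpr]

lemma eq_blkM {T : (((i : Fin k) × Fin (d i)) → ℝ) →L[ℝ] (((i : Fin k) × Fin (d i)) → ℝ)}
    (h : ∀ i X, cpr i (T X) = T (cpr i X)) : T = mL (blockDiagonal' (blkM T)) := by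
  ext1 X
  apply qi_ext
  intro i
  rw [qi_mL_bd, blkM_comm h]

lemma charpoly_of_cdet {ι : Type} [Fintype ι] [DecidableEq ι] (M : Matrix ι ι ℝ) (q : ℝ[X])
    (h : ∀ t : ℝ, cdet (t • 1 - mL M) = q.eval t) : M.charpoly = q := by
  apply Polynomial.funext
  intro t
  rw [← h, Matrix.eval_charpoly, ← cdet_mL]
  congr 1
  rw [map_sub]
  congr 1
  rw [← map_one mL, ← map_smul, Matrix.smul_one_eq_diagonal]
  rfl

lemma cdet_of_charpoly {ι : Type} [Fintype ι] [DecidableEq ι] (M : Matrix ι ι ℝ) (t : ℝ) :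
    cdet (t • 1 - mL M) = M.charpoly.eval t := by
  rw [Matrix.eval_charpoly, ← cdet_mL]
  congr 1
  rw [map_sub]
  congr 1
  rw [← map_one mL, ← map_smul, Matrix.smul_one_eq_diagonal]
  rfl

lemma blkM_charpoly
    {T : (((i : Fin k) × Fin (d i)) → ℝ) →L[ℝ] (((i : Fin k) × Fin (d i)) → ℝ)}
    (h : ∀ i X, cpr i (T X) = T (cpr i X)) {χ : Fin k → ℝ[X]} (hm : ∀ i, (χ i).Monic)
    (hc : ∀ i j, i ≠ j → IsCoprime (χ i) (χ j))
    (hdet : ∀ t : ℝ, cdet (t • 1 - T) = (∏ i, χ i).eval t)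
    (hk : ∀ i X, aeval T (χ i) (cpr i X) = 0) (i : Fin k) : (blkM T i).charpoly = χ i := by
  refine block_charpoly (blkM T) χ hm hc ?_ ?_ i
  · rw [← charpoly_blockDiag']
    apply charpoly_of_cdet
    rw [← eq_blkM h]
    exact hdet
  · intro i
    apply mL_inj
    rw [map_zero, ← Polynomial.aeval_algHom_apply]
    ext1 u
    have h1 := intertwine (qi i) T (mL (blkM T i)) (blkM_comm h i) (χ i) (ji i u)
    rw [qi_ji] at h1
    rw [← h1, ← cpr_ji, hk, map_zero]
    rfl

lemma cdet_conj {V V' : Type} [NormedAddCommGroup V] [NormedSpace ℝ V] [NormedAddCommGroup V']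
    [NormedSpace ℝ V'] (J : V' ≃L[ℝ] V) {S : V' →L[ℝ] V'} {T : V →L[ℝ] V}
    (h : ∀ X, J (S X) = T (J X)) : cdet S = cdet T := by
  unfold cdet
  rw [← LinearMap.det_conj (S : V' →ₗ[ℝ] V') J.toLinearEquiv]
  congr 1
  ext X
  have := h (J.symm X)
  rw [J.apply_symm_apply] at this
  exact this

lemma adapted0 {V : Type} [NormedAddCommGroup V] [NormedSpace ℝ V] [FiniteDimensional ℝ V]
    (P : Fin k → V →L[ℝ] V) (hs : ∑ i, P i = 1) (ho : ∀ i j, i ≠ j → P i * P j = 0)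
    (hi : ∀ i, P i * P i = P i) :
    ∃ (d' : Fin k → ℕ) (β : (((i : Fin k) × Fin (d' i)) → ℝ) ≃L[ℝ] V),
      ∀ i X, β (cpr i X) = P i (β X) := by
  have hs' : ∀ X, ∑ i, P i X = X := fun X => by
    have := congrArg (fun T => T X) hs
    simpa [ContinuousLinearMap.sum_apply] using this
  have ho' : ∀ i j, i ≠ j → ∀ X, P i (P j X) = 0 := fun i j h X => congrArg (fun T => T X) (ho i j h)
  have hi' : ∀ i X, P i (P i X) = P i X := fun i X => congrArg (fun T => T X) (hi i)
  let W : Fin k → Submodule ℝ V := fun i => LinearMap.range (P i : V →ₗ[ℝ] V)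
  let b := fun i => Module.finBasis ℝ (W i)
  have hW : ∀ i (w : W i), P i w = w := by
    rintro i ⟨w, X, rfl⟩
    exact hi' i X
  have hWn : ∀ i l, l ≠ i → ∀ (w : W i), P l w = 0 := by
    rintro i l h ⟨w, X, rfl⟩
    exact ho' l i h X
  let f : (((i : Fin k) × Fin (Module.finrank ℝ (W i))) → ℝ) →ₗ[ℝ] V :=
    ∑ i, (W i).subtype ∘ₗ (b i).equivFun.symm.toLinearMap ∘ₗ
      (qi (d := fun i => Module.finrank ℝ (W i)) i).toLinearMap
  have hf : ∀ X, f X = ∑ i, (((b i).equivFun.symm (qi i X) : W i) : V) := by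
    intro X
    simp only [f, LinearMap.sum_apply]
    rfl
  have hPf : ∀ l X, P l (f X) = (((b l).equivFun.symm (qi l X) : W l) : V) := by
    intro l X
    rw [hf, map_sum, Finset.sum_eq_single l]
    · exact hW l _
    · intro j _ hj; exact hWn j l hj.symm _
    · simp
  have hinj : Function.Injective f := by
    rw [← LinearMap.ker_eq_bot, LinearMap.ker_eq_bot']
    intro X hX
    apply qi_ext
    intro l
    have h1 := hPf l X
    rw [hX, map_zero] at h1
    have h2 : (b l).equivFun.symm (qi l X) = 0 := Subtype.ext h1.symm
    rw [map_zero]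
    exact (LinearEquiv.map_eq_zero_iff _).1 h2
  have hsurj : Function.Surjective f := by
    intro v
    refine ⟨fun s => (b s.1).equivFun ⟨P s.1 v, v, rfl⟩ s.2, ?_⟩
    rw [hf]
    refine Eq.trans ?_ (hs' v)
    refine Finset.sum_congr rfl fun i _ => ?_
    exact congrArg Subtype.val ((b i).equivFun.symm_apply_apply ⟨P i v, v, rfl⟩)
  refine ⟨fun i => Module.finrank ℝ (W i),
    (LinearEquiv.ofBijective f ⟨hinj, hsurj⟩).toContinuousLinearEquiv, ?_⟩
  intro i X
  show f (cpr i X) = P i (f X)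
  rw [hPf, hf, Finset.sum_eq_single i]
  · rw [qi_cpr]
  · intro j _ hj; rw [qi_cpr_ne hj]; simp
  · simp

lemma adapted {n : ℕ} (A : Matrix (Fin n) (Fin n) ℝ) {χ : Fin k → ℝ[X]} (hm : ∀ i, (χ i).Monic)
    (hc : ∀ i j, i ≠ j → IsCoprime (χ i) (χ j)) (hchar : A.charpoly = ∏ i, χ i)
    (hd : ∀ i, (χ i).natDegree = d i) :
    ∃ β : (((i : Fin k) × Fin (d i)) → ℝ) ≃L[ℝ] (Fin n → ℝ),
      ∀ i X, β (cpr i X) = prj (mL A) χ i (β X) := by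
  have h0 : aeval (mL A) (∏ i, χ i) = 0 := by
    rw [← hchar, Polynomial.aeval_algHom_apply, Matrix.aeval_self_charpoly, map_zero]
  obtain ⟨d', β, hβ⟩ := adapted0 (fun i => prj (mL A) χ i) (prj_sum hc h0)
    (fun i j h => prj_orth hc h0 h) (prj_idem hc h0)
  let T : (((i : Fin k) × Fin (d' i)) → ℝ) →L[ℝ] (((i : Fin k) × Fin (d' i)) → ℝ) :=
    ((β.symm : (Fin n → ℝ) →L[ℝ] _).comp (mL A)).comp (β : _ →L[ℝ] (Fin n → ℝ))
  have hT : ∀ X, β (T X) = mL A (β X) := fun X => β.apply_symm_apply _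
  have hTq : ∀ q X, β (aeval T q X) = aeval (mL A) q (β X) :=
    fun q X => intertwine (β : _ →L[ℝ] (Fin n → ℝ)) T (mL A) hT q X
  have hch : ∀ i, (blkM T i).charpoly = χ i := by
    apply blkM_charpoly
    · intro i X
      apply β.injective
      rw [hβ, hT, hT, hβ]
      have := congrArg (fun S => S (β X)) (prj_comm hc h0 i Polynomial.X)
      simpa using this
    · exact hm
    · exact hc
    · intro t
      rw [← hchar, ← cdet_of_charpoly]
      apply cdet_conj β
      intro X
      simp [hT]
    · intro i X
      apply β.injective
      rw [hTq, hβ, map_zero]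
      exact congrArg (fun S => S (β X)) (prj_kill hc h0 i)
  have hdd : d' = d := by
    ext i
    rw [← hd i, ← hch i, Matrix.charpoly_natDegree_eq_dim, Fintype.card_fin]
  subst hdd
  exact ⟨β, hβ⟩
end Coords
end PartP13

section PartP14
open Filter Topology

section Pull
variable {V V' : Type} [NormedAddCommGroup V] [NormedSpace ℝ V] [FiniteDimensional ℝ V]
  [NormedAddCommGroup V'] [NormedSpace ℝ V'] [FiniteDimensional ℝ V']
  {ι : Type} [Fintype ι] [DecidableEq ι]

lemma aeval_conj_eq (J : V' ≃L[ℝ] V) {S : V' →L[ℝ] V'} {T : V →L[ℝ] V}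
    (h : ∀ X, J (S X) = T (J X)) (q : ℝ[X]) (X : V') : J (aeval S q X) = aeval T q (J X) :=
  intertwine (J : V' →L[ℝ] V) S T h q X

lemma prj_conj_eq (J : V' ≃L[ℝ] V) {S : V' →L[ℝ] V'} {T : V →L[ℝ] V}
    (h : ∀ X, J (S X) = T (J X)) {χ : ι → ℝ[X]} (hc : ∀ i j, i ≠ j → IsCoprime (χ i) (χ j))
    (h0 : aeval T (∏ i, χ i) = 0) (i : ι) (X : V') : J (prj S χ i X) = prj T χ i (J X) := by
  obtain ⟨u, h1, h2, h3⟩ := sumcof_unit hc h0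
  have e1 : aeval S (u * ∑ i, cof χ i) = 1 := by
    ext1 X
    apply J.injective
    rw [aeval_conj_eq J h, h1]; rfl
  have e2 : aeval S ((∑ i, cof χ i) * u) = 1 := by rw [mul_comm]; exact e1
  have e3 : Ring.inverse (aeval S (∑ i, cof χ i)) = aeval S u := by
    rw [map_mul] at e1 e2
    let w : (V' →L[ℝ] V')ˣ := ⟨aeval S (∑ i, cof χ i), aeval S u, e2, e1⟩
    exact Ring.inverse_unit w
  unfold prj
  rw [h3, e3, ← map_mul, ← map_mul, aeval_conj_eq J h]

lemma SData_pullback {U : Set V} {D : Set V'} {G H : V → V →L[ℝ] V →L[ℝ] ℝ}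
    {L : V → V →L[ℝ] V} {χ : ι → V → ℝ[X]} {π : ι → V' →L[ℝ] V'}
    {G' H' : V' → V' →L[ℝ] V' →L[ℝ] ℝ} {L' : V' → V' →L[ℝ] V'} {φ : V' → V}
    (hD : IsOpen D) (hconv : Convex ℝ D) (hφ : ContDiffOn ℝ (⊤ : ℕ∞) φ D)
    (hφU : Set.MapsTo φ D U)
    (hJ : ∀ x ∈ D, ∃ J : V' ≃L[ℝ] V, (J : V' →L[ℝ] V) = fderiv ℝ φ x ∧
      ∀ i X, J (π i X) = prj (L (φ x)) (fun i => χ i (φ x)) i (J X))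
    (hG'd : ∀ x ∈ D, DifferentiableAt ℝ G' x) (hH'd : ∀ x ∈ D, DifferentiableAt ℝ H' x)
    (hL'd : ∀ x ∈ D, DifferentiableAt ℝ L' x)
    (hG' : ∀ x ∈ D, ∀ X Y, G' x X Y = G (φ x) (fderiv ℝ φ x X) (fderiv ℝ φ x Y))
    (hH' : ∀ x ∈ D, ∀ X Y, H' x X Y = H (φ x) (fderiv ℝ φ x X) (fderiv ℝ φ x Y))
    (hL' : ∀ x ∈ D, ∀ X, fderiv ℝ φ x (L' x X) = L (φ x) (fderiv ℝ φ x X))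
    (hG : ∀ x ∈ U, DifferentiableAt ℝ G x) (hL : ∀ x ∈ U, DifferentiableAt ℝ L x)
    (hχ : ∀ i, SmP U (χ i)) (hmon : ∀ x ∈ U, ∀ i, (χ i x).Monic)
    (hc : ∀ x ∈ U, ∀ i j, i ≠ j → IsCoprime (χ i x) (χ j x))
    (h0 : ∀ x ∈ U, aeval (L x) (∏ i, χ i x) = 0)
    (hGs : ∀ x ∈ U, ∀ X Y, G x X Y = G x Y X)
    (hGL : ∀ x ∈ U, ∀ X Y, G x (L x X) Y = G x X (L x Y))
    (hHs : ∀ x ∈ U, ∀ X Y, H x X Y = H x Y X)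
    (hHL : ∀ x ∈ U, ∀ X Y, H x (L x X) Y = H x X (L x Y))
    (hHnd : ∀ x ∈ U, ∀ N, (∀ W, H x W N = 0) → N = 0)
    (hGH : ∀ x ∈ U, ∀ X Y, G x X Y = H x X (aeval (L x) (∑ i, cof (fun i => χ i x) i) Y))
    (hE : ∀ x ∈ U, ∀ X Y Z, EF G L x X Y Z = 0) :
    SData D G' H' L' (fun i x => χ i (φ x)) π := by
  have key : ∀ x ∈ D, ∃ J : V' ≃L[ℝ] V, (J : V' →L[ℝ] V) = fderiv ℝ φ x ∧
      (∀ i X, J (π i X) = prj (L (φ x)) (fun i => χ i (φ x)) i (J X)) ∧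
      (∀ X, J (L' x X) = L (φ x) (J X)) ∧ (∀ X Y, H' x X Y = H (φ x) (J X) (J Y)) ∧
      (∀ X Y, G' x X Y = G (φ x) (J X) (J Y)) := by
    intro x hx
    obtain ⟨J, hJ1, hJ2⟩ := hJ x hx
    have hJ' : ∀ X, J X = fderiv ℝ φ x X := fun X => by rw [← hJ1]; rfl
    refine ⟨J, hJ1, hJ2, ?_, ?_, ?_⟩
    · intro X; rw [hJ', hJ', hL' x hx]
    · intro X Y; rw [hJ', hJ', hH' x hx]
    · intro X Y; rw [hJ', hJ', hG' x hx]
  refine ⟨hD, hconv, hG'd, hH'd, hL'd, fun i => (hχ i).comp hφ hφU, fun x hx => hmon _ (hφU hx),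
    fun x hx => hc _ (hφU hx), ?_, ?_, ?_, ?_, ?_, ?_, ?_⟩
  · intro x hx
    obtain ⟨J, -, -, hJL, -, -⟩ := key x hx
    ext1 X
    apply J.injective
    rw [aeval_conj_eq J hJL, h0 _ (hφU hx)]
    simp
  · intro x hx i
    obtain ⟨J, -, hJπ, hJL, -, -⟩ := key x hx
    ext1 X
    apply J.injective
    rw [prj_conj_eq J hJL (hc _ (hφU hx)) (h0 _ (hφU hx)), hJπ]
  · intro x hx X Y
    obtain ⟨J, -, -, -, hJH, -⟩ := key x hx
    rw [hJH, hJH, hHs _ (hφU hx)]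
  · intro x hx X Y
    obtain ⟨J, -, -, hJL, hJH, -⟩ := key x hx
    rw [hJH, hJH, hJL, hJL, hHL _ (hφU hx)]
  · intro x hx N hN
    obtain ⟨J, -, -, -, hJH, -⟩ := key x hx
    have := hHnd _ (hφU hx) (J N) (fun W => by
      have := hN (J.symm W)
      rwa [hJH, J.apply_symm_apply] at this)
    exact (map_eq_zero_iff J J.injective).1 this
  · intro x hx X Y
    obtain ⟨J, -, -, hJL, hJH, hJG⟩ := key x hx
    rw [hJG, hJH, hGH _ (hφU hx), aeval_conj_eq J hJL]
  · intro x hx X Y Z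
    obtain ⟨J, hJ1, -⟩ := key x hx
    have hm : ∀ᶠ y in 𝓝 x, y ∈ D := hD.mem_nhds hx
    rw [EF_pullback (G := G) (L := L) (φ := φ)
      ((hφ.contDiffAt (hD.mem_nhds hx)).of_le (WithTop.coe_le_coe.2 (le_top : (2 : ℕ∞) ≤ ⊤))) J hJ1
      (hG _ (hφU hx)) (hL _ (hφU hx)) (hG'd x hx) (hL'd x hx) (hGs _ (hφU hx)) (hGL _ (hφU hx))
      (hm.mono fun y hy => hG' y hy) (hm.mono fun y hy => hL' y hy)]
    exact hE _ (hφU hx) _ _ _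

lemma local_chart {k n : ℕ} {d : Fin k → ℕ} {U : Set (Fin n → ℝ)} (hU : IsOpen U) {p : Fin n → ℝ}
    (hp : p ∈ U) {L : (Fin n → ℝ) → Matrix (Fin n) (Fin n) ℝ}
    (hL : ContDiffOn ℝ (⊤ : ℕ∞) (fun y => mL (L y)) U)
    {χ : Fin k → (Fin n → ℝ) → ℝ[X]} (hχ : ∀ i, SmP U (χ i))
    (hmon : ∀ x ∈ U, ∀ i, (χ i x).Monic) (hd : ∀ x ∈ U, ∀ i, (χ i x).natDegree = d i)
    (hc : ∀ x ∈ U, ∀ i j, i ≠ j → IsCoprime (χ i x) (χ j x))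
    (hchar : ∀ x ∈ U, (L x).charpoly = ∏ i, χ i x)
    (h0 : ∀ x ∈ U, aeval (mL (L x)) (∏ i, χ i x) = 0)
    (hN : ∀ x ∈ U, Nij (mL (L x)) (fderiv ℝ (fun y => mL (L y)) x)) :
    ∃ (x0 : ((i : Fin k) × Fin (d i)) → ℝ) (ε : ℝ)
      (φ : (((i : Fin k) × Fin (d i)) → ℝ) → (Fin n → ℝ)), 0 < ε ∧ φ x0 = p ∧
      ContDiffOn ℝ (⊤ : ℕ∞) φ (Metric.ball x0 ε) ∧ Set.InjOn φ (Metric.ball x0 ε) ∧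
      IsOpen (φ '' Metric.ball x0 ε) ∧ Set.MapsTo φ (Metric.ball x0 ε) U ∧
      ∀ x ∈ Metric.ball x0 ε, ∃ J : (((i : Fin k) × Fin (d i)) → ℝ) ≃L[ℝ] (Fin n → ℝ),
        (J : _ →L[ℝ] (Fin n → ℝ)) = fderiv ℝ φ x ∧
        ∀ i X, J (cpr i X) = prj (mL (L (φ x))) (fun i => χ i (φ x)) i (J X) := by
  obtain ⟨e, hpe, heU, hes, hJ⟩ := straighten hU hp hL hχ hc h0 hN
  obtain ⟨β, hβ⟩ := adapted (L p) (hmon p hp) (hc p hp) (hchar p hp) (hd p hp)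
  let x0 := β.symm (e p)
  have hO : IsOpen (β ⁻¹' e.target) := e.open_target.preimage β.continuous
  have hx0 : x0 ∈ β ⁻¹' e.target := by
    show β (β.symm (e p)) ∈ e.target
    rw [β.apply_symm_apply]; exact e.map_source hpe
  obtain ⟨ε, hε, hball⟩ := Metric.isOpen_iff.1 hO x0 hx0
  refine ⟨x0, ε, fun x => e.symm (β x), hε, ?_, ?_, ?_, ?_, ?_, ?_⟩
  · show e.symm (β (β.symm (e p))) = p
    rw [β.apply_symm_apply, e.left_inv hpe]
  · exact hes.comp β.contDiff.contDiffOn hball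
  · intro x hx y hy hxy
    exact β.injective (e.symm.injOn (hball hx) (hball hy) hxy)
  · have : (fun x => e.symm (β x)) '' Metric.ball x0 ε = e.symm '' (β '' Metric.ball x0 ε) := by
      rw [Set.image_image]
    rw [this]
    apply e.symm.isOpen_image_of_subset_source
    · exact β.toHomeomorph.isOpenMap _ Metric.isOpen_ball
    · rintro _ ⟨x, hx, rfl⟩; exact hball hx
  · intro x hx
    exact heU (e.map_target (hball hx))
  · intro x hx
    have ht : β x ∈ e.target := hball hx
    obtain ⟨J, hJ1, hJ2⟩ := hJ _ (e.map_target ht)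
    have h1 : HasFDerivAt e.symm (J.symm : (Fin n → ℝ) →L[ℝ] (Fin n → ℝ)) (β x) :=
      e.hasFDerivAt_symm ht hJ1
    have h2 : HasFDerivAt (fun x => e.symm (β x))
        (((β.trans J.symm : _ ≃L[ℝ] (Fin n → ℝ))) : _ →L[ℝ] (Fin n → ℝ)) x :=
      HasFDerivAt.comp (g := e.symm) x h1 β.hasFDerivAt
    refine ⟨β.trans J.symm, h2.fderiv.symm, ?_⟩
    intro i X
    apply J.injective
    rw [hJ2]
    simp [hβ]
end Pull
end PartP14

section PartP15
open Filter Topology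

section Blocks
variable {k : ℕ} {d : Fin k → ℕ}

lemma ball_iff {x0 x : ((i : Fin k) × Fin (d i)) → ℝ} {ε : ℝ} (hε : 0 < ε) :
    x ∈ Metric.ball x0 ε ↔ ∀ i, qi i x ∈ Metric.ball (qi i x0) ε := by
  simp only [Metric.mem_ball, dist_pi_lt_iff hε, qi_apply]
  constructor
  · intro h i a; exact h ⟨i, a⟩
  · rintro h ⟨i, a⟩; exact h i a

lemma mG_of_clm {ι : Type} [Fintype ι] [DecidableEq ι] {V : Type} [NormedAddCommGroup V]
    [NormedSpace ℝ V] (B : V →L[ℝ] V →L[ℝ] ℝ) (A : (ι → ℝ) →L[ℝ] V) (X Y : ι → ℝ) :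
    mG (Matrix.of fun a b => B (A (Pi.single a 1)) (A (Pi.single b 1))) X Y = B (A X) (A Y) := by
  have hX : ∀ X : ι → ℝ, A X = ∑ a, X a • A (Pi.single a 1) := by
    intro X
    conv_lhs => rw [pi_eq_sum_univ' X]
    simp [map_sum, Pi.single_apply]
  rw [hX X, hX Y, mG_apply]
  simp only [map_sum, map_smul, ContinuousLinearMap.sum_apply, ContinuousLinearMap.smul_apply,
    smul_eq_mul, dotProduct, mulVec, Matrix.of_apply, Finset.mul_sum]
  rw [Finset.sum_comm]
  refine Finset.sum_congr rfl fun a _ => ?_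
  refine Finset.sum_congr rfl fun b _ => ?_
  ring

lemma blocks {x0 : ((i : Fin k) × Fin (d i)) → ℝ} {ε : ℝ} (hε : 0 < ε)
    {G H : (((i : Fin k) × Fin (d i)) → ℝ) → (((i : Fin k) × Fin (d i)) → ℝ) →L[ℝ]
      (((i : Fin k) × Fin (d i)) → ℝ) →L[ℝ] ℝ}
    {L : (((i : Fin k) × Fin (d i)) → ℝ) → (((i : Fin k) × Fin (d i)) → ℝ) →L[ℝ]
      (((i : Fin k) × Fin (d i)) → ℝ)} {χ : Fin k → (((i : Fin k) × Fin (d i)) → ℝ) → ℝ[X]}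
    (S : SData (Metric.ball x0 ε) G H L χ cpr)
    (hHsm : ContDiffOn ℝ (⊤ : ℕ∞) H (Metric.ball x0 ε))
    (hLsm : ContDiffOn ℝ (⊤ : ℕ∞) L (Metric.ball x0 ε))
    (hdet : ∀ x ∈ Metric.ball x0 ε, ∀ t : ℝ, cdet (t • 1 - L x) = (∏ i, χ i x).eval t)
    (hLu : ∀ x ∈ Metric.ball x0 ε, ∀ X, L x X = 0 → X = 0) :
    ∃ hB LB : ∀ i : Fin k, (Fin (d i) → ℝ) → Matrix (Fin (d i)) (Fin (d i)) ℝ,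
      (∀ i, IsCompatiblePair (Metric.ball (qi i x0) ε) (hB i) (LB i)) ∧
      ∀ x ∈ Metric.ball x0 ε,
        (∀ X Y, H x X Y = mG (blockDiagonal' fun i => hB i (qi i x)) X Y) ∧
        L x = mL (blockDiagonal' fun i => LB i (qi i x)) ∧
        ∀ i, (LB i (qi i x)).charpoly = χ i x := by
  set D := Metric.ball x0 ε with hD
  let y : ∀ i : Fin k, (Fin (d i) → ℝ) → (((i : Fin k) × Fin (d i)) → ℝ) :=
    fun i u => (x0 - cpr i x0) + ji i u
  have qy : ∀ i u, qi i (y i u) = u := by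
    intro i u; simp only [y, map_add, map_sub, qi_cpr, qi_ji]; simp
  have qyn : ∀ i l u, l ≠ i → qi l (y i u) = qi l x0 := by
    intro i l u h; simp only [y, map_add, map_sub, qi_cpr_ne h, qi_ji_ne h]; simp
  have hy : ∀ i u, u ∈ Metric.ball (qi i x0) ε → y i u ∈ D := by
    intro i u hu
    rw [hD, ball_iff hε]
    intro l
    by_cases h : l = i
    · subst h; rw [qy]; exact hu
    · rw [qyn i l u h]; exact Metric.mem_ball_self hε
  have hcy : ∀ i x, cpr i (y i (qi i x)) = cpr i x := by
    intro i x; rw [cpr_apply, qy, cpr_apply]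
  have hyx : ∀ i x, x ∈ D → y i (qi i x) ∈ D := fun i x hx => hy i _ ((ball_iff hε).1 hx i)
  let hB : ∀ i : Fin k, (Fin (d i) → ℝ) → Matrix (Fin (d i)) (Fin (d i)) ℝ := fun i u =>
    Matrix.of fun a b => H (y i u) (ji i (Pi.single a 1)) (ji i (Pi.single b 1))
  let LB : ∀ i : Fin k, (Fin (d i) → ℝ) → Matrix (Fin (d i)) (Fin (d i)) ℝ := fun i u =>
    blkM (L (y i u)) i
  have hhB : ∀ i u X Y, mG (hB i u) X Y = H (y i u) (ji i X) (ji i Y) := fun i u X Y =>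
    mG_of_clm (H (y i u)) (ji i) X Y
  have hLB : ∀ i u X, mL (LB i u) X = qi i (L (y i u) (ji i X)) := fun i u X => mL_blkM _ i X
  -- the blocks of L
  have hblk : ∀ x ∈ D, ∀ i, blkM (L x) i = LB i (qi i x) := by
    intro x hx i
    apply mL_inj
    ext1 X
    rw [mL_blkM, hLB, ← cpr_ji, S.L_const hx (hyx i x hx) (hcy i x).symm]
  have hLchar : ∀ x ∈ D, ∀ i, (LB i (qi i x)).charpoly = χ i x := by
    intro x hx i
    rw [← hblk x hx]
    exact blkM_charpoly (χ := fun i => χ i x) (S.pcommL hx) (S.hmon x hx) (S.hc x hx) (hdet x hx)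
      (S.pkill hx) i
  have hχc : ∀ i, ∀ x ∈ D, ∀ y ∈ D, cpr i x = cpr i y → χ i x = χ i y := by
    intro i x hx z hz h
    rw [← hLchar x hx, ← hLchar z hz]
    have : qi i x = qi i z := by rw [← qi_cpr i x, h, qi_cpr]
    rw [this]
  -- the blocks of H
  have hHc : ∀ x ∈ D, ∀ i X Y, H x (ji i X) (ji i Y) = mG (hB i (qi i x)) X Y := by
    intro x hx i X Y
    rw [hhB, S.H_const hχc hdet hx (hyx i x hx) (hcy i x).symm (cpr_ji i X) (cpr_ji i Y)]
  have hHbd : ∀ x ∈ D, ∀ X Y, H x X Y = mG (blockDiagonal' fun i => hB i (qi i x)) X Y := by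
    intro x hx X Y
    rw [mG_bd]
    conv_lhs => rw [← S.psum hx Y, map_sum]
    refine Finset.sum_congr rfl fun i _ => ?_
    rw [← hHc x hx]
    have h1 : H x (X - cpr i X) (cpr i Y) = 0 :=
      S.Horth hx (i := i) (by rw [map_sub, S.pp hx, sub_self]) (S.pp hx i Y)
    rw [map_sub, ContinuousLinearMap.sub_apply, sub_eq_zero] at h1
    exact h1
  refine ⟨hB, LB, ?_, ?_⟩
  · intro i
    have hysm : ContDiffOn ℝ (⊤ : ℕ∞) (y i) (Metric.ball (qi i x0) ε) :=
      (contDiff_const.add (ji i).contDiff).contDiffOn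
    have hBsm : ∀ a b, ContDiffOn ℝ (⊤ : ℕ∞) (fun u => hB i u a b) (Metric.ball (qi i x0) ε) := by
      intro a b
      have h1 : ContDiffOn ℝ (⊤ : ℕ∞) (fun u => H (y i u)) (Metric.ball (qi i x0) ε) :=
        hHsm.comp hysm (fun u hu => hy i u hu)
      exact (h1.clm_apply contDiffOn_const).clm_apply contDiffOn_const
    have LBsm : ∀ a b, ContDiffOn ℝ (⊤ : ℕ∞) (fun u => LB i u a b) (Metric.ball (qi i x0) ε) := by
      intro a b
      have h1 : ContDiffOn ℝ (⊤ : ℕ∞) (fun u => L (y i u)) (Metric.ball (qi i x0) ε) :=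
        hLsm.comp hysm (fun u hu => hy i u hu)
      have h2 := h1.clm_apply
        (contDiffOn_const (c := ji i (Pi.single b (1 : ℝ) : Fin (d i) → ℝ)))
      exact (contDiffOn_pi.1 h2) ⟨i, a⟩
    refine compat_of_EF Metric.isOpen_ball hBsm LBsm ?_ ?_
    · intro u hu
      have hyu := hy i u hu
      have hsym : (hB i u).IsSymm := by
        rw [sym_iff]
        intro X Y
        rw [hhB, hhB, S.hHs _ hyu]
      refine ⟨hsym, ?_, ?_, ?_⟩
      · apply det_of_nd
        intro N hN
        have h1 : ji i N = 0 := by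
          apply S.hHnd _ hyu
          intro W
          have h2 : H (y i u) (W - cpr i W) (ji i N) = 0 :=
            S.Horth hyu (i := i) (by rw [map_sub, S.pp hyu, sub_self]) (cpr_ji i N)
          rw [map_sub, ContinuousLinearMap.sub_apply, sub_eq_zero] at h2
          rw [h2, cpr_apply, ← hhB]
          exact hN _
        rw [← qi_ji i N, h1, map_zero]
      · rw [isUnit_iff_ne_zero]
        intro h0
        obtain ⟨v, hv, hv0⟩ := Matrix.exists_mulVec_eq_zero_iff.2 h0
        apply hv
        rw [← mL_apply, hLB] at hv0
        have h1 : L (y i u) (ji i v) = 0 := by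
          rw [← cpr_ji, ← S.pcommL hyu, cpr_apply, hv0, map_zero]
        rw [← qi_ji i v, hLu _ hyu _ h1, map_zero]
      · apply sym_of_self hsym
        intro X Y
        rw [hhB, hhB, hLB, hLB, ← cpr_apply, ← cpr_apply, S.pcommL hyu, S.pcommL hyu, cpr_ji,
          cpr_ji, S.hHL _ hyu]
    · intro u hu X Y Z
      have hyu := hy i u hu
      have hnh := (Metric.isOpen_ball (x := qi i x0) (ε := ε)).mem_nhds hu
      rw [EF_restrict (H := H) (L := L) (x0 - cpr i x0) (ji i) (qi i) (fun u X Y => hhB i u X Y)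
        (fun u X => hLB i u X)
        (mG_differentiableAt fun a b => ((hBsm a b).contDiffAt hnh).differentiableAt (by simp))
        (mL_differentiableAt fun a b => ((LBsm a b).contDiffAt hnh).differentiableAt (by simp))
        (S.hH _ hyu) (S.hL _ hyu)]
      · exact S.EF_block hχc hyu i (cpr_ji i X) (cpr_ji i Y) (cpr_ji i Z)
      · intro X
        show cpr i (L (y i u) (ji i X)) = L (y i u) (ji i X)
        rw [S.pcommL hyu, cpr_ji]
      · intro Z X
        show cpr i (fderiv ℝ L (y i u) (ji i Z) (ji i X)) = fderiv ℝ L (y i u) (ji i Z) (ji i X)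
        rw [S.dcomm hyu, cpr_ji]
      · intro Z X
        show fderiv ℝ L (y i u) (ji i Z) (cpr i X) = fderiv ℝ L (y i u) (ji i Z) X
        have := S.dL_zero' hyu i (cpr_ji i Z) (Y := X - cpr i X)
          (by rw [map_sub, S.pp hyu, sub_self])
        rw [map_sub, sub_eq_zero] at this
        exact this.symm
  · intro x hx
    refine ⟨hHbd x hx, ?_, hLchar x hx⟩
    conv_lhs => rw [eq_blkM (S.pcommL hx)]
    congr 2
    funext i
    exact hblk x hx i
end Blocks
end PartP15

section PartP16
open Filter Topology

section Core

lemma aeval_mL {ι : Type} [Fintype ι] [DecidableEq ι] (A : Matrix ι ι ℝ) (q : ℝ[X]) :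
    aeval (mL A) q = mL (aeval A q) := by
  rw [Polynomial.aeval_algHom_apply]

lemma ptwise {ι : Type} [Fintype ι] [DecidableEq ι] {k : ℕ} {g L : Matrix ι ι ℝ}
    {χ : Fin k → ℝ[X]} (hs : g.IsSymm) (hu : IsUnit g.det) (hLs : (g * L).IsSymm)
    (hc : ∀ i j, i ≠ j → IsCoprime (χ i) (χ j)) (hch : L.charpoly = ∏ i, χ i) :
    aeval (mL L) (∏ i, χ i) = 0 ∧
    IsUnit (aeval L (∑ i, cof χ i)).det ∧
    (g * (aeval L (∑ i, cof χ i))⁻¹).IsSymm ∧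
    IsUnit (g * (aeval L (∑ i, cof χ i))⁻¹).det ∧
    (g * (aeval L (∑ i, cof χ i))⁻¹ * L).IsSymm ∧
    (g * (aeval L (∑ i, cof χ i))⁻¹) * aeval L (∑ i, cof χ i) = g ∧
    mL (aeval L (∑ i, cof χ i))⁻¹ = Ring.inverse (aeval (mL L) (∑ i, cof χ i)) := by
  have z0 : aeval L (∏ i, χ i) = 0 := by rw [← hch]; exact Matrix.aeval_self_charpoly L
  have z1 : aeval (mL L) (∏ i, χ i) = 0 := by rw [aeval_mL, z0, map_zero]
  obtain ⟨u, h1, h2, h3⟩ := sumcof_unit hc z0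
  have hdu : IsUnit (aeval L (∑ i, cof χ i)).det := (Matrix.isUnit_iff_isUnit_det _).1 h2
  have hinv : (aeval L (∑ i, cof χ i))⁻¹ = aeval L u := by
    apply Matrix.inv_eq_left_inv
    rw [← map_mul]; exact h1
  have key : ∀ q : ℝ[X], (g * aeval L q).IsSymm := by
    intro q
    apply sym_of_self hs
    intro X Y
    rw [← aeval_mL]
    exact aeval_selfadj (self_of_sym hs hLs) q X Y
  refine ⟨z1, hdu, ?_, ?_, ?_, ?_, ?_⟩
  · rw [hinv]; exact key u
  · rw [Matrix.det_mul]
    exact hu.mul (Matrix.isUnit_nonsing_inv_det _ hdu)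
  · rw [hinv, Matrix.mul_assoc]
    have := key (u * X)
    rwa [map_mul, aeval_X] at this
  · rw [Matrix.mul_assoc, Matrix.nonsing_inv_mul _ hdu, Matrix.mul_one]
  · rw [aeval_mL]
    have e1 : mL (aeval L (∑ i, cof χ i)) * mL (aeval L (∑ i, cof χ i))⁻¹ = 1 := by
      rw [← map_mul, Matrix.mul_nonsing_inv _ hdu, map_one]
    have e2 : mL (aeval L (∑ i, cof χ i))⁻¹ * mL (aeval L (∑ i, cof χ i)) = 1 := by
      rw [← map_mul, Matrix.nonsing_inv_mul _ hdu, map_one]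
    exact (Ring.inverse_unit ⟨_, _, e1, e2⟩).symm

lemma h_smooth {n k : ℕ} {U : Set (Fin n → ℝ)} {g L : (Fin n → ℝ) → Matrix (Fin n) (Fin n) ℝ}
    (hcomp : IsCompatiblePair U g L) {χ : Fin k → (Fin n → ℝ) → ℝ[X]} (hχ : ∀ i, SmP U (χ i))
    (hc : ∀ x ∈ U, ∀ i j, i ≠ j → IsCoprime (χ i x) (χ j x))
    (hchar : ∀ x ∈ U, (L x).charpoly = ∏ i, χ i x) :
    ContDiffOn ℝ (⊤ : ℕ∞)
      (fun x => mG (g x * (aeval (L x) (∑ i, cof (fun i => χ i x) i))⁻¹)) U := by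
  obtain ⟨c1, c2, c3, c4⟩ := hcomp
  have hL := mL_contDiffOn c2
  have h2 : ContDiffOn ℝ (⊤ : ℕ∞)
      (fun x => aeval (mL (L x)) (∑ i, cof (fun i => χ i x) i)) U :=
    SmP.aeval (SmP.sum _ fun i => SmP.prod _ hχ) hL
  have h3 : ContDiffOn ℝ (⊤ : ℕ∞)
      (fun x => Ring.inverse (aeval (mL (L x)) (∑ i, cof (fun i => χ i x) i))) U := by
    intro x hx
    obtain ⟨s1, s2, s3, s4⟩ := c3 x hx
    obtain ⟨u, -, hu, -⟩ := sumcof_unit (hc x hx) (ptwise s1 s2 s4 (hc x hx) (hchar x hx)).1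
    obtain ⟨w, hw⟩ := hu
    have h3 : ContDiffAt ℝ (⊤ : ℕ∞) Ring.inverse
        (aeval (mL (L x)) (∑ i, cof (fun i => χ i x) i)) := by
      rw [← hw]; exact contDiffAt_ringInverse ℝ w
    exact ContDiffAt.comp_contDiffWithinAt (g := Ring.inverse)
      (f := fun x => aeval (mL (L x)) (∑ i, cof (fun i => χ i x) i)) x h3 (h2 x hx)
  apply mG_contDiffOn
  intro i j
  have h4 : ContDiffOn ℝ (⊤ : ℕ∞) (fun x => mG (g x) (Pi.single i 1)
      (Ring.inverse (aeval (mL (L x)) (∑ i, cof (fun i => χ i x) i)) (Pi.single j 1))) U :=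
    ((mG_contDiffOn c1).clm_apply contDiffOn_const).clm_apply (h3.clm_apply contDiffOn_const)
  refine h4.congr fun x hx => ?_
  obtain ⟨s1, s2, s3, s4⟩ := c3 x hx
  refine (mG_single (g x * (aeval (L x) (∑ i, cof (fun i => χ i x) i))⁻¹) i j).symm.trans ?_
  rw [mG_mul, (ptwise s1 s2 s4 (hc x hx) (hchar x hx)).2.2.2.2.2.2]

lemma pull_smooth {n k : ℕ} {d : Fin k → ℕ} {D : Set (((i : Fin k) × Fin (d i)) → ℝ)}
    (hD : IsOpen D) {U : Set (Fin n → ℝ)}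
    {φ : (((i : Fin k) × Fin (d i)) → ℝ) → (Fin n → ℝ)} (hφ : ContDiffOn ℝ (⊤ : ℕ∞) φ D)
    (hφU : Set.MapsTo φ D U) {g : (Fin n → ℝ) → Matrix (Fin n) (Fin n) ℝ}
    (hg : ContDiffOn ℝ (⊤ : ℕ∞) (fun y => mG (g y)) U) :
    ContDiffOn ℝ (⊤ : ℕ∞) (fun x => mG (Matrix.of fun a b =>
      mG (g (φ x)) (fderiv ℝ φ x (Pi.single a 1)) (fderiv ℝ φ x (Pi.single b 1)))) D := by
  have h1 : ContDiffOn ℝ (⊤ : ℕ∞) (fun x => fderiv ℝ φ x) D :=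
    hφ.fderiv_of_isOpen hD (by simp)
  have h2 : ContDiffOn ℝ (⊤ : ℕ∞) (fun x => mG (g (φ x))) D := hg.comp hφ hφU
  apply mG_contDiffOn
  intro a b
  exact (h2.clm_apply (h1.clm_apply contDiffOn_const)).clm_apply (h1.clm_apply contDiffOn_const)

lemma pullL_smooth {n k : ℕ} {d : Fin k → ℕ} {D : Set (((i : Fin k) × Fin (d i)) → ℝ)}
    (hD : IsOpen D) {U : Set (Fin n → ℝ)}
    {φ : (((i : Fin k) × Fin (d i)) → ℝ) → (Fin n → ℝ)} (hφ : ContDiffOn ℝ (⊤ : ℕ∞) φ D)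
    (hφU : Set.MapsTo φ D U)
    (hJ : ∀ x ∈ D, ∃ J : (((i : Fin k) × Fin (d i)) → ℝ) ≃L[ℝ] (Fin n → ℝ),
        (J : _ →L[ℝ] (Fin n → ℝ)) = fderiv ℝ φ x)
    {L : (Fin n → ℝ) → (Fin n → ℝ) →L[ℝ] (Fin n → ℝ)} (hL : ContDiffOn ℝ (⊤ : ℕ∞) L U) :
    ContDiffOn ℝ (⊤ : ℕ∞) (fun x => (ContinuousLinearMap.inverse (fderiv ℝ φ x)).comp
      ((L (φ x)).comp (fderiv ℝ φ x))) D := by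
  have h1 : ContDiffOn ℝ (⊤ : ℕ∞) (fun x => fderiv ℝ φ x) D :=
    hφ.fderiv_of_isOpen hD (by simp)
  have h2 : ContDiffOn ℝ (⊤ : ℕ∞) (fun x => L (φ x)) D := hL.comp hφ hφU
  have h3 : ContDiffOn ℝ (⊤ : ℕ∞)
      (fun x => ContinuousLinearMap.inverse (fderiv ℝ φ x)) D := by
    intro x hx
    obtain ⟨J, hJ⟩ := hJ x hx
    have h3 : ContDiffAt ℝ (⊤ : ℕ∞) ContinuousLinearMap.inverse (fderiv ℝ φ x) := by
      rw [← hJ]; exact contDiffAt_map_inverse J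
    exact ContDiffAt.comp_contDiffWithinAt (g := ContinuousLinearMap.inverse)
      (f := fun x => fderiv ℝ φ x) x h3 (h1 x hx)
  exact h3.clm_comp (h2.clm_comp h1)

lemma core {n k : ℕ} {d : Fin k → ℕ} {U : Set (Fin n → ℝ)} (hU : IsOpen U) {p : Fin n → ℝ}
    (hp : p ∈ U) {g L : (Fin n → ℝ) → Matrix (Fin n) (Fin n) ℝ}
    (hcomp : IsCompatiblePair U g L)
    {χ : Fin k → (Fin n → ℝ) → ℝ[X]} (hχ : ∀ i, SmP U (χ i))
    (hmon : ∀ x ∈ U, ∀ i, (χ i x).Monic) (hd : ∀ x ∈ U, ∀ i, (χ i x).natDegree = d i)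
    (hc : ∀ x ∈ U, ∀ i j, i ≠ j → IsCoprime (χ i x) (χ j x))
    (hchar : ∀ x ∈ U, (L x).charpoly = ∏ i, χ i x)
    {h : (Fin n → ℝ) → Matrix (Fin n) (Fin n) ℝ}
    (hh : ∀ x, h x = g x * (aeval (L x) (∑ i, cof (fun i => χ i x) i))⁻¹) :
    ∃ (W : ∀ i : Fin k, Set (Fin (d i) → ℝ))
      (hB LB : ∀ i : Fin k, (Fin (d i) → ℝ) → Matrix (Fin (d i)) (Fin (d i)) ℝ)
      (φ : (((i : Fin k) × Fin (d i)) → ℝ) → (Fin n → ℝ))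
      (D : Set (((i : Fin k) × Fin (d i)) → ℝ)),
      D = {x | ∀ i : Fin k, (fun a => x ⟨i, a⟩) ∈ W i} ∧
      (∀ i, IsOpen (W i)) ∧
      ContDiffOn ℝ (⊤ : ℕ∞) φ D ∧ Set.InjOn φ D ∧
      IsOpen (φ '' D) ∧ φ '' D ⊆ U ∧ p ∈ φ '' D ∧
      (∀ i, IsCompatiblePair (W i) (hB i) (LB i)) ∧
      (∀ x ∈ D,
        (∃ Jinv : Matrix ((i : Fin k) × Fin (d i)) (Fin n) ℝ,
          jacM φ x * Jinv = 1 ∧ Jinv * jacM φ x = 1) ∧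
        (jacM φ x)ᵀ * h (φ x) * jacM φ x
          = Matrix.blockDiagonal' (fun i => hB i (fun a => x ⟨i, a⟩)) ∧
        L (φ x) * jacM φ x
          = jacM φ x * Matrix.blockDiagonal' (fun i => LB i (fun a => x ⟨i, a⟩)) ∧
        ∀ i : Fin k, (LB i (fun a => x ⟨i, a⟩)).charpoly = χ i (φ x)) := by
  have hpt := fun x (hx : x ∈ U) => ptwise (hcomp.2.2.1 x hx).1 (hcomp.2.2.1 x hx).2.1
    (hcomp.2.2.1 x hx).2.2.2 (hc x hx) (hchar x hx)
  have hhs : ContDiffOn ℝ (⊤ : ℕ∞) (fun x => mG (h x)) U := by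
    simp_rw [hh]; exact h_smooth hcomp hχ hc hchar
  have hgs := mG_contDiffOn hcomp.1
  have hLs := mL_contDiffOn hcomp.2.1
  have hE := fun x (hx : x ∈ U) => EF_of_compat hU hcomp hx
  have hGd : ∀ x ∈ U, DifferentiableAt ℝ (fun y => mG (g y)) x := fun x hx =>
    (hgs.contDiffAt (hU.mem_nhds hx)).differentiableAt (by simp)
  have hLd : ∀ x ∈ U, DifferentiableAt ℝ (fun y => mL (L y)) x := fun x hx =>
    (hLs.contDiffAt (hU.mem_nhds hx)).differentiableAt (by simp)
  have hGs : ∀ x ∈ U, ∀ X Y, mG (g x) X Y = mG (g x) Y X := fun x hx =>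
    (sym_iff _).1 (hcomp.2.2.1 x hx).1
  have hGL : ∀ x ∈ U, ∀ X Y, mG (g x) (mL (L x) X) Y = mG (g x) X (mL (L x) Y) := fun x hx =>
    self_of_sym (hcomp.2.2.1 x hx).1 (hcomp.2.2.1 x hx).2.2.2
  have hN : ∀ x ∈ U, Nij (mL (L x)) (fderiv ℝ (fun y => mL (L y)) x) := by
    intro x hx
    refine nij_of_EF (G := fun y => mG (g y)) (L := fun y => mL (L y)) (hGd x hx) (hLd x hx)
      ?_ ?_ (mG_nd (hcomp.2.2.1 x hx).2.1) (hE x hx)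
    · filter_upwards [hU.mem_nhds hx] with y hy using hGs y hy
    · filter_upwards [hU.mem_nhds hx] with y hy using hGL y hy
  have h0 : ∀ x ∈ U, aeval (mL (L x)) (∏ i, χ i x) = 0 := fun x hx => (hpt x hx).1
  obtain ⟨x0, ε, φ, hε, hφ0, hφs, hφi, hφo, hφU, hJ⟩ :=
    local_chart hU hp hLs hχ hmon hd hc hchar h0 hN
  have hDo : IsOpen (Metric.ball x0 ε) := Metric.isOpen_ball
  let G' := fun x => mG (Matrix.of fun a b =>
      mG (g (φ x)) (fderiv ℝ φ x (Pi.single a 1)) (fderiv ℝ φ x (Pi.single b 1)))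
  let H' := fun x => mG (Matrix.of fun a b =>
      mG (h (φ x)) (fderiv ℝ φ x (Pi.single a 1)) (fderiv ℝ φ x (Pi.single b 1)))
  let L' := fun x => (ContinuousLinearMap.inverse (fderiv ℝ φ x)).comp
      ((mL (L (φ x))).comp (fderiv ℝ φ x))
  have hG'c : ContDiffOn ℝ (⊤ : ℕ∞) G' (Metric.ball x0 ε) := pull_smooth hDo hφs hφU hgs
  have hH'c : ContDiffOn ℝ (⊤ : ℕ∞) H' (Metric.ball x0 ε) := pull_smooth hDo hφs hφU hhs
  have hL'c : ContDiffOn ℝ (⊤ : ℕ∞) L' (Metric.ball x0 ε) :=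
    pullL_smooth hDo hφs hφU (fun x hx => (hJ x hx).imp fun J hJ => hJ.1) hLs
  have hG'e : ∀ x ∈ Metric.ball x0 ε, ∀ X Y,
      G' x X Y = mG (g (φ x)) (fderiv ℝ φ x X) (fderiv ℝ φ x Y) := fun x hx X Y =>
    mG_of_clm (mG (g (φ x))) (fderiv ℝ φ x) X Y
  have hH'e : ∀ x ∈ Metric.ball x0 ε, ∀ X Y,
      H' x X Y = mG (h (φ x)) (fderiv ℝ φ x X) (fderiv ℝ φ x Y) := fun x hx X Y =>
    mG_of_clm (mG (h (φ x))) (fderiv ℝ φ x) X Y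
  have hL'e : ∀ x ∈ Metric.ball x0 ε, ∀ X,
      fderiv ℝ φ x (L' x X) = mL (L (φ x)) (fderiv ℝ φ x X) := by
    intro x hx X
    obtain ⟨J, hJ1, -⟩ := hJ x hx
    show fderiv ℝ φ x (ContinuousLinearMap.inverse (fderiv ℝ φ x)
      (mL (L (φ x)) (fderiv ℝ φ x X))) = _
    rw [← hJ1, ContinuousLinearMap.inverse_equiv]
    exact J.apply_symm_apply _
  have S : SData (Metric.ball x0 ε) G' H' L' (fun i x => χ i (φ x)) cpr := by
    refine SData_pullback (G := fun y => mG (g y)) (H := fun y => mG (h y))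
      (L := fun y => mL (L y)) hDo (convex_ball x0 ε) hφs hφU hJ
      (fun x hx => (hG'c.contDiffAt (hDo.mem_nhds hx)).differentiableAt (by simp))
      (fun x hx => (hH'c.contDiffAt (hDo.mem_nhds hx)).differentiableAt (by simp))
      (fun x hx => (hL'c.contDiffAt (hDo.mem_nhds hx)).differentiableAt (by simp))
      hG'e hH'e hL'e hGd hLd hχ hmon hc h0 hGs hGL ?_ ?_ ?_ ?_ hE
    · intro x hx
      rw [← sym_iff, hh]; exact (hpt x hx).2.2.1
    · intro x hx
      apply self_of_sym
      · rw [hh]; exact (hpt x hx).2.2.1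
      · rw [hh]; exact (hpt x hx).2.2.2.2.1
    · intro x hx
      apply mG_nd
      rw [hh]; exact (hpt x hx).2.2.2.1
    · intro x hx X Y
      show mG (g x) X Y = mG (h x) X (aeval (mL (L x)) _ Y)
      rw [aeval_mL, ← mG_mul, hh, (hpt x hx).2.2.2.2.2.1]
  have hdet : ∀ x ∈ Metric.ball x0 ε, ∀ t : ℝ,
      cdet (t • 1 - L' x) = (∏ i, χ i (φ x)).eval t := by
    intro x hx t
    rw [← hchar _ (hφU hx), ← cdet_of_charpoly]
    obtain ⟨J, hJ1, -⟩ := hJ x hx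
    refine cdet_conj J fun X => ?_
    have hJ2 : ∀ X, J X = fderiv ℝ φ x X := fun X => by rw [← hJ1]; rfl
    have := hL'e x hx X
    rw [hJ2, hJ2]
    simp [this]
  have hLu : ∀ x ∈ Metric.ball x0 ε, ∀ X, L' x X = 0 → X = 0 := by
    intro x hx X hX
    obtain ⟨J, hJ1, -⟩ := hJ x hx
    have hJ2 : ∀ X, J X = fderiv ℝ φ x X := fun X => by rw [← hJ1]; rfl
    have e := hL'e x hx X
    rw [hX, map_zero, mL_apply] at e
    have hu := (hcomp.2.2.1 _ (hφU hx)).2.2.1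
    have e2 : (L (φ x))⁻¹ *ᵥ (L (φ x) *ᵥ fderiv ℝ φ x X) = 0 := by
      rw [← e, Matrix.mulVec_zero]
    rw [Matrix.mulVec_mulVec, Matrix.nonsing_inv_mul _ hu, Matrix.one_mulVec, ← hJ2] at e2
    exact J.injective (by rw [e2, map_zero])
  obtain ⟨hB, LB, hcB, hx⟩ := blocks hε S hH'c hL'c hdet hLu
  refine ⟨fun i => Metric.ball (qi i x0) ε, hB, LB, φ, Metric.ball x0 ε, ?_,
    fun i => Metric.isOpen_ball, hφs, hφi, hφo, hφU.image_subset,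
    ⟨x0, Metric.mem_ball_self hε, hφ0⟩, hcB, ?_⟩
  · ext x; exact ball_iff hε
  intro x hxD
  obtain ⟨a1, a2, a3⟩ := hx x hxD
  obtain ⟨J, hJ1, -⟩ := hJ x hxD
  have hJ2 : ∀ X, J X = fderiv ℝ φ x X := fun X => by rw [← hJ1]; rfl
  have hφd : DifferentiableAt ℝ φ x :=
    (hφs.contDiffAt (hDo.mem_nhds hxD)).differentiableAt (by simp)
  have hjac : jacM φ x = LinearMap.toMatrix' (J.toLinearEquiv.toLinearMap) := by
    apply Matrix.toLin'.injective
    ext1 a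
    ext c
    simp [jacM_apply hφd, hJ2]
  refine ⟨⟨LinearMap.toMatrix' (J.symm.toLinearEquiv.toLinearMap), ?_, ?_⟩, ?_, ?_, a3⟩
  · rw [hjac, ← LinearMap.toMatrix'_comp, ← LinearMap.toMatrix'_id]
    congr 1
    ext1 a
    ext c
    simp
  · rw [hjac, ← LinearMap.toMatrix'_comp, ← LinearMap.toMatrix'_id]
    congr 1
    ext1 a
    ext c
    simp
  · ext a b
    have e := a1 (Pi.single a 1) (Pi.single b 1)
    rw [hH'e x hxD, ← jacM_apply hφd, ← jacM_apply hφd, mG_single, mG_apply] at e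
    rw [Matrix.mul_assoc]
    refine Eq.trans ?_ e
    refine (mG_single ((jacM φ x)ᵀ * (h (φ x) * jacM φ x)) a b).symm.trans ?_
    rw [mG_apply, ← Matrix.mulVec_mulVec, ← Matrix.mulVec_mulVec,
      Matrix.dotProduct_mulVec, Matrix.vecMul_transpose]
  · apply Matrix.toLin'.injective
    apply LinearMap.ext
    intro X
    have e := hL'e x hxD X
    rw [a2, mL_apply, mL_apply, ← jacM_apply hφd, ← jacM_apply hφd] at e
    rw [Matrix.toLin'_apply, Matrix.toLin'_apply, ← Matrix.mulVec_mulVec, ← Matrix.mulVec_mulVec]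
    exact e.symm

end Core
end PartP16

/-- Splitting Lemma in local coordinates. -/
theorem splitting_lemma
    (n k r : ℕ) (hrk : r ≤ k)
    (U : Set (Fin n → ℝ)) (hU : IsOpen U)
    (g L : (Fin n → ℝ) → Matrix (Fin n) (Fin n) ℝ)
    (hcomp : IsCompatiblePair U g L)
    (p : Fin n → ℝ) (hp : p ∈ U)
    (lam : Fin k → (Fin n → ℝ) → ℂ) (m : Fin k → ℕ) (hm : ∀ i, 0 < m i)
    (hsmooth : ∀ i, ContDiffOn ℝ (⊤ : ℕ∞) (lam i) U)
    (hcomplex : ∀ i : Fin k, (i : ℕ) < r → ∀ x ∈ U, (lam i x).im ≠ 0)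
    (hrealev : ∀ i : Fin k, r ≤ (i : ℕ) → ∀ x ∈ U, (lam i x).im = 0)
    (hdistinct : ∀ x ∈ U, ∀ i j : Fin k, i ≠ j →
      lam i x ≠ lam j x ∧ lam i x ≠ (starRingEnd ℂ) (lam j x))
    -- the complex eigenvalues of L(x) are exactly the λ_i(x) (and their conjugates,
    -- for i ≤ r) with constant algebraic multiplicities m_i: the characteristic
    -- polynomial factors accordingly, where (t-λ)(t-conj λ) = t² - 2(Re λ)t + |λ|².
    (hchar : ∀ x ∈ U, (L x).charpoly =
      ∏ i : Fin k, (if (i : ℕ) < r then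
        (X ^ 2 - C (2 * (lam i x).re) * X + C (Complex.normSq (lam i x))) ^ (m i)
      else (X - C ((lam i x).re)) ^ (m i))) :
    let χ : Fin k → (Fin n → ℝ) → Polynomial ℝ := fun i x =>
      if (i : ℕ) < r then
        (X ^ 2 - C (2 * (lam i x).re) * X + C (Complex.normSq (lam i x))) ^ (m i)
      else (X - C ((lam i x).re)) ^ (m i)
    let χhat : (Fin n → ℝ) → Polynomial ℝ := fun x =>
      ∑ i : Fin k, ∏ j ∈ Finset.univ.erase i, χ j x
    let h : (Fin n → ℝ) → Matrix (Fin n) (Fin n) ℝ :=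
      fun x => g x * (Polynomial.aeval (L x) (χhat x))⁻¹
    let sz : Fin k → ℕ := fun i => if (i : ℕ) < r then 2 * m i else m i
    (∀ x ∈ U, IsUnit (Polynomial.aeval (L x) (χhat x)).det ∧
      (h x).IsSymm ∧ IsUnit (h x).det) ∧
    ∃ (W : ∀ i : Fin k, Set (Fin (sz i) → ℝ))
      (hB LB : ∀ i : Fin k, (Fin (sz i) → ℝ) → Matrix (Fin (sz i)) (Fin (sz i)) ℝ)
      (φ : (((i : Fin k) × Fin (sz i)) → ℝ) → (Fin n → ℝ)),
      let D : Set (((i : Fin k) × Fin (sz i)) → ℝ) :=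
        {x | ∀ i : Fin k, (fun a => x ⟨i, a⟩) ∈ W i}
      (∀ i, IsOpen (W i)) ∧
      ContDiffOn ℝ (⊤ : ℕ∞) φ D ∧ Set.InjOn φ D ∧
      IsOpen (φ '' D) ∧ φ '' D ⊆ U ∧ p ∈ φ '' D ∧
      (∀ i, IsCompatiblePair (W i) (hB i) (LB i)) ∧
      (∀ x ∈ D,
        (∃ Jinv : Matrix ((i : Fin k) × Fin (sz i)) (Fin n) ℝ,
          jacM φ x * Jinv = 1 ∧ Jinv * jacM φ x = 1) ∧
        (jacM φ x)ᵀ * h (φ x) * jacM φ x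
          = Matrix.blockDiagonal' (fun i => hB i (fun a => x ⟨i, a⟩)) ∧
        L (φ x) * jacM φ x
          = jacM φ x * Matrix.blockDiagonal' (fun i => LB i (fun a => x ⟨i, a⟩)) ∧
        ∀ i : Fin k,
          (if (i : ℕ) < r then
            spectrum ℂ ((LB i (fun a => x ⟨i, a⟩)).map (algebraMap ℝ ℂ))
              = {lam i (φ x), (starRingEnd ℂ) (lam i (φ x))}
          else
            spectrum ℂ ((LB i (fun a => x ⟨i, a⟩)).map (algebraMap ℝ ℂ))
              = {lam i (φ x)})) := by
  intro χ χhat h sz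
  have hc : ∀ x ∈ U, ∀ i j, i ≠ j → IsCoprime (χ i x) (χ j x) := fun x hx i j hij =>
    chi_coprime (r := r) (i := i) (j := j) (fun hi => hrealev i (not_lt.1 hi) x hx)
      (fun hj => hrealev j (not_lt.1 hj) x hx) (hdistinct x hx i j hij).1
      (hdistinct x hx i j hij).2 (m i) (m j)
  have hch : ∀ x ∈ U, (L x).charpoly = ∏ i, χ i x := hchar
  refine ⟨fun x hx => ?_, ?_⟩
  · obtain ⟨s1, s2, s3, s4⟩ := hcomp.2.2.1 x hx
    obtain ⟨-, b1, b2, b3, -⟩ := ptwise s1 s2 s4 (hc x hx) (hch x hx)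
    exact ⟨b1, b2, b3⟩
  · obtain ⟨W, hB, LB, φ, D, hD, c1, c2, c3, c4, c5, c6, c7, c8⟩ :=
      core (d := sz) hU hp hcomp (χ := χ) (fun i => chi_smP (hsmooth i) r i (m i))
        (fun x _ i => chi_monic r i (lam i x) (m i))
        (fun x _ i => chi_natDegree r i (lam i x) (m i)) hc hch (h := h) (fun x => rfl)
    subst hD
    refine ⟨W, hB, LB, φ, c1, c2, c3, c4, c5, c6, c7, fun x hx => ?_⟩
    obtain ⟨e1, e2, e3, e4⟩ := c8 x hx
    refine ⟨e1, e2, e3, fun i => ?_⟩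
    split_ifs with hi
    · exact spec_lt hi (hm i) (e4 i)
    · exact spec_ge hi (hrealev i (not_lt.1 hi) _ (c5 ⟨x, hx, rfl⟩)) (hm i) (e4 i)
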